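/- arXiv:2305.14541 — 10 statements merged into one kernel-verified Lean document; each statement's English description precedes it below -/
import Mathlib

section
/- Converse part of Theorem 1. Let q ≥ 2 be an integer and let p, r ∈ [0,1] satisfy 2p + r < (q−1)/q. Let ε > 0 and set R = C₀(q,p,r) + ε. Then for every constant B ∈ ℕ there exists n₀ such that for all n ≥ n₀, every B-bit feedback code of blocklength n with message set of size at least q^{Rn} has two distinct messages m₁ ≠ m₂ that are confusable; in particular no such code is zero-error against (p,r). -/
/-- The q-ary entropy function: `H_q(x) = x·log_q(q−1) − x·log_q(x) − (1−x)·log_q(1−x)`.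
With the convention `Real.logb b 0 = 0` this gives `H_q(0) = 0` and `H_q(1) = log_q(q−1)`. -/
noncomputable def Hq (q : ℕ) (x : ℝ) : ℝ :=
  x * Real.logb q ((q : ℝ) - 1) - x * Real.logb q x - (1 - x) * Real.logb q (1 - x)

/-- `α(p̄) = 1 − (2q/(q−1))(p − p̄) − (q/(q−1))r`. -/
noncomputable def alphaEE (q : ℕ) (p r pb : ℝ) : ℝ :=
  1 - (2 * (q : ℝ) / ((q : ℝ) - 1)) * (p - pb) - ((q : ℝ) / ((q : ℝ) - 1)) * r

/-- `C₀(q,p,r) = min_{p̄ ∈ [0,p]} α(p̄)·(1 − H_q(p̄/α(p̄)))` (the minimum is attained,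
so it equals the infimum). -/
noncomputable def C0 (q : ℕ) (p r : ℝ) : ℝ :=
  sInf ((fun pb => alphaEE q p r pb * (1 - Hq q (pb / alphaEE q p r pb))) '' Set.Icc 0 p)

/-- The q-ary input alphabet `X = {0,…,q−1}`. -/
abbrev Xq (q : ℕ) := Fin q

/-- The output alphabet `Y = X ∪ {?}`; `none` is the erasure symbol `?`. -/
abbrev Yq (q : ℕ) := Option (Fin q)

/-- A `B`-bit feedback code of blocklength `n` over a `q`-ary alphabet with message set `M`:
feedback times `0 = t 0 < t 1 < ⋯ < t T < t (T+1) = n`, a finite feedback alphabet `Z` with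
`T·log₂|Z| ≤ B`, feedback functions `f k : Y^{t (k+1)} → Z` (the `(k+1)`-st feedback symbol
is computed from the received prefix of length `t (k+1)`, for `k = 0,…,T−1` i.e. 1-indexed
`1,…,T`), encoding functions `enc k : M × Z^k → X^{t (k+1) − t k}` producing the `(k+1)`-st
sub-codeword from the message and the feedback received so far, and a decoder `dec`. -/
structure FeedbackCode (q n B : ℕ) (M : Type*) where
  T : ℕ
  t : ℕ → ℕ
  ht0 : t 0 = 0
  htn : t (T + 1) = n
  htlt : ∀ k, k ≤ T → t k < t (k + 1)
  Z : Type
  instZ : Fintype Z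
  hB : (T : ℝ) * Real.logb 2 (@Fintype.card Z instZ) ≤ B
  f : (k : Fin T) → ((Fin (t (k.val + 1))) → Yq q) → Z
  enc : (k : Fin (T + 1)) → M → (Fin k.val → Z) → (Fin (t (k.val + 1) - t k.val) → Xq q)
  dec : (Fin n → Yq q) → M

namespace FeedbackCode

variable {q n B : ℕ} {M : Type*} (c : FeedbackCode q n B M)

theorem t_mono : ∀ {k j : ℕ}, k ≤ j → j ≤ c.T + 1 → c.t k ≤ c.t j := by
  intro k j hkj hj
  induction j with
  | zero => simp [Nat.le_zero.mp hkj]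
  | succ j ih =>
    rcases Nat.eq_or_lt_of_le hkj with h | h
    · exact le_of_eq (congrArg c.t h)
    · exact le_trans (ih (Nat.lt_succ_iff.mp h) (by omega))
        (le_of_lt (c.htlt j (by omega)))

theorem t_le_n {k : ℕ} (hk : k ≤ c.T + 1) : c.t k ≤ n := by
  have := c.t_mono hk (le_refl _)
  rwa [c.htn] at this

/-- The feedback symbols determined by a full received sequence `y`:
`zseq y k = f k (y₁,…,y_{t (k+1)})`. -/
def zseq (y : Fin n → Yq q) (k : Fin c.T) : c.Z :=
  c.f k (fun i => y ⟨i.val, lt_of_lt_of_le i.isLt (c.t_le_n (by have := k.isLt; omega))⟩)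

/-- The index of the sub-codeword (block) containing position `i`:
the largest `k ≤ T` with `t k ≤ i`. -/
def blockIdx (i : ℕ) : ℕ := Nat.findGreatest (fun k => c.t k ≤ i) c.T

theorem blockIdx_le (i : ℕ) : c.blockIdx i ≤ c.T := Nat.findGreatest_le _

theorem t_blockIdx_le (i : ℕ) : c.t (c.blockIdx i) ≤ i :=
  Nat.findGreatest_spec (P := fun k => c.t k ≤ i) (Nat.zero_le _) (by simp [c.ht0])

theorem lt_t_blockIdx_succ {i : ℕ} (hi : i < n) : i < c.t (c.blockIdx i + 1) := by
  by_cases h : c.blockIdx i = c.T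
  · rw [h, c.htn]; exact hi
  · have h1 : c.blockIdx i + 1 ≤ c.T := by have := c.blockIdx_le i; omega
    have h2 := Nat.findGreatest_is_greatest (P := fun k => c.t k ≤ i)
      (Nat.lt_succ_self (c.blockIdx i)) h1
    simp only [Nat.succ_eq_add_one] at h2
    omega

/-- The codeword symbol transmitted at position `i` when the message is `m` and the
received sequence is `y`: the concatenation over blocks of
`enc k m (z₁(y),…,z_k(y))`. It depends only on the values of `y` at positions `< i`. -/
def xword (m : M) (y : Fin n → Yq q) (i : Fin n) : Xq q :=
  c.enc ⟨c.blockIdx i.val, Nat.lt_succ_of_le (c.blockIdx_le i.val)⟩ m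
    (fun j => c.zseq y ⟨j.val, lt_of_lt_of_le j.isLt (c.blockIdx_le i.val)⟩)
    ⟨i.val - c.t (c.blockIdx i.val), by
      show i.val - c.t (c.blockIdx i.val) < c.t (c.blockIdx i.val + 1) - c.t (c.blockIdx i.val)
      have h1 := c.t_blockIdx_le i.val
      have h2 := c.lt_t_blockIdx_succ i.isLt
      omega⟩

/-- Number of erased positions of a received sequence. -/
noncomputable def numErasures (y : Fin n → Yq q) : ℕ :=
  Nat.card {i : Fin n // y i = none}

/-- Number of unerased positions of `y` whose symbol differs from the transmitted
codeword `x(m,y)`. -/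
noncomputable def numErrors (m : M) (y : Fin n → Yq q) : ℕ :=
  Nat.card {i : Fin n // y i ≠ none ∧ y i ≠ some (c.xword m y i)}

/-- `y` is `(p,r)`-admissible for the message `m`: at most `rn` erasures and at most
`pn` symbol errors. -/
def Admissible (p r : ℝ) (m : M) (y : Fin n → Yq q) : Prop :=
  (numErasures (q := q) y : ℝ) ≤ r * n ∧ (c.numErrors m y : ℝ) ≤ p * n

/-- The code is zero-error against `(p,r)`: the decoder recovers every message from every
`(p,r)`-admissible received sequence. -/
def ZeroError (p r : ℝ) : Prop :=
  ∀ m : M, ∀ y : Fin n → Yq q, c.Admissible p r m y → c.dec y = m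

end FeedbackCode

/-- Two distinct messages are confusable if some received sequence is
`(p,r)`-admissible for both of them (so no decoder can decode both correctly). -/
def FeedbackCode.Confusable {q n B : ℕ} {M : Type*} (c : FeedbackCode q n B M)
    (p r : ℝ) (m₁ m₂ : M) : Prop :=
  m₁ ≠ m₂ ∧ ∃ y : Fin n → Yq q, c.Admissible p r m₁ y ∧ c.Admissible p r m₂ y


theorem Nat.factorial_mul_pow_le_factorial_mul_pow_self (e k : ℕ) :
    e.factorial * e ^ k ≤ k.factorial * e ^ e := by
  rcases le_total e k with h | h
  · calc e.factorial * e ^ k = e.factorial * e ^ (k - e) * e ^ e := by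
          rw [mul_assoc, ← pow_add, Nat.sub_add_cancel h]
      _ ≤ k.factorial * e ^ e :=
          Nat.mul_le_mul_right _ (Nat.factorial_mul_pow_sub_le_factorial h)
  · calc e.factorial * e ^ k
          = k.factorial * e.descFactorial (e - k) * e ^ k := by
          have := Nat.factorial_mul_descFactorial (Nat.sub_le e k)
          rw [Nat.sub_sub_self h] at this
          rw [this]
      _ ≤ k.factorial * e ^ (e - k) * e ^ k := by
          gcongr
          exact Nat.descFactorial_le_pow _ _
      _ = k.factorial * e ^ e := by rw [mul_assoc, ← pow_add, Nat.sub_add_cancel h]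

/-- The mode of the binomial weights with parameters `a` and `e / a` is `e`. -/
theorem Nat.choose_mul_pow_mul_pow_le (a e k : ℕ) (he : e ≤ a) (hk : k ≤ a) :
    a.choose k * e ^ k * (a - e) ^ (a - k) ≤ a.choose e * e ^ e * (a - e) ^ (a - e) := by
  have h1 := Nat.factorial_mul_pow_le_factorial_mul_pow_self e k
  have h2 := Nat.factorial_mul_pow_le_factorial_mul_pow_self (a - e) (a - k)
  have h3 := Nat.choose_mul_factorial_mul_factorial he
  have h4 := Nat.choose_mul_factorial_mul_factorial hk
  have hpos : 0 < e.factorial * (a - e).factorial * (k.factorial * (a - k).factorial) := by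
    positivity
  refine Nat.le_of_mul_le_mul_left ?_ hpos
  calc e.factorial * (a - e).factorial * (k.factorial * (a - k).factorial) *
        (a.choose k * e ^ k * (a - e) ^ (a - k))
      = (a.choose k * k.factorial * (a - k).factorial) *
        ((e.factorial * e ^ k) * ((a - e).factorial * (a - e) ^ (a - k))) := by ring
    _ ≤ (a.choose k * k.factorial * (a - k).factorial) *
        ((k.factorial * e ^ e) * ((a - k).factorial * (a - e) ^ (a - e))) := by gcongr
    _ = (a.choose e * e.factorial * (a - e).factorial) *
        ((k.factorial * e ^ e) * ((a - k).factorial * (a - e) ^ (a - e))) := by rw [h3, h4]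
    _ = _ := by ring

theorem Nat.self_pow_le_succ_mul_choose_mul (a e : ℕ) (he : e ≤ a) :
    a ^ a ≤ (a + 1) * (a.choose e * e ^ e * (a - e) ^ (a - e)) := by
  calc a ^ a = (e + (a - e)) ^ a := by rw [Nat.add_sub_cancel' he]
    _ = ∑ k ∈ Finset.range (a + 1), e ^ k * (a - e) ^ (a - k) * a.choose k := by
        rw [add_pow]; simp
    _ ≤ ∑ k ∈ Finset.range (a + 1), a.choose e * e ^ e * (a - e) ^ (a - e) := by
        refine Finset.sum_le_sum fun k hk => ?_
        have := Nat.choose_mul_pow_mul_pow_le a e k he (by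
          have := Finset.mem_range.1 hk; omega)
        calc _ = a.choose k * e ^ k * (a - e) ^ (a - k) := by ring
          _ ≤ _ := this
    _ = _ := by simp

/-- Lower bound on the logarithm of a binomial coefficient in terms of entropy. -/
theorem Real.entropy_le_log_choose (n a e : ℕ) (hn : 0 < n) (han : a ≤ n) (he : e ≤ a) :
    n * (Real.negMulLog (e / n) + Real.negMulLog (a / n - e / n) - Real.negMulLog (a / n))
      ≤ Real.log (a.choose e) + Real.log (n + 1) := by
  have hn' : (n : ℝ) ≠ 0 := by positivity
  have h0 : ∀ m : ℕ, (0 : ℝ) < (m : ℝ) ^ m := by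
    intro m
    rcases Nat.eq_zero_or_pos m with rfl | h
    · simp
    · positivity
  have hc : (0 : ℝ) < a.choose e := by exact_mod_cast Nat.choose_pos he
  have h1 := Nat.self_pow_le_succ_mul_choose_mul a e he
  have h2 : ((a : ℝ) ^ a) ≤
      (a + 1) * (a.choose e * (e : ℝ) ^ e * ((a - e : ℕ) : ℝ) ^ (a - e)) := by exact_mod_cast h1
  have h3 := Real.log_le_log (h0 a) h2
  rw [Real.log_mul (by positivity) (by have := h0 e; have := h0 (a - e); positivity),
    Real.log_mul (by have := h0 e; positivity) (h0 _).ne', Real.log_mul hc.ne' (h0 _).ne',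
    Real.log_pow, Real.log_pow, Real.log_pow] at h3
  have h4 : Real.log ((a : ℝ) + 1) ≤ Real.log (n + 1) := by
    have : (a : ℝ) ≤ n := by exact_mod_cast han
    exact Real.log_le_log (by positivity) (by linarith)
  have key : ∀ x : ℝ, -(x * n * Real.log (x * n)) =
      n * Real.negMulLog x + x * Real.negMulLog n := by
    intro x
    have := Real.negMulLog_mul x n
    rw [← this, Real.negMulLog]; ring
  have ka := key (a / n)
  have ke := key (e / n)
  have kd := key (a / n - e / n)
  rw [← sub_div, div_mul_cancel₀ _ hn', ← Nat.cast_sub he] at kd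
  rw [div_mul_cancel₀ _ hn'] at ka ke
  rw [← sub_div, ← Nat.cast_sub he]
  have : (((a - e : ℕ) : ℝ) / n) = a / n - e / n := by rw [Nat.cast_sub he, sub_div]
  have e1 : (((a - e : ℕ) : ℝ) / n) * Real.negMulLog n =
    a / n * Real.negMulLog n - e / n * Real.negMulLog n := by rw [this]; ring
  linarith

open Finset in
/-- Lower bound on the volume of a Hamming ball. -/
theorem choose_mul_pow_le_card_weight_le {ι : Type*} [Fintype ι] [DecidableEq ι] (q : ℕ)
    [NeZero q] (e : ℕ) :
    (Fintype.card ι).choose e * (q - 1) ^ e ≤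
      #{v : ι → Fin q | #{i | v i ≠ 0} ≤ e} := by
  classical
  set F : Finset ι → Finset (ι → Fin q) := fun S =>
    Fintype.piFinset (fun i => if i ∈ S then univ.erase 0 else {0}) with hF
  have hmem : ∀ S v, v ∈ F S → ({i | v i ≠ 0} : Finset ι) = S := by
    intro S v hv
    ext i
    have := Fintype.mem_piFinset.1 hv i
    by_cases h : i ∈ S <;> simp_all
  have hcard : ∀ S, #(F S) = (q - 1) ^ #S := by
    intro S
    rw [hF, Fintype.card_piFinset]
    rw [← Finset.prod_subset (Finset.subset_univ S)]
    · rw [Finset.prod_congr rfl (g := fun _ => q - 1)]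
      · simp
      · intro i hi; simp [hi]
    · intro i _ hi; simp [hi]
  calc (Fintype.card ι).choose e * (q - 1) ^ e
      = ∑ S ∈ powersetCard e (univ : Finset ι), #(F S) := by
        rw [Finset.sum_congr rfl (g := fun _ => (q - 1) ^ e)]
        · simp
        · intro S hS; rw [hcard, (mem_powersetCard.1 hS).2]
    _ = #((powersetCard e (univ : Finset ι)).biUnion F) := by
        rw [card_biUnion]
        intro S _ S' _ hne
        refine Finset.disjoint_left.2 ?_
        intro v hv hv'
        exact hne ((hmem S v hv).symm.trans (hmem S' v hv'))
    _ ≤ _ := by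
        refine card_le_card fun v hv => ?_
        obtain ⟨S, hS, hv⟩ := mem_biUnion.1 hv
        simp only [mem_filter, mem_univ, true_and]
        rw [hmem S v hv, (mem_powersetCard.1 hS).2]

open Finset in
/-- When each transmitted symbol depends causally on the received word, the number of received
words with at most `e` errors is at least the volume of a Hamming sphere. -/
theorem choose_mul_pow_le_card_causal_errors_le {l : ℕ} (q : ℕ) [NeZero q] (e : ℕ)
    (x : (Fin l → Fin q) → Fin l → Fin q)
    (hx : ∀ i w w', (∀ j < i, w j = w' j) → x w i = x w' i) :
    l.choose e * (q - 1) ^ e ≤ #{w : Fin l → Fin q | #{i | w i ≠ x w i} ≤ e} := by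
  have hinj : Function.Injective (fun w : Fin l → Fin q => w - x w) := by
    intro w w' h
    funext i
    induction i using WellFoundedLT.induction with
    | _ i ih =>
      have h1 := congrFun h i
      simp only [Pi.sub_apply, hx i w w' ih] at h1
      exact sub_left_injective h1
  have := choose_mul_pow_le_card_weight_le (ι := Fin l) q e
  rw [Fintype.card_fin] at this
  refine this.trans (le_of_eq ?_)
  symm
  refine Finset.card_bijective _ ((Finite.injective_iff_bijective).1 hinj) ?_
  intro w
  simp [sub_eq_zero]

/-- A finite form of Ramsey's theorem for pairs, in sequential form. -/
theorem exists_list_pairwise_color (c : ℕ) (s : ℕ) : ∃ N : ℕ,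
    ∀ (M C : Type) [Fintype C], Fintype.card C ≤ c → ∀ χ : M → M → C,
      ∀ S : Finset M, N ≤ S.card → ∃ l : List (M × C), l.length = s ∧ (∀ a ∈ l, a.1 ∈ S) ∧
        l.Pairwise (fun a b => a.1 ≠ b.1 ∧ χ a.1 b.1 = a.2) := by
  classical
  induction s with
  | zero => exact ⟨0, fun M C _ _ χ S _ => ⟨[], by simp⟩⟩
  | succ s ih =>
    obtain ⟨N, hN⟩ := ih
    refine ⟨c * N + 1, fun M C _ hC χ S hS => ?_⟩
    obtain ⟨m, hm⟩ : S.Nonempty := Finset.card_pos.1 (by omega)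
    have : Nonempty C := ⟨χ m m⟩
    obtain ⟨d, -, hd⟩ := Finset.exists_le_card_fiber_of_mul_le_card_of_maps_to
      (s := S.erase m) (t := Finset.univ) (f := χ m) (n := N) (by simp)
      Finset.univ_nonempty (by
        rw [Finset.card_erase_of_mem hm, Finset.card_univ]
        have := Nat.mul_le_mul_right N hC
        omega)
    obtain ⟨l, hl, hlS, hlp⟩ := hN M C hC χ _ hd
    refine ⟨(m, d) :: l, by simp [hl], ?_, ?_⟩
    · intro a ha
      rcases List.mem_cons.1 ha with rfl | ha
      · exact hm
      · have := hlS a ha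
        simp at this
        exact this.1.2
    · refine List.pairwise_cons.2 ⟨fun a ha => ?_, hlp⟩
      have := hlS a ha
      simp at this
      exact ⟨fun h => this.1.1 h.symm, this.2⟩

/-- Ramsey's theorem for ordered pairs with a bounded number of colors. -/
theorem exists_injective_monochromatic (c K : ℕ) : ∃ N : ℕ,
    ∀ (M C : Type) [Fintype C], Fintype.card C ≤ c → ∀ χ : M → M → C,
      ∀ S : Finset M, N ≤ S.card → ∃ (g : Fin K → M) (z : C), (∀ i, g i ∈ S) ∧
        ∀ i j, i < j → g i ≠ g j ∧ χ (g i) (g j) = z := by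
  classical
  obtain ⟨N, hN⟩ := exists_list_pairwise_color c (c * K)
  refine ⟨max N 1, fun M C _ hC χ S hS => ?_⟩
  obtain ⟨l, hl, hlS, hlp⟩ := hN M C hC χ S (le_trans (le_max_left _ _) hS)
  obtain ⟨m, hm⟩ : S.Nonempty := Finset.card_pos.1 (by omega)
  have : Nonempty C := ⟨χ m m⟩
  obtain ⟨z, hz⟩ := Fintype.exists_le_card_fiber_of_mul_le_card
    (fun i : Fin l.length => (l.get i).2) (n := K) (by
      rw [Fintype.card_fin, hl]; exact Nat.mul_le_mul_right K hC)
  obtain ⟨T, hT, hTc⟩ := Finset.exists_subset_card_eq hz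
  refine ⟨fun i => (l.get (T.orderEmbOfFin hTc i)).1, z, fun i => hlS _ (List.get_mem _ _), ?_⟩
  intro i j hij
  have h1 := List.pairwise_iff_get.1 hlp (T.orderEmbOfFin hTc i) (T.orderEmbOfFin hTc j)
    ((T.orderEmbOfFin hTc).lt_iff_lt.2 hij)
  refine ⟨h1.1, h1.2.trans ?_⟩
  have := hT (Finset.orderEmbOfFin_mem T hTc i)
  simpa using this

/-- Among `K` letters from a `q`-ary alphabet, at least `K ^ 2 / q` ordered pairs agree. -/
theorem sq_card_le_mul_card_agreements {K q : ℕ} (f : Fin K → Fin q) :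
    (K : ℝ) ^ 2 ≤ q * ∑ i, ∑ j, if f i = f j then (1 : ℝ) else 0 := by
  have h1 : ∑ i, ∑ j, (if f i = f j then (1 : ℝ) else 0) =
      ∑ s, (∑ i, if f i = s then (1 : ℝ) else 0) ^ 2 := by
    simp_rw [sq, Finset.sum_mul_sum]
    symm
    rw [Finset.sum_comm]
    refine Finset.sum_congr rfl fun i _ => ?_
    rw [Finset.sum_comm]
    refine Finset.sum_congr rfl fun j _ => ?_
    simp [eq_comm]
  have h2 : ∑ s, (∑ i, if f i = s then (1 : ℝ) else 0) = K := by
    rw [Finset.sum_comm]; simp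
  have h3 := sq_sum_le_card_mul_sum_sq (s := (Finset.univ : Finset (Fin q)))
    (f := fun s => ∑ i, if f i = s then (1 : ℝ) else 0)
  rw [h2] at h3
  rw [h1]
  simpa using h3

open Finset in
/-- Plotkin's averaging bound. -/
theorem exists_lt_dist_le_plotkin {K q : ℕ} {ι : Type*} (hK : 2 ≤ K) (hq : 1 ≤ q)
    (a : Fin K → ι → Fin q) (P : Finset ι) :
    ∃ i j, i < j ∧ (q : ℝ) * (K - 1) * #{t ∈ P | a i t ≠ a j t} ≤ (q - 1) * K * #P := by
  by_contra! hcon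
  have hK' : (2 : ℝ) ≤ K := by exact_mod_cast hK
  have hq' : (1 : ℝ) ≤ q := by exact_mod_cast hq
  have hne : ∀ i j, i ≠ j → (q - 1) * K * (#P : ℝ) < q * (K - 1) * #{t ∈ P | a i t ≠ a j t} := by
    intro i j hij
    rcases lt_or_gt_of_ne hij with h | h
    · exact hcon i j h
    · simpa only [ne_comm] using hcon j i h
  have hcol : ∀ t, (q : ℝ) * ∑ i, ∑ j, (if a i t ≠ a j t then (1 : ℝ) else 0) ≤
      (q - 1) * K ^ 2 := by
    intro t
    have h1 := sq_card_le_mul_card_agreements (fun i => a i t)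
    have h2 : ∑ i, ∑ j, (if a i t ≠ a j t then (1 : ℝ) else 0) =
        K ^ 2 - ∑ i, ∑ j, (if a i t = a j t then (1 : ℝ) else 0) := by
      rw [eq_sub_iff_add_eq, ← Finset.sum_add_distrib]
      simp_rw [← Finset.sum_add_distrib]
      rw [Finset.sum_congr rfl (g := fun _ => (K : ℝ))]
      · simp [sq]
      · intro i _
        rw [Finset.sum_congr rfl (g := fun _ => (1 : ℝ))]
        · simp
        · intro j _; by_cases h : a i t = a j t <;> simp [h]
    rw [h2]; nlinarith
  have htot : (q : ℝ) * ∑ i, ∑ j, (#{t ∈ P | a i t ≠ a j t} : ℝ) ≤ (q - 1) * K ^ 2 * #P := by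
    have : ∑ i, ∑ j, (#{t ∈ P | a i t ≠ a j t} : ℝ) =
        ∑ t ∈ P, ∑ i, ∑ j, (if a i t ≠ a j t then (1 : ℝ) else 0) := by
      symm
      rw [Finset.sum_comm]
      refine Finset.sum_congr rfl fun i _ => ?_
      rw [Finset.sum_comm]
      refine Finset.sum_congr rfl fun j _ => ?_
      simp [Finset.card_filter]
    rw [this, Finset.mul_sum]
    calc _ ≤ ∑ t ∈ P, ((q : ℝ) - 1) * K ^ 2 := Finset.sum_le_sum fun t _ => hcol t
      _ = _ := by simp; ring
  have hlow : ∀ i : Fin K, (K - 1) * ((q - 1) * K * (#P : ℝ)) <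
      q * (K - 1) * ∑ j, (#{t ∈ P | a i t ≠ a j t} : ℝ) := by
    intro i
    have h0 : ∑ j, (#{t ∈ P | a i t ≠ a j t} : ℝ) =
        ∑ j ∈ univ.erase i, (#{t ∈ P | a i t ≠ a j t} : ℝ) := by
      symm
      apply Finset.sum_erase
      simp
    rw [h0, Finset.mul_sum]
    have hc : (#(univ.erase i) : ℝ) = K - 1 := by
      rw [Finset.card_erase_of_mem (mem_univ _), card_univ, Fintype.card_fin,
        Nat.cast_sub (by omega)]; simp
    calc (K - 1) * ((q - 1) * K * (#P : ℝ)) =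
        ∑ j ∈ univ.erase i, ((q - 1) * K * (#P : ℝ)) := by
          rw [Finset.sum_const, nsmul_eq_mul, hc]
      _ < _ := by
          refine Finset.sum_lt_sum_of_nonempty ?_ fun j hj => hne i j (ne_of_mem_erase hj).symm
          rw [← Finset.card_pos, Finset.card_erase_of_mem (mem_univ _)]
          simp; omega
  have hsum := Finset.sum_lt_sum_of_nonempty (s := (univ : Finset (Fin K)))
    ⟨⟨0, by omega⟩, mem_univ _⟩ (fun i _ => hlow i)
  rw [Finset.sum_const, ← Finset.mul_sum] at hsum
  simp only [card_univ, Fintype.card_fin, nsmul_eq_mul] at hsum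
  have h5 := mul_le_mul_of_nonneg_left htot (by linarith : (0 : ℝ) ≤ K - 1)
  nlinarith

theorem mul_Hq_div_mul_log {q : ℕ} (hq : 2 ≤ q) {α x : ℝ} (hα : α ≠ 0) :
    α * Hq q (x / α) * Real.log q = x * Real.log ((q : ℝ) - 1) +
      (Real.negMulLog x + Real.negMulLog (α - x) - Real.negMulLog α) := by
  have hQ : Real.log q ≠ 0 := (Real.log_pos (by exact_mod_cast hq)).ne'
  have h1 : Hq q (x / α) * Real.log q = x / α * Real.log ((q : ℝ) - 1) +
      Real.negMulLog (x / α) + Real.negMulLog (1 - x / α) := by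
    simp only [Hq, Real.logb, Real.negMulLog]
    field_simp
    ring
  have h2 := Real.negMulLog_mul (x / α) α
  have h3 := Real.negMulLog_mul (1 - x / α) α
  rw [div_mul_cancel₀ _ hα] at h2
  rw [show (1 - x / α) * α = α - x by field_simp] at h3
  rw [mul_assoc, h1, h2, h3]
  field_simp
  ring

open Filter Topology in
/-- Sphere-packing asymptotics: a block of length about `(α + δ) n` holds at most
`q ^ ((α (1 - H_q (x / α)) + 2 δ) n)` spheres of radius `x n`, up to any constant factor. -/
theorem eventually_pow_mul_le_choose {q : ℕ} (hq : 2 ≤ q) {α x δ : ℝ} (hx : 0 ≤ x)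
    (hxα : x < α) (hα : α ≤ 1) (hδ : 0 < δ) {L : ℕ} (hL : 0 < L) :
    ∀ᶠ n : ℕ in atTop, ∀ l : ℕ, ⌈α * n⌉₊ ≤ l → (l : ℝ) ≤ (α + δ) * n + 2 →
      (q : ℝ) ^ l * L ≤ (q : ℝ) ^ ((α * (1 - Hq q (x / α)) + 2 * δ) * n) *
        (l.choose ⌊x * n⌋₊ * ((q : ℝ) - 1) ^ ⌊x * n⌋₊) := by
  have hα0 : 0 < α := hx.trans_lt hxα
  have hq1 : (2 : ℝ) ≤ q := by exact_mod_cast hq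
  have hQ : 0 < Real.log q := Real.log_pos (by linarith)
  have hH := mul_Hq_div_mul_log hq (x := x) hα0.ne'
  have te : Tendsto (fun n : ℕ => (⌊x * n⌋₊ : ℝ) / n) atTop (𝓝 x) :=
    (tendsto_nat_floor_mul_div_atTop hx).comp tendsto_natCast_atTop_atTop
  have ta : Tendsto (fun n : ℕ => (⌈α * n⌉₊ : ℝ) / n) atTop (𝓝 α) :=
    (tendsto_nat_ceil_mul_div_atTop hα0.le).comp tendsto_natCast_atTop_atTop
  have tl : Tendsto (fun n : ℕ => Real.log ((n : ℝ) + 1) / n) atTop (𝓝 0) := by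
    have h := (Real.tendsto_pow_log_div_mul_add_atTop 1 (-1) 1 one_ne_zero).comp
      (tendsto_atTop_add_const_right atTop (1 : ℝ) tendsto_natCast_atTop_atTop)
    refine h.congr fun n => ?_
    simp
  have tc : Tendsto (fun n : ℕ => (2 * Real.log q + Real.log L) / (n : ℝ)) atTop (𝓝 0) :=
    tendsto_const_div_atTop_nhds_zero_nat _
  have cn := Real.continuous_negMulLog
  have tF := (((cn.tendsto _).comp te).add ((cn.tendsto _).comp (ta.sub te))).sub
    ((cn.tendsto _).comp ta)
  have tG := ((tF.add (te.mul_const (Real.log ((q : ℝ) - 1)))).sub tl).sub tc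
  have hev := tG.eventually_const_lt (u := α * Hq q (x / α) * Real.log q - δ * Real.log q)
    (by rw [hH]; nlinarith)
  filter_upwards [hev, eventually_gt_atTop 0] with n hn hn0 l hal hl
  have hn' : (0 : ℝ) < n := by exact_mod_cast hn0
  have hea : ⌊x * n⌋₊ ≤ ⌈α * n⌉₊ :=
    (Nat.floor_mono (by gcongr)).trans (Nat.floor_le_ceil _)
  have han : ⌈α * n⌉₊ ≤ n := Nat.ceil_le.2 (by nlinarith)
  have h1 := Real.entropy_le_log_choose n ⌈α * n⌉₊ ⌊x * n⌋₊ hn0 han hea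
  have hcpos : (0 : ℝ) < (⌈α * n⌉₊.choose ⌊x * n⌋₊ : ℕ) := by exact_mod_cast Nat.choose_pos hea
  have hclpos : (0 : ℝ) < (l.choose ⌊x * n⌋₊ : ℕ) := by
    exact_mod_cast Nat.choose_pos (hea.trans hal)
  have h2 : Real.log (⌈α * n⌉₊.choose ⌊x * n⌋₊ : ℕ) ≤ Real.log (l.choose ⌊x * n⌋₊ : ℕ) :=
    Real.log_le_log hcpos (by exact_mod_cast Nat.choose_le_choose _ hal)
  have hq0 : (0 : ℝ) < q := by linarith
  have hqm : (0 : ℝ) < (q : ℝ) - 1 := by linarith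
  have hL' : (0 : ℝ) < L := by exact_mod_cast hL
  rw [← Real.log_le_log_iff (by positivity) (by positivity),
    Real.log_mul (by positivity) (by positivity), Real.log_mul (by positivity) (by positivity),
    Real.log_mul (by positivity) (by positivity), Real.log_pow, Real.log_pow,
    Real.log_rpow hq0]
  simp only [Function.comp] at hn
  have h3 := mul_lt_mul_of_pos_left hn hn'
  have h4 := mul_le_mul_of_nonneg_right hl hQ.le
  have e1 : (n : ℝ) * ((⌊x * n⌋₊ : ℝ) / n) = ⌊x * n⌋₊ := by field_simp
  have e2 : (n : ℝ) * (Real.log ((n : ℝ) + 1) / n) = Real.log ((n : ℝ) + 1) := by field_simp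
  have e3 : (n : ℝ) * ((2 * Real.log q + Real.log L) / n) = 2 * Real.log q + Real.log L := by
    field_simp
  rw [mul_sub, mul_sub, mul_sub, mul_add, ← mul_assoc (n : ℝ) ((⌊x * n⌋₊ : ℝ) / n), e1, e2, e3] at h3
  nlinarith

/-- Causal recursions have a fixed point. -/
theorem exists_eq_of_causal {n : ℕ} {A : Type*} (g : (Fin n → A) → Fin n → A)
    (hg : ∀ i y y', (∀ j < i, y j = y' j) → g y i = g y' i) (y₀ : Fin n → A) :
    ∃ y, ∀ i, y i = g y i := by
  have h : ∀ k : ℕ, ∃ y : Fin n → A, ∀ i : Fin n, i.val < k → y i = g y i := by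
    intro k
    induction k with
    | zero => exact ⟨y₀, fun i hi => absurd hi (Nat.not_lt_zero _)⟩
    | succ k ih =>
      obtain ⟨y, hy⟩ := ih
      by_cases hk : k < n
      · refine ⟨Function.update y ⟨k, hk⟩ (g y ⟨k, hk⟩), fun i hi => ?_⟩
        have hc : g (Function.update y ⟨k, hk⟩ (g y ⟨k, hk⟩)) i = g y i := by
          refine hg i _ _ fun j hj => Function.update_of_ne ?_ _ _
          rintro rfl
          simp only [Fin.lt_def] at hj
          omega
        rw [hc]
        by_cases hik : i.val = k
        · obtain rfl : i = ⟨k, hk⟩ := Fin.ext hik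
          simp
        · rw [Function.update_of_ne (fun h => hik (by rw [h]))]
          exact hy i (by omega)
      · exact ⟨y, fun i _ => hy i (by omega)⟩
  obtain ⟨y, hy⟩ := h n
  exact ⟨y, fun i => hy i i.isLt⟩

open Finset in
/-- The elements of a finite set of indices whose rank lies in `[u, v)` are at most `v - u`. -/
theorem card_rank_mem_Ico_le {n : ℕ} (D : Finset (Fin n)) (u v : ℕ) :
    #{i ∈ D | u ≤ #{j ∈ D | j < i} ∧ #{j ∈ D | j < i} < v} ≤ v - u := by
  rw [← Nat.card_Ico]
  refine card_le_card_of_injOn (fun i => #{j ∈ D | j < i}) (fun i hi => ?_) ?_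
  · simp at hi ⊢; exact hi.2
  · have key : ∀ i ∈ D, ∀ i', i < i' → #{j ∈ D | j < i} < #{j ∈ D | j < i'} := by
      intro i hi i' hlt
      refine card_lt_card (Finset.ssubset_iff_of_subset ?_ |>.2 ⟨i, ?_, ?_⟩)
      · intro j hj
        simp only [mem_filter] at hj ⊢
        exact ⟨hj.1, hj.2.trans hlt⟩
      · simp [hi, hlt]
      · simp
    intro i hi i' hi' h
    simp only [coe_filter, Set.mem_ofPred_eq] at hi hi' h
    rcases lt_trichotomy i i' with hlt | rfl | hlt
    · exact absurd h (key i hi.1 i' hlt).ne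
    · rfl
    · exact absurd h (key i' hi'.1 i hlt).ne'

open Finset in
/-- At most `#D - u` elements of a finite set `D` of indices have rank at least `u`. -/
theorem card_rank_ge_le {n : ℕ} (D : Finset (Fin n)) (u : ℕ) :
    #{i ∈ D | u ≤ #{j ∈ D | j < i}} ≤ #D - u := by
  refine le_trans (card_le_card fun i hi => ?_) (card_rank_mem_Ico_le D u #D)
  simp only [mem_filter] at hi ⊢
  refine ⟨hi.1, hi.2, card_lt_card (Finset.ssubset_iff_of_subset (filter_subset _ _) |>.2
    ⟨i, hi.1, by simp⟩)⟩

open Finset in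
/-- The pushing attack: after a fixed prefix, the first `ρ` disagreements between two causal
transmissions are erased, the next `b` follow the first one, the remaining follow the second. -/
theorem exists_push {n : ℕ} {A : Type*} [DecidableEq A]
    (x₁ x₂ : (Fin n → Option A) → Fin n → A)
    (h₁ : ∀ i y y', (∀ j < i, y j = y' j) → x₁ y i = x₁ y' i)
    (h₂ : ∀ i y y', (∀ j < i, y j = y' j) → x₂ y i = x₂ y' i)
    (w : Fin n → A) (l ρ b : ℕ) :
    ∃ y : Fin n → Option A, (∀ i : Fin n, i.val < l → y i = some (w i)) ∧
      #{i | y i = none} ≤ ρ ∧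
      #{i : Fin n | l ≤ i.val ∧ y i ≠ none ∧ y i ≠ some (x₁ y i)} ≤
        #{i : Fin n | l ≤ i.val ∧ x₁ y i ≠ x₂ y i} - (ρ + b) ∧
      #{i : Fin n | l ≤ i.val ∧ y i ≠ none ∧ y i ≠ some (x₂ y i)} ≤ b := by
  obtain ⟨rk, hrk⟩ : ∃ rk : (Fin n → Option A) → Fin n → ℕ, ∀ y i, rk y i =
    #{j ∈ ({i : Fin n | l ≤ i.val ∧ x₁ y i ≠ x₂ y i} : Finset (Fin n)) | j < i} :=
    ⟨_, fun _ _ => rfl⟩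
  have hrkc : ∀ i y y', (∀ j < i, y j = y' j) → rk y i = rk y' i := by
    intro i y y' h
    simp only [hrk]
    congr 1
    ext j
    simp only [mem_filter, mem_univ, true_and]
    constructor
    · rintro ⟨⟨a, a'⟩, a''⟩
      have hh : ∀ k < j, y k = y' k := fun k hk => h k (hk.trans a'')
      rw [h₁ j y y' hh, h₂ j y y' hh] at a'
      exact ⟨⟨a, a'⟩, a''⟩
    · rintro ⟨⟨a, a'⟩, a''⟩
      have hh : ∀ k < j, y k = y' k := fun k hk => h k (hk.trans a'')
      rw [← h₁ j y y' hh, ← h₂ j y y' hh] at a'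
      exact ⟨⟨a, a'⟩, a''⟩
  obtain ⟨y, hy⟩ := exists_eq_of_causal (fun y i =>
    if i.val < l then some (w i) else if x₁ y i = x₂ y i then some (x₁ y i) else
    if rk y i < ρ then none else if rk y i < ρ + b then some (x₁ y i) else some (x₂ y i))
    (by
      intro i y y' h
      simp only [h₁ i y y' h, h₂ i y y' h, hrkc i y y' h]) (fun _ => none)
  have hcases : ∀ i : Fin n, l ≤ i.val →
      (x₁ y i = x₂ y i ∧ y i = some (x₁ y i)) ∨
      (x₁ y i ≠ x₂ y i ∧ rk y i < ρ ∧ y i = none) ∨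
      (x₁ y i ≠ x₂ y i ∧ ρ ≤ rk y i ∧ rk y i < ρ + b ∧ y i = some (x₁ y i)) ∨
      (x₁ y i ≠ x₂ y i ∧ ρ + b ≤ rk y i ∧ y i = some (x₂ y i)) := by
    intro i hi
    have h := hy i
    rw [if_neg (by omega)] at h
    split_ifs at h with c1 c2 c3
    · exact Or.inl ⟨c1, h⟩
    · exact Or.inr (Or.inl ⟨c1, c2, h⟩)
    · exact Or.inr (Or.inr (Or.inl ⟨c1, by omega, c3, h⟩))
    · exact Or.inr (Or.inr (Or.inr ⟨c1, by omega, h⟩))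
  have hpre : ∀ i : Fin n, i.val < l → y i = some (w i) := fun i hi => by
    rw [hy i, if_pos hi]
  refine ⟨y, hpre, ?_, ?_, ?_⟩
  · refine le_trans (card_le_card fun i hi => ?_)
      (card_rank_mem_Ico_le {i : Fin n | l ≤ i.val ∧ x₁ y i ≠ x₂ y i} 0 ρ)
    simp only [mem_filter, mem_univ, true_and] at hi
    have hl : l ≤ i.val := by
      by_contra h
      rw [hpre i (by omega)] at hi
      exact Option.some_ne_none _ hi
    rw [mem_filter, ← hrk]
    rcases hcases i hl with h | h | h | h
    · rw [hi] at h; exact absurd h.2.symm (Option.some_ne_none _)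
    · exact ⟨by simp [hl, h.1], Nat.zero_le _, h.2.1⟩
    · rw [hi] at h; exact absurd h.2.2.2.symm (Option.some_ne_none _)
    · rw [hi] at h; exact absurd h.2.2.symm (Option.some_ne_none _)
  · refine le_trans (card_le_card fun i hi => ?_)
      (card_rank_ge_le {i : Fin n | l ≤ i.val ∧ x₁ y i ≠ x₂ y i} (ρ + b))
    simp only [mem_filter, mem_univ, true_and] at hi
    rw [mem_filter, ← hrk]
    rcases hcases i hi.1 with h | h | h | h
    · exact absurd h.2 hi.2.2
    · exact absurd h.2.2 hi.2.1
    · exact absurd h.2.2.2 hi.2.2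
    · exact ⟨by simp [hi.1, h.1], h.2.1⟩
  · refine le_trans (card_le_card fun i hi => ?_)
      ((card_rank_mem_Ico_le {i : Fin n | l ≤ i.val ∧ x₁ y i ≠ x₂ y i} ρ (ρ + b)).trans
        (by omega))
    simp only [mem_filter, mem_univ, true_and] at hi
    rw [mem_filter, ← hrk]
    rcases hcases i hi.1 with h | h | h | h
    · exact absurd (h.1 ▸ h.2) hi.2.2
    · exact absurd h.2.2 hi.2.1
    · exact ⟨by simp [hi.1, h.1], h.2.1, h.2.2.1⟩
    · exact absurd h.2.2 hi.2.2

namespace FeedbackCode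

variable {q n B : ℕ} {M : Type*} (c : FeedbackCode q n B M)

theorem xword_congr_of_lt (m : M) (i : Fin n) (y y' : Fin n → Yq q)
    (h : ∀ j < i, y j = y' j) : c.xword m y i = c.xword m y' i := by
  unfold xword
  congr 1
  funext j
  unfold zseq
  congr 1
  funext k
  apply h
  have h1 := c.t_mono (k := j.val + 1) (j := c.blockIdx i.val) j.isLt
    (by have := c.blockIdx_le i.val; omega)
  have h2 := c.t_blockIdx_le i.val
  have h3 := k.isLt
  simp only [Fin.lt_def] at h3 ⊢
  omega

theorem xword_congr_of_zseq_eq (m : M) (i : Fin n) (y y' : Fin n → Yq q)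
    (h : c.zseq y = c.zseq y') : c.xword m y i = c.xword m y' i := by
  unfold xword
  rw [h]

theorem card_feedback_le [Fintype c.Z] [Fintype (Fin c.T → c.Z)] :
    Fintype.card (Fin c.T → c.Z) ≤ 2 ^ B := by
  classical
  have hB := c.hB
  have e1 : @Fintype.card c.Z c.instZ = Fintype.card c.Z := by congr!
  rw [e1] at hB
  have : Fintype.card (Fin c.T → c.Z) = Fintype.card c.Z ^ c.T := by
    rw [← Nat.card_eq_fintype_card, Nat.card_fun]; simp
  rw [this]
  rcases Nat.eq_zero_or_pos (Fintype.card c.Z) with h | h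
  · rw [h]
    exact le_trans (pow_le_one₀ le_rfl zero_le_one) Nat.one_le_two_pow
  · have hp : (0 : ℝ) < Fintype.card c.Z := by exact_mod_cast h
    rw [← Real.logb_pow, Real.logb_le_iff_le_rpow (by norm_num) (by positivity),
      Real.rpow_natCast] at hB
    exact_mod_cast hB

open Finset in
theorem numErrors_le (m : M) (y y' : Fin n → Yq q) (l e b : ℕ) (hl : l ≤ n)
    (w : Fin l → Fin q) (hy : ∀ i : Fin l, y (i.castLE hl) = some (w i))
    (hy' : ∀ i : Fin l, y' (i.castLE hl) = some (w i))
    (he : #{i : Fin l | w i ≠ c.xword m y' (i.castLE hl)} ≤ e)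
    (hb : #{i : Fin n | l ≤ i.val ∧ y i ≠ none ∧ y i ≠ some (c.xword m y i)} ≤ b) :
    c.numErrors m y ≤ e + b := by
  classical
  rw [numErrors, Nat.card_eq_fintype_card, Fintype.card_subtype]
  refine le_trans (card_le_card (t := ({i : Fin l | w i ≠ c.xword m y' (i.castLE hl)} : Finset
    (Fin l)).map (Fin.castLEEmb hl) ∪
    ({i : Fin n | l ≤ i.val ∧ y i ≠ none ∧ y i ≠ some (c.xword m y i)} : Finset (Fin n))) ?_) ?_
  · intro i hi
    simp only [mem_filter, mem_univ, true_and, mem_union, mem_map] at hi ⊢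
    by_cases h : i.val < l
    · left
      refine ⟨⟨i, h⟩, ?_, rfl⟩
      have h1 := hi.2
      have h2 : (⟨i, h⟩ : Fin l).castLE hl = i := rfl
      have h3 := hy ⟨i, h⟩
      rw [h2] at h3 ⊢
      rw [h3] at h1
      rw [c.xword_congr_of_lt m i y' y]
      · simpa using h1
      · intro j hj
        have hjl : j.val < l := lt_trans hj h
        exact (hy' ⟨j, hjl⟩).trans (hy ⟨j, hjl⟩).symm
    · exact Or.inr ⟨by omega, hi⟩
  · refine (card_union_le _ _).trans ?_
    rw [card_map]
    omega

end FeedbackCode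

open Finset in
/-- If the prefix of length `l` leaves a long list of messages consistent with `e` errors, and the
remaining budget covers the Plotkin distance of the suffix, then two messages are confusable. -/
theorem FeedbackCode.exists_confusable_of_card {q n B : ℕ} [NeZero q] {M : Type} [Fintype M]
    (c : FeedbackCode q n B M) {p r : ℝ} (hp : 0 ≤ p) (hr : 0 ≤ r) {K N l e : ℕ} (hK : 2 ≤ K)
    (hN : ∀ (M C : Type) [Fintype C], Fintype.card C ≤ 2 ^ B → ∀ χ : M → M → C,
      ∀ S : Finset M, N ≤ S.card → ∃ (g : Fin K → M) (z : C), (∀ i, g i ∈ S) ∧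
        ∀ i j, i < j → g i ≠ g j ∧ χ (g i) (g j) = z)
    (hl : l ≤ n) (he : e ≤ ⌊p * n⌋₊)
    (hcard : q ^ l * N ≤ Fintype.card M * (l.choose e * (q - 1) ^ e))
    (hdist : ∀ d : ℕ, (q : ℝ) * (K - 1) * d ≤ (q - 1) * K * (n - l : ℕ) →
      d ≤ ⌊r * n⌋₊ + 2 * (⌊p * n⌋₊ - e)) :
    ∃ m₁ m₂ : M, c.Confusable p r m₁ m₂ := by
  classical
  let := c.instZ
  set ext : (Fin l → Fin q) → Fin n → Yq q := fun w i =>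
    if h : i.val < l then some (w ⟨i, h⟩) else none with hext
  have hextv : ∀ w (i : Fin l), ext w (i.castLE hl) = some (w i) := fun w i => by simp [hext]
  set x : M → (Fin l → Fin q) → Fin l → Fin q := fun m w i =>
    c.xword m (ext w) (i.castLE hl) with hx
  have hxc : ∀ m i w w', (∀ j < i, w j = w' j) → x m w i = x m w' i := by
    intro m i w w' h
    refine c.xword_congr_of_lt m _ _ _ fun j hj => ?_
    have hji : j.val < i.val := hj
    have hjl : j.val < l := hji.trans i.isLt
    simp only [hext, hjl, dif_pos]
    rw [h ⟨j, hjl⟩ hji]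
  -- some prefix is compatible with many messages
  obtain ⟨w, hw⟩ : ∃ w : Fin l → Fin q, N ≤ #{m : M | #{i | w i ≠ x m w i} ≤ e} := by
    have h1 : Fintype.card M * (l.choose e * (q - 1) ^ e) ≤
        ∑ w : Fin l → Fin q, #{m : M | #{i | w i ≠ x m w i} ≤ e} := by
      have h2 := sum_card_bipartiteAbove_eq_sum_card_bipartiteBelow
        (s := (univ : Finset M)) (t := (univ : Finset (Fin l → Fin q)))
        (fun m w => #{i | w i ≠ x m w i} ≤ e)
      simp only [bipartiteAbove, bipartiteBelow] at h2
      rw [← h2, ← card_univ, ← smul_eq_mul]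
      exact card_nsmul_le_sum _ _ _ fun m _ =>
        choose_mul_pow_le_card_causal_errors_le q e (x m) (hxc m)
    obtain ⟨w, -, hw⟩ := exists_le_of_sum_le (s := (univ : Finset (Fin l → Fin q)))
      (f := fun _ => N) univ_nonempty
      (le_trans (by simpa using hcard) h1)
    exact ⟨w, hw⟩
  choose Y hYpre hYer hY₁ hY₂ using fun m₁ m₂ : M => exists_push (c.xword m₁) (c.xword m₂)
    (fun i y y' => c.xword_congr_of_lt m₁ i y y') (fun i y y' => c.xword_congr_of_lt m₂ i y y')
    (fun i => if h : i.val < l then w ⟨i, h⟩ else 0) l ⌊r * n⌋₊ (⌊p * n⌋₊ - e)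
  obtain ⟨g, z, hgS, hg⟩ := hN M (Fin c.T → c.Z) c.card_feedback_le
    (fun m₁ m₂ => c.zseq (Y m₁ m₂)) _ hw
  -- the common feedback sequence turns the suffixes into a fixed code
  have hK0 : 0 < K := by omega
  set y₀ := Y (g ⟨0, hK0⟩) (g ⟨1, hK⟩) with hy₀
  have hz : c.zseq y₀ = z := (hg _ _ (by simp)).2
  obtain ⟨i, j, hij, hd⟩ := exists_lt_dist_le_plotkin hK (NeZero.one_le)
    (fun k t => c.xword (g k) y₀ t) {t : Fin n | l ≤ t.val}
  have hsuffix : #{t : Fin n | l ≤ t.val} = n - l := by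
    have := Fin.card_filter_val_lt (n := n) (m := l)
    have h2 := card_filter_add_card_filter_not (s := (univ : Finset (Fin n))) (fun t => t.val < l)
    simp only [not_lt, card_univ, Fintype.card_fin] at h2
    omega
  rw [hsuffix, filter_filter] at hd
  have hd' := hdist _ hd
  obtain ⟨hne, hzij⟩ := hg i j hij
  set y := Y (g i) (g j) with hy
  have hxy : ∀ m t, c.xword m y t = c.xword m y₀ t := fun m t =>
    c.xword_congr_of_zseq_eq m t _ _ (hzij.trans hz.symm)
  have hypre : ∀ k : Fin l, y (k.castLE hl) = some (w k) := fun k => by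
    rw [hy, hYpre _ _ _ k.isLt]; simp
  have herr : ∀ k, #{t | w t ≠ c.xword (g k) (ext w) (t.castLE hl)} ≤ e := fun k => by
    simpa using hgS k
  have hbound : ∀ k, #{t : Fin n | l ≤ t.val ∧ y t ≠ none ∧ y t ≠ some (c.xword (g k) y t)} ≤
      ⌊p * n⌋₊ - e → (c.numErrors (g k) y : ℝ) ≤ p * n := by
    intro k hk
    have h1 := c.numErrors_le (g k) y (ext w) l e _ hl w hypre (hextv w) (herr k) hk
    rw [Nat.add_sub_cancel' he] at h1
    exact (Nat.le_floor_iff (by positivity)).1 h1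
  have hera : (numErasures y : ℝ) ≤ r * n := by
    refine (Nat.le_floor_iff (by positivity)).1 ?_
    rw [numErasures, Nat.card_eq_fintype_card, Fintype.card_subtype]
    exact hYer _ _
  refine ⟨g i, g j, hne, y, ⟨hera, hbound i ?_⟩, hera, hbound j (hY₂ _ _)⟩
  refine (hY₁ _ _).trans ?_
  simp only [← hy, hxy]
  omega

/-- Converse part of Theorem 1. Let q ≥ 2 be an integer and let
p, r ∈ [0,1] satisfy 2p + r < (q−1)/q. Let ε > 0 and set R = C₀(q,p,r) + ε. Then for
every constant B ∈ ℕ there exists n₀ such that for all n ≥ n₀, every B-bit feedback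
code of blocklength n with message set of size at least q^{Rn} has two distinct
messages m₁ ≠ m₂ that are confusable; in particular no such code is zero-error
against (p,r). -/
theorem converse_O1_feedback (q : ℕ) (hq : 2 ≤ q) (p r : ℝ)
    (hp : p ∈ Set.Icc (0 : ℝ) 1) (hr : r ∈ Set.Icc (0 : ℝ) 1)
    (hpr : 2 * p + r < ((q : ℝ) - 1) / q) (ε : ℝ) (hε : 0 < ε) :
    ∀ B : ℕ, ∃ n₀ : ℕ, ∀ n : ℕ, n₀ ≤ n →
      ∀ (M : Type) (_ : Fintype M),
        (q : ℝ) ^ ((C0 q p r + ε) * n) ≤ Fintype.card M →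
        ∀ c : FeedbackCode q n B M,
          (∃ m₁ m₂ : M, c.Confusable p r m₁ m₂) ∧ ¬ c.ZeroError p r := by
  intro B
  have : NeZero q := ⟨by omega⟩
  have hq2 : (2 : ℝ) ≤ q := by exact_mod_cast hq
  obtain ⟨_, ⟨x, hx, rfl⟩, hxC⟩ := exists_lt_of_csInf_lt
    ((Set.nonempty_Icc.2 hp.1).image
      (fun pb => alphaEE q p r pb * (1 - Hq q (pb / alphaEE q p r pb))))
    (show sInf _ < C0 q p r + ε / 2 by rw [C0]; linarith)
  set α := alphaEE q p r x with hα
  -- `(q - 1) / q * (1 - α)` is the relative budget left for the suffix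
  have hαeq : ((q : ℝ) - 1) * (1 - α) = q * (2 * (p - x) + r) := by
    have : (q : ℝ) - 1 ≠ 0 := by linarith
    rw [hα, alphaEE]
    field_simp
    ring
  rw [lt_div_iff₀ (by linarith)] at hpr
  have hxα : x < α := by
    have : ((q : ℝ) - 1) * x < (q - 1) * α := by nlinarith [hx.1]
    exact lt_of_mul_lt_mul_left this (by linarith)
  have hα1 : α ≤ 1 := by
    have : 0 ≤ ((q : ℝ) - 1) * (1 - α) := by
      rw [hαeq]
      have := hx.2; have := hr.1
      exact mul_nonneg (by linarith) (by linarith)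
    have := nonneg_of_mul_nonneg_right this (by linarith)
    linarith
  set δ := ε / 4 with hδ
  have hδ0 : 0 < δ := by positivity
  set k := ⌈4 / δ⌉₊ + 1 with hk
  have hkδ : 4 ≤ δ * k := by
    have := Nat.le_ceil (4 / δ)
    rw [div_le_iff₀ hδ0] at this
    rw [hk]; push_cast; nlinarith
  obtain ⟨N, hN⟩ := exists_injective_monochromatic (2 ^ B) (k + 1)
  have hev := eventually_pow_mul_le_choose hq hx.1 hxα hα1 hδ0 (L := N + 1) (by omega)
  obtain ⟨n₀, hn₀⟩ := Filter.eventually_atTop.1 (hev.and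
    (tendsto_natCast_atTop_atTop.eventually_ge_atTop (12 / δ)))
  refine ⟨n₀, fun n hn M _ hM c => ?_⟩
  obtain ⟨hvol, hnδ⟩ := hn₀ n hn
  rw [div_le_iff₀ hδ0] at hnδ
  have hn0 : (0 : ℝ) ≤ n := n.cast_nonneg
  suffices hconf : ∃ m₁ m₂ : M, c.Confusable p r m₁ m₂ by
    refine ⟨hconf, fun hz => ?_⟩
    obtain ⟨m₁, m₂, hne, y, h₁, h₂⟩ := hconf
    exact hne ((hz m₁ y h₁).symm.trans (hz m₂ y h₂))
  have hxfl : ⌊x * n⌋₊ ≤ ⌊p * n⌋₊ := Nat.floor_mono (by gcongr; exact hx.2)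
  have hceilα : ⌈α * n⌉₊ ≤ n := Nat.ceil_le.2 (by nlinarith)
  have hceil1 := Nat.ceil_lt_add_one (a := α * n) (mul_nonneg (hx.1.trans hxα.le) hn0)
  have hceil2 := Nat.ceil_lt_add_one (a := δ * n) (by positivity)
  refine c.exists_confusable_of_card hp.1 hr.1 (K := k + 1) (N := N)
    (l := min n (⌈α * n⌉₊ + ⌈δ * n⌉₊)) (e := ⌊x * n⌋₊) (by omega) hN (min_le_left _ _) hxfl ?_ ?_
  · have h1 := hvol (min n (⌈α * n⌉₊ + ⌈δ * n⌉₊)) (le_min hceilα (Nat.le_add_right _ _)) (by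
      have : ((min n (⌈α * n⌉₊ + ⌈δ * n⌉₊) : ℕ) : ℝ) ≤ (⌈α * n⌉₊ + ⌈δ * n⌉₊ : ℕ) :=
        Nat.cast_le.2 (min_le_right _ _)
      push_cast at this ⊢
      linarith)
    have h2 : (q : ℝ) ^ ((α * (1 - Hq q (x / α)) + 2 * δ) * n) ≤ Fintype.card M := by
      refine le_trans (Real.rpow_le_rpow_of_exponent_le (by linarith) ?_) hM
      refine mul_le_mul_of_nonneg_right ?_ hn0
      simp only at hxC
      linarith
    have h3 : ((q - 1 : ℕ) : ℝ) = q - 1 := by rw [Nat.cast_sub (by omega)]; simp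
    rw [← h3] at h1
    have h4 := h1.trans (mul_le_mul_of_nonneg_right h2 (by positivity))
    have h5 : q ^ (min n (⌈α * n⌉₊ + ⌈δ * n⌉₊)) * (N + 1) ≤ Fintype.card M *
        ((min n (⌈α * n⌉₊ + ⌈δ * n⌉₊)).choose ⌊x * n⌋₊ * (q - 1) ^ ⌊x * n⌋₊) := by
      exact_mod_cast h4
    exact le_trans (Nat.mul_le_mul_left _ (Nat.le_succ N)) h5
  · intro d hd
    have hk1 : (1 : ℝ) ≤ k := by rw [hk]; push_cast; linarith [(⌈4 / δ⌉₊).cast_nonneg (α := ℝ)]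
    push_cast at hd
    rw [add_sub_cancel_right] at hd
    rcases le_total n (⌈α * n⌉₊ + ⌈δ * n⌉₊) with h | h
    · rw [min_eq_left h, Nat.sub_self] at hd
      have hd0 : (d : ℝ) ≤ 0 := by
        by_contra! hpos
        have : 0 < (q : ℝ) * k * d := by positivity
        simp at hd
        linarith
      have : d = 0 := by exact_mod_cast le_antisymm hd0 (Nat.cast_nonneg d)
      omega
    · rw [min_eq_right h, Nat.cast_sub h] at hd
      push_cast at hd
      have hs : (n : ℝ) - (⌈α * n⌉₊ + ⌈δ * n⌉₊) ≤ (1 - α - δ) * n := by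
        have := Nat.le_ceil (α * n)
        have := Nat.le_ceil (δ * n)
        linarith
      have hA : (d : ℝ) ≤ (2 * (p - x) + r) * n - 3 := by
        have hβ : 2 * (p - x) + r ≤ 1 := by nlinarith [hx.1]
        have g1 : ((q : ℝ) - 1) * (k + 1) * ((n : ℝ) - (⌈α * n⌉₊ + ⌈δ * n⌉₊)) ≤
            (q - 1) * (k + 1) * ((1 - α - δ) * n) :=
          mul_le_mul_of_nonneg_left hs (mul_nonneg (by linarith) (by linarith))
        have g2 : ((q : ℝ) - 1) * (k + 1) * ((1 - α - δ) * n) =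
            (k + 1) * n * (q * (2 * (p - x) + r)) - (k + 1) * n * δ * (q - 1) := by
          rw [← hαeq]; ring
        have g3 : (k : ℝ) * n * δ * (q / 2) ≤ (k + 1) * n * δ * (q - 1) := by
          gcongr <;> linarith
        have g4 : (n : ℝ) + 3 * k ≤ k * n * δ / 2 := by
          have a1 := mul_le_mul_of_nonneg_right hkδ hn0
          have a2 := mul_le_mul_of_nonneg_right hnδ (by linarith : (0 : ℝ) ≤ k)
          linarith
        have g5 : (q : ℝ) * n * (2 * (p - x) + r) ≤ q * n * 1 :=
          mul_le_mul_of_nonneg_left hβ (by positivity)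
        have g6 := mul_le_mul_of_nonneg_left g4 (by linarith : (0 : ℝ) ≤ q)
        have g7 : (q : ℝ) * k * d ≤ q * k * ((2 * (p - x) + r) * n - 3) := by linarith
        exact le_of_mul_le_mul_left g7 (by positivity)
      have f1 := Nat.lt_floor_add_one (r * n)
      have f2 := Nat.lt_floor_add_one (p * n)
      have f3 := Nat.floor_le (a := x * n) (mul_nonneg hx.1 hn0)
      have hlt : (d : ℝ) < (⌊r * n⌋₊ + 2 * (⌊p * n⌋₊ - ⌊x * n⌋₊ : ℕ) : ℕ) := by
        push_cast [Nat.cast_sub hxfl]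
        nlinarith
      exact_mod_cast hlt.le
end

section
/- Closed form of the capacity expression for pure errors (equation (4)). Let q ≥ 2 be an integer and let p be a real with 0 ≤ p < (q−1)/(2q). Then C₀(q,p,0) = 1 − H_q(p) if p ≤ p*(q), and C₀(q,p,0) = ((1 − H_q(p*(q)))/((q−1)/(2q) − p*(q)))·((q−1)/(2q) − p) if p*(q) < p < (q−1)/(2q). -/
/-- Gibbs' inequality for two-point distributions. -/
lemma binary_gibbs {m x : ℝ} (hm : m ∈ Set.Ioo (0 : ℝ) 1) (hx : x ∈ Set.Ico (0 : ℝ) 1) :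
    x * Real.log m + (1 - x) * Real.log (1 - m) ≤
      x * Real.log x + (1 - x) * Real.log (1 - x) := by
  have key : ∀ a b : ℝ, 0 ≤ a → 0 < b → a * Real.log b ≤ a * Real.log a + (b - a) := by
    intro a b ha hb
    rcases ha.eq_or_lt with rfl | ha
    · simpa using hb.le
    · have h := mul_le_mul_of_nonneg_left (Real.log_le_sub_one_of_pos (div_pos hb ha)) ha.le
      rw [Real.log_div hb.ne' ha.ne', mul_sub, mul_sub, mul_div_cancel₀ _ ha.ne'] at h
      linarith
  linarith [key x m hx.1 hm.1, key (1 - x) (1 - m) (by linarith [hx.2]) (by linarith [hm.2])]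

/-- The function `x ↦ s log x + (1 - s) log (1 - x)` is monotone on `(0, s]`. -/
lemma weighted_log_le {s x y : ℝ} (hx : 0 < x) (hxy : x ≤ y) (hys : y ≤ s) (hs : s < 1) :
    s * Real.log x + (1 - s) * Real.log (1 - x) ≤
      s * Real.log y + (1 - s) * Real.log (1 - y) := by
  have hy : 0 < y := hx.trans_le hxy
  have hy1 : 0 < 1 - y := by linarith
  have hx1 : 0 < 1 - x := by linarith
  have h1 := mul_le_mul_of_nonneg_left (Real.log_le_sub_one_of_pos (div_pos hx hy))
    (hy.le.trans hys)
  have h2 := mul_le_mul_of_nonneg_left (Real.log_le_sub_one_of_pos (div_pos hx1 hy1))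
    (sub_nonneg.2 hs.le)
  rw [Real.log_div hx.ne' hy.ne'] at h1
  rw [Real.log_div hx1.ne' hy1.ne'] at h2
  have h3 : s * (x / y - 1) + (1 - s) * ((1 - x) / (1 - y) - 1) =
      -((y - x) * (s - y) / (y * (1 - y))) := by
    field_simp
    ring
  have h4 : 0 ≤ (y - x) * (s - y) / (y * (1 - y)) :=
    div_nonneg (mul_nonneg (sub_nonneg.2 hxy) (sub_nonneg.2 hys)) (mul_pos hy hy1).le
  linarith

lemma Hq_le_cross_entropy {q : ℕ} (hq : 2 ≤ q) {m x : ℝ} (hm : m ∈ Set.Ioo (0 : ℝ) 1)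
    (hx : x ∈ Set.Ico (0 : ℝ) 1) :
    Hq q x ≤ x * Real.logb q ((q : ℝ) - 1) - x * Real.logb q m
      - (1 - x) * Real.logb q (1 - m) := by
  have hL : 0 < Real.log q := Real.log_pos (by exact_mod_cast hq)
  have h := div_le_div_of_nonneg_right (binary_gibbs hm hx) hL.le
  rw [add_div, add_div, mul_div_assoc, mul_div_assoc, mul_div_assoc, mul_div_assoc] at h
  unfold Hq
  simp only [Real.logb] at *
  linarith

/-- The value at `s` of the tangent line to `1 - H_q` at `m`. -/
noncomputable def tangentValue (q : ℕ) (s m : ℝ) : ℝ :=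
  1 - s * Real.logb q ((q : ℝ) - 1) + s * Real.logb q m + (1 - s) * Real.logb q (1 - m)

lemma one_sub_Hq_mul_le {q : ℕ} (hq : 2 ≤ q) {s m x : ℝ} (hm : m ∈ Set.Ioo (0 : ℝ) 1)
    (hx : x ∈ Set.Ico (0 : ℝ) 1) (hms : m ≤ s) (h : 0 ≤ (x - m) * tangentValue q s m) :
    (1 - Hq q m) * (s - x) ≤ (1 - Hq q x) * (s - m) := by
  have h1 := mul_le_mul_of_nonneg_right (Hq_le_cross_entropy hq hm hx) (sub_nonneg.2 hms)
  unfold tangentValue at h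
  rw [show Hq q m = m * Real.logb q ((q : ℝ) - 1) - m * Real.logb q m
      - (1 - m) * Real.logb q (1 - m) from rfl]
  linarith

lemma tangentValue_mono {q : ℕ} (hq : 2 ≤ q) {s x y : ℝ} (hx : 0 < x) (hxy : x ≤ y)
    (hys : y ≤ s) (hs : s < 1) : tangentValue q s x ≤ tangentValue q s y := by
  have hL : 0 < Real.log q := Real.log_pos (by exact_mod_cast hq)
  have h := div_le_div_of_nonneg_right (weighted_log_le hx hxy hys hs) hL.le
  rw [add_div, add_div, mul_div_assoc, mul_div_assoc, mul_div_assoc, mul_div_assoc] at h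
  unfold tangentValue
  simp only [Real.logb] at *
  linarith

lemma tangentValue_eq_zero {q : ℕ} (hq : 2 ≤ q) {m : ℝ} (hm : m ∈ Set.Ioo (0 : ℝ) 1)
    (heq : m * (1 - m) ^ (((q : ℝ) + 1) / ((q : ℝ) - 1)) =
      ((q : ℝ) - 1) * (q : ℝ) ^ (-(2 * (q : ℝ)) / ((q : ℝ) - 1))) :
    tangentValue q (((q : ℝ) - 1) / (2 * q)) m = 0 := by
  have hq' : (2 : ℝ) ≤ q := by exact_mod_cast hq
  have hq0 : (0 : ℝ) < q := by linarith
  have hq1 : (0 : ℝ) < (q : ℝ) - 1 := by linarith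
  have hm1 : 0 < 1 - m := sub_pos.2 hm.2
  have h := congrArg (Real.logb q) heq
  rw [Real.logb_mul hm.1.ne' (Real.rpow_pos_of_pos hm1 _).ne',
    Real.logb_mul hq1.ne' (Real.rpow_pos_of_pos hq0 _).ne',
    Real.logb_rpow_eq_mul_logb_of_pos hm1, Real.logb_rpow hq0 (by linarith)] at h
  unfold tangentValue
  generalize Real.logb q m = A at *
  generalize Real.logb q (1 - m) = B at *
  generalize Real.logb q ((q : ℝ) - 1) = c at *
  field_simp at h ⊢
  linarith

/-- If `x ↦ (1 - H_q(x)) / (s - x)` attains its minimum over `[0, p]` at `m`, this minimum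
determines the value of `C₀(q, p, 0)`. -/
lemma C0_eq_of_minimizer {q : ℕ} (hq : 2 ≤ q) {s p m : ℝ} (hs : s = ((q : ℝ) - 1) / (2 * q))
    (hps : p < s) (hm : m ∈ Set.Icc 0 p)
    (hmin : ∀ x ∈ Set.Icc 0 p, (1 - Hq q m) * (s - x) ≤ (1 - Hq q x) * (s - m)) :
    C0 q p 0 = (1 - Hq q m) / (s - m) * (s - p) := by
  have hq' : (2 : ℝ) ≤ q := by exact_mod_cast hq
  have hq1 : (0 : ℝ) < (q : ℝ) - 1 := by linarith
  have hs0 : 0 < s := by rw [hs]; positivity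
  have hsp : 0 < s - p := sub_pos.2 hps
  have hsm : 0 < s - m := by linarith [hm.2]
  have hα : ∀ y, alphaEE q p 0 y = (s - p + y) / s := by
    intro y
    have : 2 * (q : ℝ) / ((q : ℝ) - 1) = 1 / s := by
      rw [hs]
      field_simp
    unfold alphaEE
    rw [this]
    field_simp
    ring
  apply IsLeast.csInf_eq
  constructor
  · have hα' : (s - p + m * (s - p) / (s - m)) / s = (s - p) / (s - m) := by
      field_simp
      ring
    refine ⟨m * (s - p) / (s - m), ⟨div_nonneg (mul_nonneg hm.1 hsp.le) hsm.le, ?_⟩, ?_⟩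
    · rw [div_le_iff₀ hsm]
      nlinarith [mul_nonneg hs0.le (sub_nonneg.2 hm.2)]
    · have hx : m * (s - p) / (s - m) / ((s - p) / (s - m)) = m := by field_simp
      simp only [hα, hα', hx]
      ring
  · rintro _ ⟨y, hy, rfl⟩
    have hd : 0 < s - p + y := by linarith [hy.1]
    have hαy : 0 < (s - p + y) / s := div_pos hd hs0
    simp only [hα]
    have hx : y / ((s - p + y) / s) ∈ Set.Icc 0 p := by
      refine ⟨div_nonneg hy.1 hαy.le, ?_⟩
      rw [div_le_iff₀ hαy, mul_div_assoc', le_div_iff₀ hs0]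
      nlinarith [mul_nonneg hsp.le (sub_nonneg.2 hy.2)]
    have h := mul_le_mul_of_nonneg_left (hmin _ hx) hαy.le
    have he : (s - p + y) / s * (s - y / ((s - p + y) / s)) = s - p := by
      field_simp
      ring
    rw [div_mul_eq_mul_div, div_le_iff₀ hsm, mul_assoc]
    refine le_of_eq_of_le ?_ h
    rw [mul_left_comm, he]

/-- Closed form of the capacity expression for pure errors (equation (4)).
Let q ≥ 2 be an integer and let p be a real with 0 ≤ p < (q−1)/(2q). Then
C₀(q,p,0) = 1 − H_q(p) if p ≤ p*(q), and
C₀(q,p,0) = ((1 − H_q(p*))/((q−1)/(2q) − p*))·((q−1)/(2q) − p) if p* < p < (q−1)/(2q),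
where p* = p*(q) is the unique value in [0,(q−1)/(2q)] with
p*(1−p*)^{(q+1)/(q−1)} = (q−1)·q^{−2q/(q−1)}. -/
theorem capacity_pure_errors (q : ℕ) (hq : 2 ≤ q) (p pstar : ℝ)
    (hp0 : 0 ≤ p) (hp1 : p < ((q : ℝ) - 1) / (2 * q))
    (hmem : pstar ∈ Set.Icc (0 : ℝ) (((q : ℝ) - 1) / (2 * q)))
    (heq : pstar * (1 - pstar) ^ (((q : ℝ) + 1) / ((q : ℝ) - 1)) =
      ((q : ℝ) - 1) * (q : ℝ) ^ (-(2 * (q : ℝ)) / ((q : ℝ) - 1))) :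
    (p ≤ pstar → C0 q p 0 = 1 - Hq q p) ∧
    (pstar < p →
      C0 q p 0 = ((1 - Hq q pstar) / (((q : ℝ) - 1) / (2 * q) - pstar)) *
        (((q : ℝ) - 1) / (2 * q) - p)) := by
  have hq' : (2 : ℝ) ≤ q := by exact_mod_cast hq
  have hq1 : (0 : ℝ) < (q : ℝ) - 1 := by linarith
  obtain ⟨s, hs⟩ : ∃ s, s = ((q : ℝ) - 1) / (2 * q) := ⟨_, rfl⟩
  have hs1 : s < 1 := by
    rw [hs, div_lt_one (by linarith)]
    linarith
  have hps0 : 0 < pstar := by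
    refine hmem.1.lt_of_ne fun h => ?_
    rw [← h, zero_mul] at heq
    exact absurd heq (by positivity)
  have hstar : pstar ∈ Set.Ioo (0 : ℝ) 1 := ⟨hps0, (hs ▸ hmem.2).trans_lt hs1⟩
  have hzero := tangentValue_eq_zero hq hstar heq
  have hle := hmem.2
  rw [← hs] at hp1 hle hzero ⊢
  refine ⟨fun h => ?_, fun h => ?_⟩
  · rw [C0_eq_of_minimizer hq hs hp1 ⟨hp0, le_rfl⟩, div_mul_cancel₀ _ (sub_pos.2 hp1).ne']
    intro x hx
    rcases hp0.eq_or_lt with rfl | hp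
    · rw [le_antisymm hx.2 hx.1]
    · refine one_sub_Hq_mul_le hq ⟨hp, hp1.trans hs1⟩ ⟨hx.1, by linarith [hx.2]⟩ hp1.le ?_
      have := tangentValue_mono hq hp h hle hs1
      exact mul_nonneg_of_nonpos_of_nonpos (sub_nonpos.2 hx.2) (this.trans hzero.le)
  · refine C0_eq_of_minimizer hq hs hp1 ⟨hps0.le, h.le⟩ fun x hx => ?_
    refine one_sub_Hq_mul_le hq hstar ⟨hx.1, by linarith [hx.2]⟩ hle ?_
    rw [hzero, mul_zero]
end

section
/- Corollary 2 (large-alphabet asymptotics of the capacity expression). Fix reals p, r ∈ [0,1] with 0 < 2p + r < 1. Then there exist a constant c > 0 and an integer q₀ ≥ 2 such that for every integer q ≥ q₀ (for which 2p + r < (q−1)/q, so C₀(q,p,r) is defined): (2p + r)/(q−1) ≤ 1 − 2p − r − C₀(q,p,r) ≤ c/q. In particular, C₀(q,p,r) = 1 − 2p − r − Θ(1/q) as q → ∞. -/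
theorem mul_Hq_div_le {q : ℕ} (hq : 3 ≤ q) {x a : ℝ} (hx : 0 ≤ x) (hxa : x < a) (ha : a ≤ 1) :
    a * Hq q (x / a) ≤ 2 * x + 1 / q := by
  have hq3 : (3 : ℝ) ≤ q := by exact_mod_cast hq
  have hq0 : (0 : ℝ) < q := by linarith
  have ha0 : 0 < a := hx.trans_lt hxa
  rcases hx.eq_or_lt with rfl | hx0
  · simp [Hq]
  have hL : 1 ≤ Real.log q := by
    rw [Real.le_log_iff_exp_le hq0]
    linarith [Real.exp_one_lt_d9]
  have hL0 : 0 < Real.log q := by linarith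
  have expand : a * Hq q (x / a) = (x * Real.log ((q : ℝ) - 1) - x * Real.log (x / a)
      - (a - x) * Real.log (1 - x / a)) / Real.log q := by
    unfold Hq Real.logb
    field_simp
  have h_pred : Real.log ((q : ℝ) - 1) ≤ Real.log q :=
    Real.log_le_log (by linarith) (by linarith)
  have h_div : Real.log x ≤ Real.log (x / a) :=
    Real.log_le_log hx0 (by rw [le_div_iff₀ ha0]; nlinarith)
  have h_compl : -x ≤ (a - x) * Real.log (1 - x / a) := by
    have hpos : 0 < 1 - x / a := by rw [sub_pos, div_lt_one ha0]; exact hxa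
    have h := mul_le_mul_of_nonneg_left (Real.one_sub_inv_le_log_of_pos hpos)
      (sub_nonneg.2 hxa.le)
    have hne : a - x ≠ 0 := (sub_pos.2 hxa).ne'
    have e : (a - x) * (1 - (1 - x / a)⁻¹) = -x := by
      rw [one_sub_div ha0.ne', inv_div]
      field_simp
      ring
    linarith
  have h_self : x - 1 / q ≤ x * (Real.log x + Real.log q) := by
    rw [← Real.log_mul hx0.ne' hq0.ne']
    have h := mul_le_mul_of_nonneg_left
      (Real.one_sub_inv_le_log_of_pos (mul_pos hx0 hq0)) hx
    have e : x * (1 - (x * q)⁻¹) = x - 1 / q := by field_simp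
    linarith
  rw [expand, div_le_iff₀ hL0]
  have h1 := mul_le_mul_of_nonneg_left h_pred hx
  have h2 := mul_le_mul_of_nonneg_left h_div hx
  have h3 : 1 / (q : ℝ) ≤ 1 / q * Real.log q := le_mul_of_one_le_right (by positivity) hL
  linarith

/-- Corollary 2 (large-alphabet asymptotics of the capacity expression).
Fix reals p, r ∈ [0,1] with 0 < 2p + r < 1. Then there exist a constant c > 0 and an
integer q₀ ≥ 2 such that for every integer q ≥ q₀ one has 2p + r < (q−1)/q (so
C₀(q,p,r) is defined) and (2p + r)/(q−1) ≤ 1 − 2p − r − C₀(q,p,r) ≤ c/q.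
In particular, C₀(q,p,r) = 1 − 2p − r − Θ(1/q) as q → ∞. -/
theorem capacity_large_alphabet (p r : ℝ)
    (hp : p ∈ Set.Icc (0 : ℝ) 1) (hr : r ∈ Set.Icc (0 : ℝ) 1)
    (h0 : 0 < 2 * p + r) (h1 : 2 * p + r < 1) :
    ∃ c : ℝ, 0 < c ∧ ∃ q₀ : ℕ, 2 ≤ q₀ ∧ ∀ q : ℕ, q₀ ≤ q →
      2 * p + r < ((q : ℝ) - 1) / q ∧
      (2 * p + r) / ((q : ℝ) - 1) ≤ 1 - 2 * p - r - C0 q p r ∧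
      1 - 2 * p - r - C0 q p r ≤ c / q := by
  obtain ⟨n, hn⟩ := exists_nat_gt (1 / (1 - (2 * p + r)))
  refine ⟨3, by norm_num, max 3 n, le_trans (by norm_num) (le_max_left _ _), fun q hq => ?_⟩
  have hq3' : 3 ≤ q := (le_max_left _ _).trans hq
  have hq3 : (3 : ℝ) ≤ q := by exact_mod_cast hq3'
  have hq0 : (0 : ℝ) < q := by linarith
  have hqm : (0 : ℝ) < q - 1 := by linarith
  have hqn : (n : ℝ) ≤ q := by exact_mod_cast (le_max_right _ _).trans hq
  have hgap : 1 < (1 - (2 * p + r)) * q := by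
    rw [div_lt_iff₀' (by linarith)] at hn
    exact hn.trans_le (mul_le_mul_of_nonneg_left hqn (by linarith))
  have hratio : (q : ℝ) / (q - 1) = 1 + 1 / (q - 1) := by field_simp; ring
  have hinv : 0 < 1 / ((q : ℝ) - 1) := by positivity
  have alpha_eq (x : ℝ) : alphaEE q p r x =
      1 - (2 * p + r) - (2 * p + r) / (q - 1) + 2 * x + 2 * x * (1 / (q - 1)) := by
    rw [alphaEE, mul_div_assoc, hratio]
    ring
  have hdefect : (2 * p + r) / ((q : ℝ) - 1) < 1 - (2 * p + r) := by
    rw [div_lt_iff₀ hqm]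
    linarith
  have lower {x : ℝ} (hx : x ∈ Set.Icc 0 p) :
      1 - (2 * p + r) - (2 * p + r) / (q - 1) - 1 / q ≤
        alphaEE q p r x * (1 - Hq q (x / alphaEE q p r x)) := by
    have hx1 : 0 ≤ 2 * x * (1 / ((q : ℝ) - 1)) := mul_nonneg (by linarith [hx.1]) hinv.le
    have hle : alphaEE q p r x ≤ 1 := by
      have h := mul_nonneg (by linarith [hx.2, hr.1] : 0 ≤ 2 * p + r - 2 * x) hinv.le
      rw [alpha_eq, div_eq_mul_one_div]
      linarith [hx.2, hr.1]
    have hH := mul_Hq_div_le hq3' hx.1 (by rw [alpha_eq]; linarith [hx.1]) hle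
    have h := alpha_eq x
    rw [mul_sub, mul_one]
    linarith
  have C0_le : C0 q p r ≤ 1 - (2 * p + r) - (2 * p + r) / (q - 1) :=
    csInf_le ⟨_, Set.forall_mem_image.2 fun x hx => lower hx⟩
      ⟨0, Set.left_mem_Icc.2 hp.1, by simp [alpha_eq, Hq]⟩
  have le_C0 : 1 - (2 * p + r) - (2 * p + r) / (q - 1) - 1 / q ≤ C0 q p r :=
    le_csInf ((Set.nonempty_Icc.2 hp.1).image _) (Set.forall_mem_image.2 fun x hx => lower hx)
  refine ⟨?_, by linarith, ?_⟩
  · rw [lt_div_iff₀ hq0]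
    linarith
  · have h : (2 * p + r) / ((q : ℝ) - 1) ≤ 2 / q := by
      rw [div_le_div_iff₀ hqm hq0]
      nlinarith
    have e : (3 : ℝ) / q = 2 / q + 1 / q := by ring
    linarith
end

section
/- Appendix B claim: p* ≤ 1/q. For every integer q ≥ 2, the unique value p* ∈ [0, (q−1)/(2q)] satisfying p*·(1 − p*)^{(q+1)/(q−1)} = (q−1)·q^{−2q/(q−1)} satisfies p* ≤ 1/q. -/
/-- For `1 ≤ a`, the map `x ↦ x * (1 - x) ^ a` is strictly increasing on `(0, 1 / (1 + a)]`. -/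
theorem mul_one_sub_rpow_lt {a x y : ℝ} (ha : 1 ≤ a) (hx : 0 < x) (hxy : x < y)
    (hy : (1 + a) * y ≤ 1) : x * (1 - x) ^ a < y * (1 - y) ^ a := by
  have hy0 : 0 < y := hx.trans hxy
  have hy1 : y < 1 := by nlinarith
  have hx1 : 0 < 1 - x := by linarith
  have hratio : 1 + (x - y) / (1 - x) = (1 - y) / (1 - x) := by field_simp; ring
  have hr : 0 ≤ (1 - y) / (1 - x) := div_nonneg (by linarith) hx1.le
  have hbern : 1 + a * ((x - y) / (1 - x)) ≤ ((1 - y) / (1 - x)) ^ a := by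
    rw [← hratio]
    exact one_add_mul_self_le_rpow_one_add (by linarith) ha
  have hlt : x / y < 1 + a * ((x - y) / (1 - x)) := by
    have hdiff : 1 + a * ((x - y) / (1 - x)) - x / y =
        (y - x) * (1 - x - a * y) / (y * (1 - x)) := by
      field_simp
      ring
    have hpos : 0 < (y - x) * (1 - x - a * y) / (y * (1 - x)) :=
      div_pos (mul_pos (by linarith) (by linarith)) (mul_pos hy0 hx1)
    linarith
  have h := hlt.trans_le hbern
  rw [Real.div_rpow (by linarith) hx1.le,
    div_lt_div_iff₀ hy0 (Real.rpow_pos_of_pos hx1 a)] at h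
  linarith

/-- Appendix B claim: p* ≤ 1/q. For every integer q ≥ 2, the (unique)
value p* ∈ [0, (q−1)/(2q)] satisfying p*·(1 − p*)^{(q+1)/(q−1)} = (q−1)·q^{−2q/(q−1)}
satisfies p* ≤ 1/q. -/
theorem pstar_le_inv_q (q : ℕ) (hq : 2 ≤ q) (pstar : ℝ)
    (hmem : pstar ∈ Set.Icc (0 : ℝ) (((q : ℝ) - 1) / (2 * q)))
    (heq : pstar * (1 - pstar) ^ (((q : ℝ) + 1) / ((q : ℝ) - 1)) =
      ((q : ℝ) - 1) * (q : ℝ) ^ (-(2 * (q : ℝ)) / ((q : ℝ) - 1))) :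
    pstar ≤ 1 / q := by
  by_contra! hlt
  have hq2 : (2 : ℝ) ≤ q := by exact_mod_cast hq
  have hq0 : (0 : ℝ) < q := by linarith
  have hq1 : (0 : ℝ) < q - 1 := by linarith
  have ha : 1 ≤ ((q : ℝ) + 1) / (q - 1) := by
    rw [le_div_iff₀ hq1]
    linarith
  have hexp : -(2 * (q : ℝ)) / (q - 1) = -1 - ((q : ℝ) + 1) / (q - 1) := by
    field_simp
    ring
  have hmax : (1 + ((q : ℝ) + 1) / (q - 1)) * pstar ≤ 1 := by
    have h : (1 + ((q : ℝ) + 1) / (q - 1)) * (((q : ℝ) - 1) / (2 * q)) = 1 := by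
      field_simp
      ring
    exact (mul_le_mul_of_nonneg_left hmem.2 (by linarith)).trans_eq h
  have hmono := mul_one_sub_rpow_lt ha (one_div_pos.mpr hq0) hlt hmax
  have hsub : 1 - 1 / (q : ℝ) = (q - 1) / q := by field_simp
  rw [heq, hexp, Real.rpow_sub hq0, Real.rpow_neg_one, hsub,
    Real.div_rpow hq1.le hq0.le] at hmono
  have hle : (q : ℝ) - 1 ≤ ((q : ℝ) - 1) ^ (((q : ℝ) + 1) / (q - 1)) :=
    Real.self_le_rpow_of_one_le (by linarith) ha
  have hqa := Real.rpow_pos_of_pos hq0 (((q : ℝ) + 1) / (q - 1))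
  refine hmono.not_ge ?_
  calc ((q : ℝ) - 1) * ((q : ℝ)⁻¹ / (q : ℝ) ^ (((q : ℝ) + 1) / (q - 1)))
      = 1 / q * ((q - 1) / (q : ℝ) ^ (((q : ℝ) + 1) / (q - 1))) := by ring
    _ ≤ 1 / q * ((q - 1) ^ (((q : ℝ) + 1) / (q - 1)) / (q : ℝ) ^ (((q : ℝ) + 1) / (q - 1))) := by
      gcongr
end

section
/- Convexity of the capacity objective (Appendix A, Condition 1). Let q ≥ 2 be an integer and let p be a real with 0 ≤ p < (q−1)/(2q). Define α₀(p̄) = 1 − (2q/(q−1))(p − p̄) for p̄ ∈ [0,p] (so α₀(p̄) > 0 and 0 ≤ p̄/α₀(p̄) ≤ (q−1)/(2q)). Then the function g_p(p̄) = α₀(p̄)·(1 − H_q(p̄/α₀(p̄))) is convex on the interval [0,p]. -/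
theorem Hq_eq_qaryEntropy_div_log {q : ℕ} (x : ℝ) :
    Hq q x = Real.qaryEntropy q x / Real.log q := by
  simp only [Hq, Real.qaryEntropy, Real.binEntropy, Real.logb, Real.log_inv]
  push_cast
  ring

theorem concaveOn_Hq (q : ℕ) : ConcaveOn ℝ (Set.Icc 0 1) (Hq q) := by
  have h := (Real.strictConcaveOn_qaryEntropy (q := q)).concaveOn.smul
    (inv_nonneg.2 (Real.log_natCast_nonneg q) : 0 ≤ (Real.log q)⁻¹)
  refine h.congr fun x _ => ?_
  simp [Hq_eq_qaryEntropy_div_log, div_eq_inv_mul]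

/-- The perspective of a convex function, restricted to a set `s` on which the scale `α` is
positive and affine, is convex. -/
theorem ConvexOn.perspective {f α : ℝ → ℝ} {s t : Set ℝ} (hf : ConvexOn ℝ t f)
    (hs : Convex ℝ s) (hα : ∀ x ∈ s, 0 < α x) (hmem : ∀ x ∈ s, x / α x ∈ t)
    (hαff : ∀ x y a b : ℝ, a + b = 1 → α (a * x + b * y) = a * α x + b * α y) :
    ConvexOn ℝ s (fun x => α x * f (x / α x)) := by
  refine ⟨hs, fun x hx y hy a b ha hb hab => ?_⟩
  have hz := hα _ (hs hx hy ha hb hab)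
  have hxα := hα x hx
  have hyα := hα y hy
  simp only [smul_eq_mul] at hz ⊢
  have hA := hαff x y a b hab
  set A := α (a * x + b * y)
  have key := hf.2 (hmem x hx) (hmem y hy)
    (by positivity : 0 ≤ a * α x / A) (by positivity : 0 ≤ b * α y / A)
    (by rw [← add_div, ← hA, div_self hz.ne'])
  simp only [smul_eq_mul] at key
  have e : a * α x / A * (x / α x) + b * α y / A * (y / α y) = (a * x + b * y) / A := by
    field_simp
  rw [e] at key
  calc A * f ((a * x + b * y) / A)
      ≤ A * (a * α x / A * f (x / α x) + b * α y / A * f (y / α y)) :=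
        mul_le_mul_of_nonneg_left key hz.le
    _ = a * (α x * f (x / α x)) + b * (α y * f (y / α y)) := by field_simp

/-- Convexity of the capacity objective (Appendix A, Condition 1).
Let q ≥ 2 be an integer and let p be a real with 0 ≤ p < (q−1)/(2q). With
α₀(p̄) = 1 − (2q/(q−1))(p − p̄), the function g_p(p̄) = α₀(p̄)·(1 − H_q(p̄/α₀(p̄)))
is convex on the interval [0,p]. -/
theorem capacity_objective_convex (q : ℕ) (hq : 2 ≤ q) (p : ℝ)
    (hp0 : 0 ≤ p) (hp1 : p < ((q : ℝ) - 1) / (2 * q)) :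
    ConvexOn ℝ (Set.Icc (0 : ℝ) p)
      (fun pb => (1 - (2 * (q : ℝ) / ((q : ℝ) - 1)) * (p - pb)) *
        (1 - Hq q (pb / (1 - (2 * (q : ℝ) / ((q : ℝ) - 1)) * (p - pb))))) := by
  have hq' : (2 : ℝ) ≤ q := by exact_mod_cast hq
  have hq1 : (0 : ℝ) < q - 1 := by linarith
  have hc : 1 ≤ 2 * (q : ℝ) / ((q : ℝ) - 1) := by
    rw [le_div_iff₀ hq1]; linarith
  have hcp : 2 * (q : ℝ) / ((q : ℝ) - 1) * p < 1 := by
    rw [lt_div_iff₀ (by positivity)] at hp1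
    rw [div_mul_eq_mul_div, div_lt_one hq1]
    linarith
  set c := 2 * (q : ℝ) / ((q : ℝ) - 1)
  have hα : ∀ x ∈ Set.Icc (0 : ℝ) p, 0 < 1 - c * (p - x) := fun x hx => by
    nlinarith [hx.1]
  have hf : ConvexOn ℝ (Set.Icc 0 1) (fun x => 1 - Hq q x) :=
    (convexOn_const 1 (convex_Icc 0 1)).sub (concaveOn_Hq q)
  refine hf.perspective (α := fun x => 1 - c * (p - x)) (convex_Icc 0 p) hα
    (fun x hx => ⟨div_nonneg hx.1 (hα x hx).le, ?_⟩) fun x y a b hab => ?_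
  · rw [div_le_one (hα x hx)]
    nlinarith [hx.1]
  · linear_combination (c * p - 1) * hab
end

section
/- List-decodability of a random code with feedback (Lemma thm:LD / Appendix E). Let q ≥ 2 be an integer, let n, t, λ, L ∈ ℕ with λ ≤ t ≤ n, let R > 0, ε_L > 0, and let p̂ ∈ [0,(q−1)/q] satisfy (t−λ)(1 − H_q(p̂)) ≥ n(R + ε_L). Let M be a finite set with |M| ≤ q^{Rn}, let Z be a finite set, let g : Y^t → Z be any function, and let (X_{m,z})_{m∈M, z∈Z} be independent random vectors, each uniformly distributed on X^t. If L + 1 ≥ (n + t·log_q 2 + (t−λ))/(ε_L·n), then the probability that there exists y ∈ Y^t with exactly λ erased coordinates such that at least L+1 messages m ∈ M satisfy d_H(X_{m,g(y)}, y) ≤ (t−λ)·p̂ is at most q^{−n}. -/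
/-- The erasure-adapted Hamming distance between `x ∈ X^t` and `y ∈ Y^t`:
the number of unerased positions of `y` whose symbol differs from `x`. -/
noncomputable def dHe {q t : ℕ} (x : Fin t → Fin q) (y : Fin t → Yq q) : ℕ :=
  Nat.card {i : Fin t // y i ≠ none ∧ y i ≠ some (x i)}

open Finset in
/-- A weight `θ` raised to the number of indices satisfying `P` splits as a product over indices. -/
theorem pow_natCard_subtype {ι : Type*} [Fintype ι] (P : ι → Prop) [DecidablePred P] (θ : ℝ) :
    θ ^ Nat.card {i // P i} = ∏ i, if P i then θ else 1 := by
  rw [Finset.prod_ite, prod_const, prod_const_one, mul_one, Nat.card_eq_fintype_card,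
    Fintype.card_subtype]

/-- Markov's inequality for counting. -/
theorem natCard_subtype_mul_le_sum {W : Type*} [Fintype W] (P : W → Prop) (c : ℝ) (f : W → ℝ)
    (hf : ∀ x, 0 ≤ f x) (h : ∀ x, P x → c ≤ f x) :
    (Nat.card {x // P x} : ℝ) * c ≤ ∑ x, f x := by
  classical
  rw [Nat.card_eq_fintype_card, Fintype.card_subtype, ← nsmul_eq_mul]
  refine (Finset.card_nsmul_le_sum _ f c fun x hx => h x (by simpa using hx)).trans ?_
  exact Finset.sum_le_sum_of_subset_of_nonneg (Finset.subset_univ _) fun x _ _ => hf x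

/-- The generating function of the distance to `y` factors over the coordinates. -/
theorem sum_pow_dHe {q t : ℕ} (y : Fin t → Yq q) (θ : ℝ) :
    ∑ x : Fin t → Fin q, θ ^ dHe x y =
      (q : ℝ) ^ Nat.card {i // y i = none} *
        (1 + ((q : ℝ) - 1) * θ) ^ Nat.card {i // ¬ y i = none} := by
  classical
  simp only [dHe, pow_natCard_subtype]
  rw [← Fintype.prod_sum (fun i b => if y i ≠ none ∧ y i ≠ some b then θ else 1),
    ← Finset.prod_mul_distrib]
  refine Finset.prod_congr rfl fun i _ => ?_
  cases hy : y i with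
  | none => simp
  | some a =>
    have h : ∀ b : Fin q, (if (some a : Yq q) ≠ none ∧ (some a : Yq q) ≠ some b then θ else 1)
        = θ + if a = b then 1 - θ else 0 := by
      intro b
      by_cases hab : a = b <;> simp [hab]
    simp only [h, Finset.sum_add_distrib, Finset.sum_ite_eq]
    simp
    ring

/-- The number of words with exactly `lam` erasures is at most `2 ^ t * q ^ (t - lam)`. -/
theorem natCard_erasure_pattern_mul_le (q t lam : ℕ) :
    (Nat.card {y : Fin t → Yq q // Nat.card {i // y i = none} = lam} : ℝ) * (q : ℝ) ^ lam ≤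
      (2 * q : ℝ) ^ t := by
  classical
  refine (natCard_subtype_mul_le_sum _ _ (fun y => (q : ℝ) ^ Nat.card {i // y i = none})
    (fun _ => by positivity) fun y hy => by rw [hy]).trans_eq ?_
  simp only [pow_natCard_subtype]
  rw [← Fintype.prod_sum (fun (_ : Fin t) (b : Yq q) => if b = none then (q : ℝ) else 1)]
  simp [Fintype.sum_option, two_mul]

/-- Assignments constrained to lie in a set of density at most `a` on the coordinates in `T`. -/
theorem natCard_forall_mem_le {ι W : Type*} [Fintype ι] [Fintype W] (P : W → Prop) (a : ℝ)
    (hP : (Nat.card {x // P x} : ℝ) ≤ Fintype.card W * a) (T : Finset ι) :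
    (Nat.card {C : ι → W // ∀ i ∈ T, P (C i)} : ℝ) ≤
      (Fintype.card W : ℝ) ^ Fintype.card ι * a ^ T.card := by
  classical
  have h : (Finset.univ.filter fun C : ι → W => ∀ i ∈ T, P (C i)) =
      Fintype.piFinset fun i => if i ∈ T then Finset.univ.filter P else Finset.univ := by
    ext C
    simp only [Finset.mem_filter, Finset.mem_univ, true_and, Fintype.mem_piFinset]
    refine forall_congr' fun i => ?_
    by_cases hi : i ∈ T <;> simp [hi]
  rw [Nat.card_eq_fintype_card, Fintype.card_subtype] at hP ⊢
  rw [h, Fintype.card_piFinset, Nat.cast_prod]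
  have h2 : (Fintype.card W : ℝ) ^ Fintype.card ι * a ^ T.card =
      ∏ i : ι, (Fintype.card W : ℝ) * if i ∈ T then a else 1 := by
    rw [Finset.prod_mul_distrib, Finset.prod_ite_mem, Finset.univ_inter]
    simp
  rw [h2]
  refine Finset.prod_le_prod (fun _ _ => by positivity) fun i _ => ?_
  by_cases hi : i ∈ T <;> simp [hi, hP]

/-- The parameter `θ = p / ((1 - p) (q - 1))` optimal in the Chernoff bound for Hamming balls. -/
theorem rpow_chernoff_parameter {q : ℕ} (hq : 2 ≤ q) {p : ℝ} (hp0 : 0 ≤ p) (hp1 : p < 1) :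
    (p / ((1 - p) * ((q : ℝ) - 1))) ^ p * (1 - p) = (q : ℝ) ^ (-Hq q p) := by
  have hq' : (2 : ℝ) ≤ q := by exact_mod_cast hq
  have h1p : 0 < 1 - p := by linarith
  rcases hp0.eq_or_lt with rfl | hp
  · simp [Hq]
  have hq1 : 0 < (q : ℝ) - 1 := by linarith
  have hlog : Real.log q ≠ 0 := (Real.log_pos (by linarith)).ne'
  have hθ : 0 < p / ((1 - p) * ((q : ℝ) - 1)) := by positivity
  apply Real.log_injOn_pos (Set.mem_Ioi.2 (by positivity)) (Set.mem_Ioi.2 (by positivity))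
  rw [Real.log_mul (by positivity) h1p.ne', Real.log_rpow hθ, Real.log_rpow (by linarith),
    Real.log_div hp.ne' (by positivity), Real.log_mul h1p.ne' hq1.ne']
  simp only [Hq, Real.logb]
  field_simp
  ring

/-- The entropy bound on the volume of an erasure-adapted Hamming ball. -/
theorem natCard_dHe_le {q t lam : ℕ} (hq : 2 ≤ q) (hlt : lam ≤ t) {p : ℝ}
    (hp : p ∈ Set.Icc (0 : ℝ) (((q : ℝ) - 1) / q)) (y : Fin t → Yq q)
    (hy : Nat.card {i // y i = none} = lam) :
    (Nat.card {x : Fin t → Fin q // (dHe x y : ℝ) ≤ ((t : ℝ) - lam) * p} : ℝ) ≤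
      Fintype.card (Fin t → Fin q) * (q : ℝ) ^ (-(((t : ℝ) - lam) * (1 - Hq q p))) := by
  classical
  have hq' : (2 : ℝ) ≤ q := by exact_mod_cast hq
  have hq0 : (0 : ℝ) < q := by linarith
  obtain ⟨hp0, hpq⟩ := hp
  rw [le_div_iff₀ hq0] at hpq
  have hp1 : p < 1 := by nlinarith
  have h1p : 0 < 1 - p := by linarith
  have hq1 : 0 < (q : ℝ) - 1 := by linarith
  have hcompl : Nat.card {i // ¬ y i = none} = t - lam := by
    rw [Nat.card_eq_fintype_card] at hy ⊢
    rw [Fintype.card_subtype_compl, hy, Fintype.card_fin]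
  obtain ⟨s, rfl⟩ := Nat.exists_eq_add_of_le hlt
  have hs : ((lam + s : ℕ) : ℝ) - lam = s := by push_cast; ring
  rw [Nat.add_sub_cancel_left] at hcompl
  set θ : ℝ := p / ((1 - p) * ((q : ℝ) - 1)) with hθ
  have hθ0 : 0 ≤ θ := by positivity
  have hθ1 : θ ≤ 1 := by
    rw [hθ, div_le_one (by positivity)]
    nlinarith
  have hmarkov := natCard_subtype_mul_le_sum
    (fun x : Fin (lam + s) → Fin q => (dHe x y : ℝ) ≤ s * p) (θ ^ ((s : ℝ) * p))
    (fun x => θ ^ dHe x y) (fun x => by positivity) (fun x hx => by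
      rcases hθ0.eq_or_lt with h0 | h0
      · have hp : p = 0 := by
          rw [hθ, eq_comm, div_eq_zero_iff] at h0
          exact h0.resolve_right (by positivity)
        have hd : dHe x y = 0 := by
          rw [hp, mul_zero] at hx
          exact_mod_cast le_antisymm hx (by positivity)
        simp [hp, hd]
      · rw [← Real.rpow_natCast]
        exact Real.rpow_le_rpow_of_exponent_ge h0 hθ1 hx)
  have hone : 1 + ((q : ℝ) - 1) * θ = (1 - p)⁻¹ := by
    rw [hθ]
    field_simp
    ring
  rw [sum_pow_dHe, hy, hcompl, hone] at hmarkov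
  have hent : θ ^ ((s : ℝ) * p) * (1 - p) ^ s = (q : ℝ) ^ (-(s * Hq q p)) := by
    rw [mul_comm (s : ℝ) p, Real.rpow_mul hθ0, Real.rpow_natCast, ← mul_pow,
      rpow_chernoff_parameter hq hp0 hp1, ← Real.rpow_natCast, ← Real.rpow_mul hq0.le]
    congr 1
    ring
  rw [hs]
  have hpow : (q : ℝ) ^ (-((s : ℝ) * (1 - Hq q p))) * (q : ℝ) ^ (-(s * Hq q p)) =
      ((q : ℝ) ^ s)⁻¹ := by
    rw [← Real.rpow_add hq0, ← Real.rpow_natCast, ← Real.rpow_neg hq0.le]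
    congr 1
    ring
  have hpos : 0 < (q : ℝ) ^ (-((s : ℝ) * Hq q p)) := by positivity
  refine le_of_mul_le_mul_right ?_ hpos
  rw [mul_assoc, hpow, ← hent, ← mul_assoc]
  calc _ ≤ (q : ℝ) ^ lam * (1 - p)⁻¹ ^ s * (1 - p) ^ s := by gcongr
    _ = (q : ℝ) ^ lam := by rw [mul_assoc, ← mul_pow, inv_mul_cancel₀ h1p.ne', one_pow, mul_one]
    _ = _ := by
      have : (q : ℝ) ^ s ≠ 0 := by positivity
      simp [pow_add, this]

/-- Union bound: the number of elements satisfying some `P y` with `y` in the range of `Q`. -/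
theorem natCard_exists_and_le {α β : Type*} [Finite α] [Finite β] (Q : β → Prop)
    (P : β → α → Prop) (c : ℝ) (h : ∀ y, Q y → (Nat.card {x // P y x} : ℝ) ≤ c) :
    (Nat.card {x // ∃ y, Q y ∧ P y x} : ℝ) ≤ Nat.card {y // Q y} * c := by
  classical
  have := Fintype.ofFinite α
  have := Fintype.ofFinite β
  simp only [Nat.card_eq_fintype_card, Fintype.card_subtype] at h ⊢
  have hsub : (Finset.univ.filter fun x => ∃ y, Q y ∧ P y x) ⊆
      (Finset.univ.filter Q).biUnion fun y => Finset.univ.filter (P y) := by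
    intro x
    simp
  rw [← nsmul_eq_mul]
  calc _ ≤ ((∑ y ∈ Finset.univ.filter Q, (Finset.univ.filter (P y)).card : ℕ) : ℝ) := by
        exact_mod_cast (Finset.card_le_card hsub).trans Finset.card_biUnion_le
    _ ≤ _ := by
      push_cast
      exact Finset.sum_le_card_nsmul _ _ _ fun y hy => h y (by simpa using hy)

/-- The number of codes for which at least `k` of the messages are sent, under feedback `z`, into
a set of density at most `a`. -/
theorem natCard_codes_le {M Z W : Type*} [Fintype M] [Fintype Z] [Fintype W] (z : Z)
    (P : W → Prop) (a : ℝ) (hP : (Nat.card {x // P x} : ℝ) ≤ Fintype.card W * a) (k : ℕ)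
    (ha : 0 ≤ a) :
    (Nat.card {C : M × Z → W // k ≤ Nat.card {m // P (C (m, z))}} : ℝ) ≤
      (Fintype.card W : ℝ) ^ Fintype.card (M × Z) * (Fintype.card M * a) ^ k := by
  classical
  have hiff : ∀ C : M × Z → W, k ≤ Nat.card {m // P (C (m, z))} →
      ∃ S : Finset M, S.card = k ∧ ∀ i ∈ S ×ˢ {z}, P (C i) := by
    intro C hC
    rw [Nat.card_eq_fintype_card, Fintype.card_subtype] at hC
    obtain ⟨S, hS, hk⟩ := Finset.exists_subset_card_eq hC
    refine ⟨S, hk, ?_⟩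
    rintro ⟨m, z'⟩ hi
    obtain ⟨hm, rfl⟩ : m ∈ S ∧ z = z' := by simpa using hi
    simpa using hS hm
  have hunion := natCard_exists_and_le (fun S : Finset M => S.card = k)
    (fun S (C : M × Z → W) => ∀ i ∈ S ×ˢ {z}, P (C i))
    ((Fintype.card W : ℝ) ^ Fintype.card (M × Z) * a ^ k) (fun S hS => by
      have h := natCard_forall_mem_le P a hP (S ×ˢ {z})
      rwa [Finset.card_product, Finset.card_singleton, mul_one, hS] at h)
  have hcard : (Nat.card {S : Finset M // S.card = k} : ℝ) ≤ (Fintype.card M : ℝ) ^ k := by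
    rw [Nat.card_eq_fintype_card, Fintype.card_finset_len]
    exact_mod_cast Nat.choose_le_pow _ _
  calc _ ≤ (Nat.card {C : M × Z → W // ∃ S : Finset M, S.card = k ∧ ∀ i ∈ S ×ˢ {z}, P (C i)} : ℝ) := by
        exact_mod_cast Nat.card_le_card_of_injective
          (Subtype.map id hiff) (Subtype.map_injective _ Function.injective_id)
    _ ≤ _ := hunion
    _ ≤ (Fintype.card M : ℝ) ^ k * ((Fintype.card W : ℝ) ^ Fintype.card (M × Z) * a ^ k) := by
        gcongr
    _ = _ := by rw [mul_pow]; ring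

/-- List-decodability of a random code with feedback (Lemma thm:LD /
Appendix E). Let q ≥ 2 be an integer, n, t, λ, L ∈ ℕ with λ ≤ t ≤ n, R > 0, ε_L > 0,
and let p̂ ∈ [0,(q−1)/q] satisfy (t−λ)(1 − H_q(p̂)) ≥ n(R + ε_L). Let M be a finite set
with |M| ≤ q^{Rn}, Z a finite set, g : Y^t → Z any function, and let (X_{m,z}) be
independent uniform random vectors on X^t, modeled as the uniform distribution over
all assignments C : M × Z → X^t. If L + 1 ≥ (n + t·log_q 2 + (t−λ))/(ε_L·n), then the
probability that some y ∈ Y^t with exactly λ erased coordinates has at least L+1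
messages m with d_H(X_{m,g(y)}, y) ≤ (t−λ)·p̂ is at most q^{−n}. -/
theorem random_code_list_decodable (q : ℕ) (hq : 2 ≤ q)
    (n t lam L : ℕ) (hlt : lam ≤ t) (htn : t ≤ n)
    (R εL : ℝ) (hR : 0 < R) (hεL : 0 < εL)
    (phat : ℝ) (hphat : phat ∈ Set.Icc (0 : ℝ) (((q : ℝ) - 1) / q))
    (htraj : (n : ℝ) * (R + εL) ≤ ((t : ℝ) - lam) * (1 - Hq q phat))
    (M : Type) [Fintype M] (hM : (Fintype.card M : ℝ) ≤ (q : ℝ) ^ (R * n))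
    (Z : Type) [Fintype Z] (g : (Fin t → Yq q) → Z)
    (hL : ((n : ℝ) + t * Real.logb q 2 + ((t : ℝ) - lam)) / (εL * n) ≤ (L : ℝ) + 1) :
    (Nat.card {C : M × Z → Fin t → Fin q //
        ∃ y : Fin t → Yq q, Nat.card {i : Fin t // y i = none} = lam ∧
          L + 1 ≤ Nat.card {m : M //
            (dHe (C (m, g y)) y : ℝ) ≤ ((t : ℝ) - lam) * phat}} : ℝ) /
      (Nat.card (M × Z → Fin t → Fin q) : ℝ) ≤ (q : ℝ) ^ (-(n : ℝ)) := by
  classical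
  have hq' : (2 : ℝ) ≤ q := by exact_mod_cast hq
  have hq0 : (0 : ℝ) < q := by linarith
  have hq1 : (1 : ℝ) ≤ q := by linarith
  have : NeZero q := ⟨by omega⟩
  set a : ℝ := (q : ℝ) ^ (-(((t : ℝ) - lam) * (1 - Hq q phat))) with ha
  set N : ℝ := (Fintype.card (Fin t → Fin q) : ℝ) ^ Fintype.card (M × Z) with hN
  have hNpos : 0 < N := by positivity
  have hcodes := natCard_exists_and_le (fun y : Fin t → Yq q => Nat.card {i // y i = none} = lam)
    (fun y (C : M × Z → Fin t → Fin q) => L + 1 ≤ Nat.card {m : M //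
      (dHe (C (m, g y)) y : ℝ) ≤ ((t : ℝ) - lam) * phat})
    (N * (Fintype.card M * a) ^ (L + 1)) (fun y hy =>
      natCard_codes_le (g y) (fun x => (dHe x y : ℝ) ≤ ((t : ℝ) - lam) * phat) a
        (natCard_dHe_le hq hlt hphat y hy) (L + 1) (by positivity))
  have htotal : (Nat.card (M × Z → Fin t → Fin q) : ℝ) = N := by
    rw [Nat.card_eq_fintype_card, Fintype.card_fun, Nat.cast_pow]
  rw [htotal, div_le_iff₀ hNpos]
  refine hcodes.trans ?_
  have herase : (Nat.card {y : Fin t → Yq q // Nat.card {i // y i = none} = lam} : ℝ) ≤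
      (q : ℝ) ^ (t * Real.logb q 2 + ((t : ℝ) - lam)) := by
    refine le_of_mul_le_mul_right ((natCard_erasure_pattern_mul_le q t lam).trans_eq ?_)
      (pow_pos hq0 lam)
    rw [← Real.rpow_natCast (q : ℝ) lam, ← Real.rpow_add hq0, mul_pow, add_assoc,
      sub_add_cancel, Real.rpow_add hq0, Real.rpow_natCast, mul_comm (t : ℝ),
      Real.rpow_mul hq0.le, Real.rpow_logb hq0 (by linarith) two_pos, Real.rpow_natCast]
  have hdens : (Fintype.card M : ℝ) * a ≤ (q : ℝ) ^ (-(εL * n)) := by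
    calc _ ≤ (q : ℝ) ^ (R * n) * a := by gcongr
      _ = (q : ℝ) ^ (R * n + -(((t : ℝ) - lam) * (1 - Hq q phat))) := by
        rw [ha, ← Real.rpow_add hq0]
      _ ≤ _ := Real.rpow_le_rpow_of_exponent_le hq1 (by linarith)
  have hexp : (n : ℝ) + t * Real.logb q 2 + ((t : ℝ) - lam) ≤ ((L : ℝ) + 1) * (εL * n) := by
    rcases n.eq_zero_or_pos with rfl | hn
    · obtain rfl : t = 0 := by omega
      obtain rfl : lam = 0 := by omega
      simp
    · exact (div_le_iff₀ (by positivity)).1 hL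
  calc _ ≤ (q : ℝ) ^ (t * Real.logb q 2 + ((t : ℝ) - lam)) *
        (N * ((q : ℝ) ^ (-(εL * n))) ^ (L + 1)) := by gcongr
    _ = (q : ℝ) ^ (t * Real.logb q 2 + ((t : ℝ) - lam) + -(εL * n) * ((L : ℝ) + 1)) * N := by
      rw [← Real.rpow_natCast _ (L + 1), ← Real.rpow_mul hq0.le,
        Real.rpow_add hq0 (_ + _)]
      push_cast
      ring
    _ ≤ _ := by
      gcongr
      linarith
end

section
/- Existence of a uniformly list-decodable random code (Lemma thm:LD2). Let q ≥ 2 be an integer, let p, r ∈ [0,1], R > 0, ε_L > 0, and let θ ∈ (0,1) and n ∈ ℕ be such that θn and 1/θ are positive integers; set T = {θn, 2θn, …, (1−θ)n} and L = ⌈(2 + log_q 2)/ε_L⌉. Let M be a finite set with |M| ≤ q^{Rn}, let Z be a finite set, and for k = 1,…,1/θ, m ∈ M, z ∈ Z let X_{k,m,z} be independent random vectors, each uniform on X^{θn}; for feedback functions f_k : Y^{kθn} → Z and y ∈ Y^{kθn}, let P(m,y) ∈ X^{kθn} denote the concatenation X_{1,m,z₀} ∘ X_{2,m,f_1(y_1..y_{θn})}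 ∘ ⋯ ∘ X_{k,m,f_{k−1}(y_1..y_{(k−1)θn})} (z₀ a fixed default symbol). Then with probability at least 1 − ((1−θ)/θ)·(n+1)·q^{−n}, the following holds simultaneously for every t = kθn ∈ T and every integer λ with 0 ≤ λ ≤ min(t, rn) and t − λ ≥ n(R + ε_L): for every y ∈ Y^t with exactly λ erased coordinates, at most L messages m ∈ M satisfy d_H(P(m,y), y) ≤ (t−λ)·p̂_{t,λ}, where p̂_{t,λ} is the unique value in [0,(q−1)/q] with (t−λ)(1 − H_q(p̂_{t,λ})) = n(R + ε_L). -/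
/-- The codeword prefix `P(m,y) = X_{1,m,z₀} ∘ X_{2,m,f_1(y…)} ∘ ⋯ ∘ X_{k,m,f_{k−1}(y…)}`
of length `k·s` (blocks of length `s = θn`), built from the random sub-codewords `ω`,
the message `m`, the default feedback symbol `z₀` and feedback functions `f_j` applied
to received prefixes of length `j·s`. -/
def Pword {q s K : ℕ} {M Z : Type*} (hs : 0 < s) (z₀ : Z)
    (f : (j : ℕ) → (Fin (j * s) → Yq q) → Z)
    (ω : Fin K × M × Z → Fin s → Fin q) (m : M)
    {k : ℕ} (hk : k ≤ K) (y : Fin (k * s) → Yq q) : Fin (k * s) → Fin q :=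
  fun i =>
    have hj : i.val / s < k := (Nat.div_lt_iff_lt_mul hs).mpr i.isLt
    ω (⟨i.val / s, lt_of_lt_of_le hj hk⟩, m,
        if i.val / s = 0 then z₀
        else f (i.val / s)
          (fun a => y ⟨a.val, lt_of_lt_of_le a.isLt (Nat.mul_le_mul hj.le (le_refl s))⟩))
      ⟨i.val % s, Nat.mod_lt _ hs⟩

open Finset in
/-- Sampling a uniform `g : J → α` along an injection `φ : I → J` gives independent uniform
coordinates: the mean of `∏ i, w i (g (φ i))` is the product of the means of the `w i`. -/
theorem sum_prod_comp_injective {I J α : Type*} [Fintype I] [Fintype J] [Fintype α]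
    [DecidableEq J] (φ : I → J) (hφ : Function.Injective φ) (w : I → α → ℝ) :
    (∑ g : J → α, ∏ i, w i (g (φ i))) * (Fintype.card α : ℝ) ^ Fintype.card I =
      (Fintype.card (J → α) : ℝ) * ∏ i, ∑ a, w i a := by
  classical
  let v : J → α → ℝ := Function.extend φ w 1
  have hprod (F : (α → ℝ) → ℝ) : ∏ j, F (v j) =
      (∏ i, F (w i)) * F 1 ^ (Fintype.card J - Fintype.card I) := by
    rw [← prod_mul_prod_compl (univ.image φ), prod_image hφ.injOn]
    congr 1
    · exact prod_congr rfl fun i _ => by simp [v, hφ.extend_apply]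
    · rw [prod_congr rfl (g := fun _ => F 1), prod_const, card_compl, card_image_of_injective _ hφ,
        card_univ]
      intro j hj
      have : ¬ ∃ i, φ i = j := by simpa using hj
      simp [v, Function.extend_apply' _ _ _ this]
  have hsum : ∑ g : J → α, ∏ i, w i (g (φ i)) = ∏ j, ∑ a, v j a := by
    rw [prod_univ_sum, Fintype.piFinset_univ]
    refine sum_congr rfl fun g _ => ?_
    rw [← prod_mul_prod_compl (univ.image φ), prod_image hφ.injOn, prod_eq_one (s := _ᶜ), mul_one]
    · exact prod_congr rfl fun i _ => by simp [v, hφ.extend_apply]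
    · intro j hj
      have : ¬ ∃ i, φ i = j := by simpa using hj
      simp [v, Function.extend_apply' _ _ _ this]
  rw [hsum, hprod fun u => ∑ a, u a, Fintype.card_fun]
  have hcard : Fintype.card J = Fintype.card J - Fintype.card I + Fintype.card I :=
    (Nat.sub_add_cancel (Fintype.card_le_of_injective φ hφ)).symm
  conv_rhs => rw [hcard]
  simp only [Pi.one_apply, sum_const, card_univ, nsmul_eq_mul, mul_one]
  push_cast
  ring

/-- The likelihood of the input symbol `a` given the output `o` of a `q`-ary symmetric channel with
crossover probability `p`; an erased output carries no information. -/
noncomputable def symmetricWeight (q : ℕ) (p : ℝ) (o : Yq q) (a : Fin q) : ℝ :=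
  if o = none then 1 else if o = some a then 1 - p else p / ((q : ℝ) - 1)

theorem symmetricWeight_nonneg {q : ℕ} (hq : 2 ≤ q) {p : ℝ}
    (hp : p ∈ Set.Icc (0 : ℝ) (((q : ℝ) - 1) / q)) (o : Yq q) (a : Fin q) :
    0 ≤ symmetricWeight q p o a := by
  have hq' : (2 : ℝ) ≤ q := by exact_mod_cast hq
  have hp1 : p ≤ 1 := hp.2.trans ((div_le_one (by linarith)).2 (by linarith))
  have := hp.1
  unfold symmetricWeight
  split_ifs
  · exact zero_le_one
  · linarith
  · exact div_nonneg this (by linarith)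

theorem sum_symmetricWeight {q : ℕ} (hq : 2 ≤ q) (p : ℝ) (o : Yq q) :
    ∑ a, symmetricWeight q p o a = if o = none then (q : ℝ) else 1 := by
  have hq' : (2 : ℝ) ≤ q := by exact_mod_cast hq
  have hq1 : (q : ℝ) - 1 ≠ 0 := by linarith
  rcases o with _ | b
  · simp [symmetricWeight]
  · simp only [symmetricWeight, reduceCtorEq, if_false, Option.some.injEq]
    rw [← Finset.add_sum_erase _ _ (Finset.mem_univ b), Finset.sum_congr rfl
      (g := fun _ => p / ((q : ℝ) - 1)) fun a ha => if_neg (Finset.ne_of_mem_erase ha).symm]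
    rw [Finset.sum_const, Finset.card_erase_of_mem (Finset.mem_univ b), Finset.card_univ,
      Fintype.card_fin, nsmul_eq_mul, Nat.cast_sub (by omega)]
    simp only [if_true, Nat.cast_one]
    field_simp
    ring

theorem prod_sum_symmetricWeight {q t : ℕ} (hq : 2 ≤ q) (p : ℝ) (y : Fin t → Yq q) :
    ∏ i, ∑ a, symmetricWeight q p (y i) a = (q : ℝ) ^ Nat.card {i : Fin t // y i = none} := by
  simp only [sum_symmetricWeight hq, Finset.prod_ite, Finset.prod_const, one_pow, mul_one,
    Nat.card_eq_fintype_card, Fintype.card_subtype]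

open Finset in
theorem prod_symmetricWeight {q t : ℕ} (p : ℝ) (x : Fin t → Fin q) (y : Fin t → Yq q) :
    ∃ a : ℕ, a + dHe x y + Nat.card {i : Fin t // y i = none} = t ∧
      ∏ i, symmetricWeight q p (y i) (x i) = (1 - p) ^ a * (p / ((q : ℝ) - 1)) ^ dHe x y := by
  classical
  refine ⟨#{i | y i = some (x i)}, ?_, ?_⟩
  · have h1 := card_filter_add_card_filter_not (s := (univ : Finset (Fin t))) (fun i => y i = none)
    have h2 := card_filter_add_card_filter_not (s := (univ : Finset (Fin t)).filter
      (fun i => ¬ y i = none)) (fun i => y i = some (x i))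
    simp only [filter_filter, card_univ, Fintype.card_fin] at h1 h2
    have h3 : (univ.filter fun i => ¬ y i = none ∧ y i = some (x i)) =
        univ.filter fun i => y i = some (x i) := by
      ext i; simp +contextual
    rw [h3] at h2
    simp only [dHe, Nat.card_eq_fintype_card, Fintype.card_subtype, ne_eq]
    omega
  · have h (i : Fin t) : symmetricWeight q p (y i) (x i) =
        (if y i = some (x i) then 1 - p else 1) *
          (if y i ≠ none ∧ y i ≠ some (x i) then p / ((q : ℝ) - 1) else 1) := by
      unfold symmetricWeight
      rcases y i with _ | b
      · simp
      · by_cases hb : b = x i <;> simp [hb]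
    simp only [h, prod_mul_distrib, prod_ite, prod_const, one_pow, mul_one, dHe,
      Nat.card_eq_fintype_card, Fintype.card_subtype]

theorem rpow_neg_Hq_le {q : ℕ} (hq : 2 ≤ q) {p : ℝ}
    (hp : p ∈ Set.Icc (0 : ℝ) (((q : ℝ) - 1) / q)) {a d : ℕ} {N : ℝ} (hN : (a : ℝ) + d = N)
    (hd : (d : ℝ) ≤ N * p) :
    (q : ℝ) ^ (-(N * Hq q p)) ≤ (1 - p) ^ a * (p / ((q : ℝ) - 1)) ^ d := by
  have hq' : (2 : ℝ) ≤ q := by exact_mod_cast hq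
  have hq0 : (0 : ℝ) < q := by linarith
  have hq1 : (0 : ℝ) < (q : ℝ) - 1 := by linarith
  have hpq : p * q ≤ q - 1 := (le_div_iff₀ hq0).1 hp.2
  rcases hp.1.eq_or_lt with rfl | hp0
  · have : d = 0 := by
      have : (d : ℝ) ≤ 0 := by simpa using hd
      exact_mod_cast le_antisymm this (Nat.cast_nonneg d)
    subst this
    simp [Hq]
  have hp1 : 0 < 1 - p := by nlinarith
  have hlog : Real.log p ≤ Real.log (1 - p) + Real.log ((q : ℝ) - 1) := by
    rw [← Real.log_mul hp1.ne' hq1.ne']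
    exact Real.log_le_log hp0 (by nlinarith)
  have hγ : 0 < p / ((q : ℝ) - 1) := div_pos hp0 hq1
  have hlq : Real.log q ≠ 0 := (Real.log_pos (by linarith)).ne'
  rw [← Real.log_le_log_iff (Real.rpow_pos_of_pos hq0 _) (by positivity), Real.log_rpow hq0,
    Real.log_mul (by positivity) (by positivity), Real.log_pow, Real.log_pow,
    Real.log_div hp0.ne' hq1.ne']
  have hH : Hq q p * Real.log q = p * Real.log ((q : ℝ) - 1) - p * Real.log p -
      (1 - p) * Real.log (1 - p) := by
    unfold Hq Real.logb
    field_simp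
  have := mul_nonneg (sub_nonneg.2 hd) (sub_nonneg.2 hlog)
  have ha : (a : ℝ) = N - d := by linarith
  rw [neg_mul, mul_assoc, hH, ha]
  linarith

open Finset in
open scoped Classical in
/-- Exponential bound on the probability that all messages of `S` lie in the Hamming ball around
a fixed received word. -/
theorem card_forall_dHe_le {q s K k : ℕ} (hq : 2 ≤ q) {M Z : Type} [Fintype M] [Fintype Z]
    (hs : 0 < s) (z₀ : Z) (f : (j : ℕ) → (Fin (j * s) → Yq q) → Z) (hk : k ≤ K)
    (y : Fin (k * s) → Yq q) (S : Finset M) {p N : ℝ}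
    (hp : p ∈ Set.Icc (0 : ℝ) (((q : ℝ) - 1) / q))
    (hN : ((k * s : ℕ) : ℝ) - (Nat.card {i : Fin (k * s) // y i = none} : ℕ) = N) :
    (#{ω : Fin K × M × Z → Fin s → Fin q | ∀ m ∈ S, (dHe (Pword hs z₀ f ω m hk y) y : ℝ) ≤ N * p} :
      ℝ) ≤ Fintype.card (Fin K × M × Z → Fin s → Fin q) *
        (q : ℝ) ^ (-(N * (1 - Hq q p)) * #S) := by
  have hq0 : (0 : ℝ) < q := by exact_mod_cast (by omega : 0 < q)
  set lam := Nat.card {i : Fin (k * s) // y i = none} with hlam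
  set A : Finset (Fin K × M × Z → Fin s → Fin q) :=
    {ω | ∀ m ∈ S, (dHe (Pword hs z₀ f ω m hk y) y : ℝ) ≤ N * p}
  let zz (i : Fin (k * s)) : Z :=
    if i.val / s = 0 then z₀ else f (i.val / s) (fun a => y ⟨a.val, lt_of_lt_of_le a.isLt
      (Nat.mul_le_mul ((Nat.div_lt_iff_lt_mul hs).mpr i.isLt).le (le_refl s))⟩)
  let φ (e : S × Fin (k * s)) : (Fin K × M × Z) × Fin s :=
    ((⟨e.2.val / s, lt_of_lt_of_le ((Nat.div_lt_iff_lt_mul hs).mpr e.2.isLt) hk⟩, e.1.1, zz e.2),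
      ⟨e.2.val % s, Nat.mod_lt _ hs⟩)
  have hφ : Function.Injective φ := by
    rintro ⟨m, i⟩ ⟨m', i'⟩ h
    simp only [φ, Prod.mk.injEq, Fin.mk.injEq] at h
    obtain ⟨⟨h1, h2, -⟩, h3⟩ := h
    have : i.val = i'.val := by rw [← Nat.div_add_mod i.val s, h1, h3, Nat.div_add_mod]
    exact Prod.ext (Subtype.ext h2) (Fin.ext this)
  have key := sum_prod_comp_injective φ hφ fun e a => symmetricWeight q p (y e.2) a
  rw [Fintype.prod_prod_type] at key
  simp only [prod_sum_symmetricWeight hq, prod_const, card_univ, Fintype.card_prod,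
    Fintype.card_coe, Fintype.card_fin, ← hlam] at key
  rw [← (Equiv.curry (Fin K × M × Z) (Fin s) (Fin q)).symm.sum_comp,
    Fintype.card_congr (Equiv.curry (Fin K × M × Z) (Fin s) (Fin q))] at key
  have hω (ω : Fin K × M × Z → Fin s → Fin q) :
      ∏ e : S × Fin (k * s), symmetricWeight q p (y e.2)
          ((Equiv.curry (Fin K × M × Z) (Fin s) (Fin q)).symm ω (φ e)) =
        ∏ m ∈ S, ∏ i, symmetricWeight q p (y i) (Pword hs z₀ f ω m hk y i) := by
    rw [Fintype.prod_prod_type, ← prod_coe_sort S]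
    rfl
  simp only [hω] at key
  have hlow : (#A : ℝ) * ((q : ℝ) ^ (-(N * Hq q p))) ^ #S ≤
      ∑ ω : Fin K × M × Z → Fin s → Fin q,
        ∏ m ∈ S, ∏ i, symmetricWeight q p (y i) (Pword hs z₀ f ω m hk y i) := by
    rw [← nsmul_eq_mul, ← sum_const]
    refine (sum_le_sum fun ω hωA => ?_).trans (sum_le_sum_of_subset_of_nonneg (subset_univ A)
      fun ω _ _ => prod_nonneg fun m _ => prod_nonneg fun i _ => symmetricWeight_nonneg hq hp _ _)
    rw [← prod_const]
    refine prod_le_prod (fun _ _ => by positivity) fun m hm => ?_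
    obtain ⟨a, ha, hprod⟩ := prod_symmetricWeight p (Pword hs z₀ f ω m hk y) y
    rw [hprod]
    refine rpow_neg_Hq_le hq hp ?_ ((mem_filter.1 hωA).2 m hm)
    have ha' : (a : ℝ) + dHe (Pword hs z₀ f ω m hk y) y + lam = (k * s : ℕ) := by
      exact_mod_cast ha
    linarith
  have hmul := mul_le_mul_of_nonneg_right hlow
    (by positivity : (0 : ℝ) ≤ (q : ℝ) ^ (#S * (k * s)))
  rw [key] at hmul
  have hpos : (0 : ℝ) < ((q : ℝ) ^ (-(N * Hq q p))) ^ #S * (q : ℝ) ^ (#S * (k * s)) := by positivity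
  rw [mul_assoc] at hmul
  refine ((le_div_iff₀ hpos).2 hmul).trans (le_of_eq ?_)
  rw [mul_div_assoc]
  congr 1
  rw [div_eq_iff hpos.ne']
  simp only [← Real.rpow_natCast, ← Real.rpow_mul hq0.le, ← Real.rpow_add hq0]
  congr 1
  push_cast at hN ⊢
  rw [← hN]
  ring

open Finset in
open scoped Classical in
/-- Union bound over received words and over lists of `L + 1` messages, for a fixed decoding point
and number of erasures. -/
theorem card_not_listDecodable_le {q s K k : ℕ} (hq : 2 ≤ q) {M Z : Type} [Fintype M] [Fintype Z]
    (hs : 0 < s) (z₀ : Z) (f : (j : ℕ) → (Fin (j * s) → Yq q) → Z) (hk : k ≤ K)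
    {n L lam : ℕ} (hn : k * s ≤ n) {R ε : ℝ} (hL : 2 + Real.logb q 2 ≤ ε * (L + 1))
    (hM : (Fintype.card M : ℝ) ≤ (q : ℝ) ^ (R * n))
    {p : ℝ} (hp : p ∈ Set.Icc (0 : ℝ) (((q : ℝ) - 1) / q))
    (hpH : (((k * s : ℕ) : ℝ) - lam) * (1 - Hq q p) = n * (R + ε)) :
    (#{ω : Fin K × M × Z → Fin s → Fin q | ∃ y : Fin (k * s) → Yq q,
        Nat.card {i : Fin (k * s) // y i = none} = lam ∧
        L < Nat.card {m : M // (dHe (Pword hs z₀ f ω m hk y) y : ℝ) ≤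
          (((k * s : ℕ) : ℝ) - lam) * p}} : ℝ) ≤
      Fintype.card (Fin K × M × Z → Fin s → Fin q) * (q : ℝ) ^ (-(n : ℝ)) := by
  have hq' : (2 : ℝ) ≤ q := by exact_mod_cast hq
  have hq0 : (0 : ℝ) < q := by linarith
  set C := Fintype.card (Fin K × M × Z → Fin s → Fin q)
  set N : ℝ := ((k * s : ℕ) : ℝ) - lam
  let Y : Finset (Fin (k * s) → Yq q) := {y | Nat.card {i : Fin (k * s) // y i = none} = lam}
  let E (e : (Fin (k * s) → Yq q) × Finset M) : Finset (Fin K × M × Z → Fin s → Fin q) :=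
    {ω | ∀ m ∈ e.2, (dHe (Pword hs z₀ f ω m hk e.1) e.1 : ℝ) ≤ N * p}
  have hsub : ({ω : Fin K × M × Z → Fin s → Fin q | ∃ y : Fin (k * s) → Yq q,
        Nat.card {i : Fin (k * s) // y i = none} = lam ∧
        L < Nat.card {m : M // (dHe (Pword hs z₀ f ω m hk y) y : ℝ) ≤ N * p}} :
      Finset (Fin K × M × Z → Fin s → Fin q)) ⊆
      (Y ×ˢ powersetCard (L + 1) univ).biUnion E := by
    intro ω hω
    obtain ⟨y, hy, hlt⟩ := (mem_filter.1 hω).2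
    rw [Nat.card_eq_fintype_card, Fintype.card_subtype] at hlt
    obtain ⟨S, hS, hScard⟩ := exists_subset_card_eq (Nat.succ_le_of_lt hlt)
    refine mem_biUnion.2 ⟨(y, S), mem_product.2 ⟨by simpa [Y] using hy,
      mem_powersetCard.2 ⟨subset_univ _, hScard⟩⟩, mem_filter.2 ⟨mem_univ _, fun m hm => ?_⟩⟩
    exact (mem_filter.1 (hS hm)).2
  have hE : ∀ e ∈ Y ×ˢ powersetCard (L + 1) (univ : Finset M),
      (#(E e) : ℝ) ≤ C * (q : ℝ) ^ (-(n * (R + ε)) * ((L : ℝ) + 1)) := by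
    rintro ⟨y, S⟩ he
    obtain ⟨hy, hS⟩ := mem_product.1 he
    have hy' : Nat.card {i : Fin (k * s) // y i = none} = lam := (mem_filter.1 hy).2
    have := card_forall_dHe_le hq hs z₀ f hk y S (N := N) hp (by rw [hy'])
    rw [hpH, (mem_powersetCard.1 hS).2] at this
    exact_mod_cast this
  have hY : (#Y : ℝ) ≤ (q : ℝ) ^ ((1 + Real.logb q 2) * n) := by
    calc (#Y : ℝ) ≤ ((q : ℝ) + 1) ^ (k * s) := by
          have := card_le_univ Y
          rw [Fintype.card_fun, Fintype.card_option, Fintype.card_fin, Fintype.card_fin] at this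
          exact_mod_cast this
      _ ≤ ((q : ℝ) * 2) ^ (k * s) := by gcongr; linarith
      _ ≤ ((q : ℝ) * 2) ^ n := pow_le_pow_right₀ (by linarith) hn
      _ = _ := by
          rw [Real.rpow_mul_natCast hq0.le, Real.rpow_add hq0, Real.rpow_one,
            Real.rpow_logb hq0 (by linarith) two_pos]
  have hPS : (#(powersetCard (L + 1) (univ : Finset M)) : ℝ) ≤ (q : ℝ) ^ (R * n * ((L : ℝ) + 1)) := by
    rw [card_powersetCard, card_univ]
    calc ((Fintype.card M).choose (L + 1) : ℝ) ≤ (Fintype.card M : ℝ) ^ (L + 1) := by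
          exact_mod_cast Nat.choose_le_pow _ _
      _ ≤ ((q : ℝ) ^ (R * n)) ^ (L + 1) := by gcongr
      _ = _ := by rw [← Real.rpow_mul_natCast hq0.le]; push_cast; rfl
  calc _ ≤ (#((Y ×ˢ powersetCard (L + 1) univ).biUnion E) : ℝ) := by
        exact_mod_cast card_le_card hsub
    _ ≤ ∑ e ∈ Y ×ˢ powersetCard (L + 1) univ, (#(E e) : ℝ) := by exact_mod_cast card_biUnion_le
    _ ≤ #(Y ×ˢ powersetCard (L + 1) univ) • (C * (q : ℝ) ^ (-(n * (R + ε)) * ((L : ℝ) + 1))) :=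
        sum_le_card_nsmul _ _ _ hE
    _ = (#Y * #(powersetCard (L + 1) (univ : Finset M)) : ℝ) *
          (C * (q : ℝ) ^ (-(n * (R + ε)) * ((L : ℝ) + 1))) := by
        rw [nsmul_eq_mul, card_product, Nat.cast_mul]
    _ ≤ ((q : ℝ) ^ ((1 + Real.logb q 2) * n) * (q : ℝ) ^ (R * n * ((L : ℝ) + 1))) *
          (C * (q : ℝ) ^ (-(n * (R + ε)) * ((L : ℝ) + 1))) := by gcongr
    _ = C * (q : ℝ) ^ ((1 + Real.logb q 2) * n + R * n * ((L : ℝ) + 1) +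
          -(n * (R + ε)) * ((L : ℝ) + 1)) := by
        rw [Real.rpow_add hq0, Real.rpow_add hq0]; ring
    _ ≤ C * (q : ℝ) ^ (-(n : ℝ)) := by
        gcongr
        · linarith
        · nlinarith [mul_le_mul_of_nonneg_left hL (Nat.cast_nonneg (α := ℝ) n)]

theorem one_sub_le_card_subtype_div {Ω : Type*} [Fintype Ω] [Nonempty Ω] {P : Ω → Prop}
    (B : Finset Ω) (hB : ∀ ω, ¬ P ω → ω ∈ B) {δ : ℝ} (hδ : (B.card : ℝ) ≤ δ * Fintype.card Ω) :
    1 - δ ≤ (Nat.card {ω // P ω} : ℝ) / Nat.card Ω := by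
  classical
  have hpos : (0 : ℝ) < Fintype.card Ω := by exact_mod_cast Fintype.card_pos
  rw [Nat.card_eq_fintype_card, Nat.card_eq_fintype_card, Fintype.card_subtype, le_div_iff₀ hpos]
  have h := Finset.card_filter_add_card_filter_not (s := (Finset.univ : Finset Ω)) P
  have hle : (Finset.univ.filter fun ω => ¬ P ω).card ≤ B.card :=
    Finset.card_le_card fun ω hω => hB ω (Finset.mem_filter.1 hω).2
  rw [Finset.card_univ] at h
  have h' : (Fintype.card Ω : ℝ) ≤ (Finset.univ.filter P).card + B.card := by
    exact_mod_cast (by omega)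
  linarith

/-- Existence of a uniformly list-decodable random code (Lemma thm:LD2).
With `θ = 1/K = s/n` (so `θn = s` and `1/θ = K` are integers), `T = {s, 2s, …, (K−1)s}`
and `L = ⌈(2 + log_q 2)/ε_L⌉`, for a uniformly random assignment `ω` of the
sub-codewords `X_{k,m,z}`, with probability at least `1 − ((1−θ)/θ)(n+1)q^{−n}` the
following holds simultaneously for every `t = k·s ∈ T` and every `λ ≤ min(t, rn)`
with `t − λ ≥ n(R + ε_L)`: for every received prefix `y ∈ Y^t` with exactly `λ` erased
coordinates, at most `L` messages `m` satisfy `d_H(P(m,y), y) ≤ (t−λ)·p̂_{t,λ}`, where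
`p̂_{t,λ}` is the unique value in `[0,(q−1)/q]` with
`(t−λ)(1 − H_q(p̂_{t,λ})) = n(R + ε_L)`. -/
theorem uniformly_list_decodable_code (q : ℕ) (hq : 2 ≤ q)
    (p r R εL θ : ℝ) (hp : p ∈ Set.Icc (0 : ℝ) 1) (hr : r ∈ Set.Icc (0 : ℝ) 1)
    (hR : 0 < R) (hεL : 0 < εL) (hθ0 : 0 < θ) (hθ1 : θ < 1)
    (n s K : ℕ) (hs : 0 < s) (hsθ : (s : ℝ) = θ * n) (hK : (K : ℝ) = 1 / θ)
    (L : ℕ) (hL : L = ⌈(2 + Real.logb q 2) / εL⌉₊)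
    (M : Type) [Fintype M] (hM : (Fintype.card M : ℝ) ≤ (q : ℝ) ^ (R * n))
    (Z : Type) [Fintype Z] (z₀ : Z)
    (f : (j : ℕ) → (Fin (j * s) → Yq q) → Z)
    (phat : ℕ → ℕ → ℝ)
    (hphat : ∀ k lam : ℕ, 1 ≤ k → k ≤ K - 1 → lam ≤ k * s → (lam : ℝ) ≤ r * n →
      (n : ℝ) * (R + εL) ≤ ((k * s : ℕ) : ℝ) - lam →
      phat k lam ∈ Set.Icc (0 : ℝ) (((q : ℝ) - 1) / q) ∧
      (((k * s : ℕ) : ℝ) - lam) * (1 - Hq q (phat k lam)) = (n : ℝ) * (R + εL)) :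
    1 - ((1 - θ) / θ) * ((n : ℝ) + 1) * (q : ℝ) ^ (-(n : ℝ)) ≤
      (Nat.card {ω : Fin K × M × Z → Fin s → Fin q //
        ∀ k lam : ℕ, ∀ h1 : 1 ≤ k, ∀ hk : k ≤ K - 1, lam ≤ k * s → (lam : ℝ) ≤ r * n →
          (n : ℝ) * (R + εL) ≤ ((k * s : ℕ) : ℝ) - lam →
          ∀ y : Fin (k * s) → Yq q, Nat.card {i : Fin (k * s) // y i = none} = lam →
            Nat.card {m : M //
              (dHe (Pword hs z₀ f ω m (show k ≤ K by omega) y) y : ℝ) ≤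
                (((k * s : ℕ) : ℝ) - lam) * phat k lam} ≤ L} : ℝ) /
        (Nat.card (Fin K × M × Z → Fin s → Fin q) : ℝ) := by
  classical
  have hq' : (2 : ℝ) ≤ q := by exact_mod_cast hq
  have hq0 : (0 : ℝ) < q := by linarith
  have hKpos : 1 ≤ K := by
    have : (0 : ℝ) < K := by rw [hK]; positivity
    exact_mod_cast this
  have hKs : K * s = n := by
    have : (K : ℝ) * s = n := by rw [hK, hsθ]; field_simp
    exact_mod_cast this
  have hKθ : (1 - θ) / θ = ((K - 1 : ℕ) : ℝ) := by
    rw [Nat.cast_sub hKpos, hK, Nat.cast_one, sub_div, div_self hθ0.ne']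
  have hLε : 2 + Real.logb q 2 ≤ εL * (L + 1) := by
    have h := Nat.le_ceil ((2 + Real.logb q 2) / εL)
    rw [← hL, div_le_iff₀ hεL] at h
    linarith
  let Bad (e : ℕ × ℕ) : Finset (Fin K × M × Z → Fin s → Fin q) :=
    {ω | ∃ _ : 1 ≤ e.1, ∃ hk : e.1 ≤ K - 1, e.2 ≤ e.1 * s ∧ (e.2 : ℝ) ≤ r * n ∧
      (n : ℝ) * (R + εL) ≤ ((e.1 * s : ℕ) : ℝ) - e.2 ∧ ∃ y : Fin (e.1 * s) → Yq q,
        Nat.card {i : Fin (e.1 * s) // y i = none} = e.2 ∧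
        L < Nat.card {m : M // (dHe (Pword hs z₀ f ω m (show e.1 ≤ K by omega) y) y : ℝ) ≤
          (((e.1 * s : ℕ) : ℝ) - e.2) * phat e.1 e.2}}
  set C := Fintype.card (Fin K × M × Z → Fin s → Fin q)
  have hBad (e : ℕ × ℕ) : ((Bad e).card : ℝ) ≤ C * (q : ℝ) ^ (-(n : ℝ)) := by
    by_cases h : 1 ≤ e.1 ∧ e.1 ≤ K - 1 ∧ e.2 ≤ e.1 * s ∧ (e.2 : ℝ) ≤ r * n ∧
        (n : ℝ) * (R + εL) ≤ ((e.1 * s : ℕ) : ℝ) - e.2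
    · obtain ⟨h1, hk, hlam, hlr, hdim⟩ := h
      obtain ⟨hp1, hp2⟩ := hphat e.1 e.2 h1 hk hlam hlr hdim
      have hkK : e.1 ≤ K := by omega
      refine le_trans ?_ (card_not_listDecodable_le hq hs z₀ f hkK
        ((Nat.mul_le_mul_right s hkK).trans hKs.le) hLε hM hp1 hp2)
      refine Nat.cast_le.2 (Finset.card_le_card fun ω hω => ?_)
      obtain ⟨_, _, _, _, _, hy⟩ := (Finset.mem_filter.1 hω).2
      exact Finset.mem_filter.2 ⟨Finset.mem_univ _, hy⟩
    · have : Bad e = ∅ := by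
        refine Finset.filter_eq_empty_iff.2 fun ω _ hω => h ?_
        obtain ⟨h1, h2, h3, h4, h5, _⟩ := hω
        exact ⟨h1, h2, h3, h4, h5⟩
      rw [this, Finset.card_empty, Nat.cast_zero]
      positivity
  have : Nonempty (Fin q) := ⟨⟨0, by omega⟩⟩
  refine one_sub_le_card_subtype_div ((Finset.Icc 1 (K - 1) ×ˢ Finset.range (n + 1)).biUnion Bad)
    (fun ω hω => ?_) ?_
  · push Not at hω
    obtain ⟨k, lam, h1, hk, hlam, hlr, hdim, y, hy, hlt⟩ := hω
    have : k * s ≤ n := (Nat.mul_le_mul_right s (by omega)).trans hKs.le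
    exact Finset.mem_biUnion.2 ⟨(k, lam), Finset.mem_product.2 ⟨Finset.mem_Icc.2 ⟨h1, hk⟩,
      Finset.mem_range.2 (by omega)⟩, Finset.mem_filter.2 ⟨Finset.mem_univ _,
        h1, hk, hlam, hlr, hdim, y, hy, hlt⟩⟩
  · calc (((Finset.Icc 1 (K - 1) ×ˢ Finset.range (n + 1)).biUnion Bad).card : ℝ)
        ≤ ∑ e ∈ Finset.Icc 1 (K - 1) ×ˢ Finset.range (n + 1), ((Bad e).card : ℝ) := by
          exact_mod_cast Finset.card_biUnion_le
      _ ≤ _ := Finset.sum_le_card_nsmul _ _ _ fun e _ => hBad e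
      _ = _ := by
          rw [nsmul_eq_mul, Finset.card_product, Nat.card_Icc, Finset.card_range, hKθ]
          push_cast [Nat.add_sub_cancel]
          ring
end

section
/- Feedback distance property of a random code (Lemma thm:cb_fb). Let q ≥ 2 be an integer, let R > 0, ε_L ∈ (0,1), L ∈ ℕ, and let θ ∈ (0,1) and n ∈ ℕ be such that θn, 1/θ and L/θ are positive integers with L/θ ≥ 2; set T = 1/θ − 1 and δ = (q−1)(1−ε_L)(1+ε_L)/q. Let M be a finite set with |M| ≤ q^{Rn}, let Z be a finite set, and let (X_{k,m,z}) for k ∈ {1,…,T}, m ∈ M, z ∈ Z be independent random vectors, each uniform on X^{θn}. Let E be the event that there exist k ∈ {1,…,T} and a set S ⊆ M with |S| = L/θ such that for every z ∈ Z there are distinct m′, m″ ∈ S with Hamming distance d_H(X_{k,m′,z}, X_{k,m″,z}) ≤ θn·δ. Then P(E) ≤ T · C(L/θ, 2)^{|Z|} · q^{(RnL/θ) − |Z|·θn·(1 − H_q(δ))}, where C(a,2) = a(a−1)/2. In particular, if |Z| > R·L/(θ²·(1 − H_q(δ))), then P(E) ≤ T · C(L/θ,2)^{|Z|} · q^{−cn}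 with c = |Z|·θ·(1 − H_q(δ)) − R·L/θ > 0, so P(E) → 0 exponentially fast in n. -/
/-- The Chernoff-type bound on the size of a Hamming ball around the origin. -/
lemma card_hammingNorm_le (q : ℕ) (hq : 2 ≤ q) {G : Type*} [Fintype G] [DecidableEq G] [Zero G]
    (hG : Fintype.card G = q) (s : ℕ) {δ : ℝ} (h0 : 0 < δ) (h1 : δ < ((q : ℝ) - 1) / q) :
    ((Finset.univ.filter fun v : Fin s → G => (hammingNorm v : ℝ) ≤ s * δ).card : ℝ) ≤
      (q : ℝ) ^ (s * Hq q δ) := by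
  have hq2 : (2 : ℝ) ≤ q := by exact_mod_cast hq
  have hlogq : 0 < Real.log q := Real.log_pos (by linarith)
  have hδq : δ * q < q - 1 := (lt_div_iff₀ (by linarith)).1 h1
  have hδ1 : 0 < 1 - δ := by
    by_contra h
    nlinarith
  set y : ℝ := δ / ((q - 1) * (1 - δ)) with hy
  have hq1 : (0 : ℝ) < q - 1 := by linarith
  have hy0 : 0 < y := by positivity
  have hy1 : y ≤ 1 := by
    rw [hy, div_le_one (by positivity)]
    nlinarith
  have hsum : ∑ v : Fin s → G, y ^ hammingNorm v = (1 / (1 - δ)) ^ s := by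
    have hprod (v : Fin s → G) : y ^ hammingNorm v = ∏ i, if v i = 0 then 1 else y := by
      rw [Finset.prod_ite]
      simp [hammingNorm]
    have hone : ∑ a : G, (if a = 0 then 1 else y) = 1 / (1 - δ) := by
      rw [Finset.sum_ite, Finset.filter_ne', Finset.filter_eq', if_pos (Finset.mem_univ _)]
      simp only [Finset.sum_const, Finset.card_singleton, one_smul, Finset.card_erase_of_mem
        (Finset.mem_univ _), Finset.card_univ, hG, nsmul_eq_mul]
      rw [Nat.cast_sub (by omega), hy]
      push_cast
      field_simp
      ring
    simp_rw [hprod]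
    calc ∑ v : Fin s → G, ∏ i, (if v i = 0 then 1 else y)
        = ∏ _i : Fin s, ∑ a : G, (if a = 0 then 1 else y) := by
          rw [Finset.prod_univ_sum, Fintype.piFinset_univ]
      _ = (1 / (1 - δ)) ^ s := by simp [hone]
  have hmain : ((Finset.univ.filter fun v : Fin s → G => (hammingNorm v : ℝ) ≤ s * δ).card : ℝ) *
      y ^ (s * δ) ≤ (1 / (1 - δ)) ^ s := by
    rw [← hsum, ← nsmul_eq_mul, ← Finset.sum_const]
    refine (Finset.sum_le_sum fun v hv => ?_).trans
      (Finset.sum_le_sum_of_subset_of_nonneg (Finset.filter_subset _ _)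
        fun _ _ _ => by positivity)
    rw [← Real.rpow_natCast y]
    exact Real.rpow_le_rpow_of_exponent_ge hy0 hy1 (Finset.mem_filter.1 hv).2
  have hentropy : (q : ℝ) ^ (s * Hq q δ) * y ^ (s * δ) = (1 / (1 - δ)) ^ s := by
    rw [← Real.rpow_natCast (1 / (1 - δ)), Real.rpow_def_of_pos (by linarith),
      Real.rpow_def_of_pos hy0, Real.rpow_def_of_pos (by positivity), ← Real.exp_add, hy,
      Real.log_div (by positivity) (by positivity), Real.log_mul (by positivity) (by positivity),
      Real.log_div (by positivity) (by positivity), Real.log_one]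
    unfold Hq Real.logb
    congr 1
    field_simp
    ring
  exact le_of_mul_le_mul_right (hmain.trans hentropy.ge) (by positivity)

lemma Hq_lt_one (q : ℕ) (hq : 2 ≤ q) {δ : ℝ} (h0 : 0 < δ) (h1 : δ < ((q : ℝ) - 1) / q) :
    Hq q δ < 1 := by
  have hq2 : (2 : ℝ) ≤ q := by exact_mod_cast hq
  have hlogq : 0 < Real.log q := Real.log_pos (by linarith)
  have hHq (x : ℝ) : Hq q x = Real.qaryEntropy q x / Real.log q := by
    rw [Real.qaryEntropy, Real.binEntropy_eq_negMulLog_add_negMulLog_one_sub]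
    simp only [Hq, Real.logb, Real.negMulLog]
    push_cast
    ring
  have hval : Real.qaryEntropy q (1 - 1 / (q : ℝ)) = Real.log q := by
    rw [Real.qaryEntropy, Real.binEntropy_eq_negMulLog_add_negMulLog_one_sub]
    have hpos : (0 : ℝ) < q - 1 := by linarith
    have hlog : Real.log (1 - 1 / (q : ℝ)) = Real.log (q - 1) - Real.log q := by
      rw [← Real.log_div (by positivity) (by positivity)]
      congr 1
      field_simp
    simp only [Real.negMulLog, sub_sub_cancel, hlog]
    push_cast
    rw [one_div, Real.log_inv]
    ring
  have hle : ((q : ℝ) - 1) / q = 1 - 1 / q := by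
    field_simp
  rw [hle] at h1
  rw [hHq, div_lt_one hlogq, ← hval]
  exact Real.qaryEntropy_strictMonoOn hq ⟨h0.le, h1.le⟩ ⟨h0.le.trans h1.le, le_rfl⟩ h1

/-- Disjoint pairs of coordinates of a uniformly random assignment, one for each `z`, are
simultaneously close with probability at most the `card Z`-th power of the probability that a
uniform word lies in the ball. -/
lemma card_forall_hammingDist_le {A M Z ι G : Type*} [Fintype A] [Fintype M] [Fintype Z]
    [Fintype ι] [Fintype G] [DecidableEq A] [DecidableEq M] [DecidableEq Z] [DecidableEq ι]
    [DecidableEq G] [AddCommGroup G] (k : A) (x y : Z → M) (hxy : ∀ z, x z ≠ y z) (r : ℝ) :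
    ((Finset.univ.filter fun ω : A × M × Z → ι → G =>
        ∀ z, (hammingDist (ω (k, x z, z)) (ω (k, y z, z)) : ℝ) ≤ r).card : ℝ) ≤
      (((Finset.univ.filter fun v : ι → G => (hammingNorm v : ℝ) ≤ r).card : ℝ) /
          Fintype.card (ι → G)) ^ Fintype.card Z * Fintype.card (A × M × Z → ι → G) := by
  set B : Finset (ι → G) := Finset.univ.filter fun v => (hammingNorm v : ℝ) ≤ r with hB
  let Φ : (A × M × Z → ι → G) → A × M × Z → ι → G := fun ω i =>
    if i.1 = k ∧ i.2.1 = x i.2.2 then ω i - ω (k, y i.2.2, i.2.2) else ω i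
  have hx (ω : A × M × Z → ι → G) (z : Z) :
      Φ ω (k, x z, z) = ω (k, x z, z) - ω (k, y z, z) := by simp [Φ]
  have hother (ω : A × M × Z → ι → G) (i : A × M × Z) (hi : ¬(i.1 = k ∧ i.2.1 = x i.2.2)) :
      Φ ω i = ω i := if_neg hi
  have hinj : Function.Injective Φ := by
    intro ω ω' h
    have hi' (i : A × M × Z) (hi : ¬(i.1 = k ∧ i.2.1 = x i.2.2)) : ω i = ω' i := by
      rw [← hother ω i hi, ← hother ω' i hi, h]
    ext1 ⟨a, m, z⟩
    by_cases hi : a = k ∧ m = x z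
    · obtain ⟨rfl, rfl⟩ := hi
      have := congrFun h (a, x z, z)
      rw [hx, hx, hi' (a, y z, z) fun h => hxy z h.2.symm] at this
      exact sub_left_injective this
    · exact hi' _ hi
  let F : A × M × Z → Finset (ι → G) := fun i =>
    if i.1 = k ∧ i.2.1 = x i.2.2 then B else Finset.univ
  have hcard : (Finset.univ.filter fun ω : A × M × Z → ι → G =>
      ∀ z, (hammingDist (ω (k, x z, z)) (ω (k, y z, z)) : ℝ) ≤ r).card ≤
      (Fintype.piFinset F).card := by
    refine Finset.card_le_card_of_injOn Φ (fun ω hω => ?_) hinj.injOn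
    simp only [Finset.coe_filter, Finset.mem_univ, true_and, Set.mem_ofPred_eq] at hω
    simp only [Finset.mem_coe, Fintype.mem_piFinset]
    rintro ⟨a, m, z⟩
    by_cases hi : a = k ∧ m = x z
    · obtain ⟨rfl, rfl⟩ := hi
      simp only [F, and_self, if_true, hx, hB, Finset.mem_filter, Finset.mem_univ, true_and]
      rw [← neg_add_eq_sub, ← hammingDist_eq_hammingNorm, hammingDist_comm]
      exact hω z
    · simp only [F, if_neg hi, Finset.mem_univ]
  have hN : (Fintype.card (ι → G) : ℝ) ≠ 0 := by
    exact_mod_cast Fintype.card_ne_zero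
  have hprod : ((Fintype.piFinset F).card : ℝ) =
      ((B.card : ℝ) / Fintype.card (ι → G)) ^ Fintype.card Z *
        Fintype.card (A × M × Z → ι → G) := by
    have hterm (i : A × M × Z) : ((F i).card : ℝ) =
        (if i.1 = k ∧ i.2.1 = x i.2.2 then (B.card : ℝ) / Fintype.card (ι → G) else 1) *
          Fintype.card (ι → G) := by
      by_cases hi : i.1 = k ∧ i.2.1 = x i.2.2
      · simp only [F, if_pos hi, div_mul_cancel₀ _ hN]
      · simp only [F, if_neg hi, one_mul, Finset.card_univ]
    have hgraph : (Finset.univ.filter fun i : A × M × Z => i.1 = k ∧ i.2.1 = x i.2.2).card =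
        Fintype.card Z := by
      rw [← Finset.card_univ (α := Z)]
      symm
      refine Finset.card_bij (fun z _ => (k, x z, z)) (by simp) (by simp) ?_
      rintro ⟨a, m, z⟩ h
      obtain ⟨rfl, rfl⟩ : a = k ∧ m = x z := (Finset.mem_filter.1 h).2
      exact ⟨z, Finset.mem_univ _, rfl⟩
    rw [Fintype.card_piFinset, Nat.cast_prod, Finset.prod_congr rfl fun i _ => hterm i,
      Finset.prod_mul_distrib, Finset.prod_ite, Finset.prod_const, Finset.prod_const_one, mul_one,
      hgraph, Finset.prod_const, Finset.card_univ, Fintype.card_fun (α := A × M × Z)]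
    push_cast
    rfl
  rw [← hprod]
  exact_mod_cast hcard

/-- The union bound over the index `k`, the set `S` and the choice of one pair from `S` for each
`z`. -/
lemma card_exists_close_pairs_le {A M Z ι G : Type*} [Fintype A] [Fintype M] [Fintype Z]
    [Fintype ι] [Fintype G] [DecidableEq A] [DecidableEq M] [DecidableEq Z] [DecidableEq ι]
    [DecidableEq G] [AddCommGroup G] (m₀ : ℕ) (r : ℝ) :
    (Nat.card {ω : A × M × Z → ι → G // ∃ k : A, ∃ S : Finset M, S.card = m₀ ∧
        ∀ z, ∃ m' ∈ S, ∃ m'' ∈ S, m' ≠ m'' ∧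
          (hammingDist (ω (k, m', z)) (ω (k, m'', z)) : ℝ) ≤ r} : ℝ) ≤
      Fintype.card A * (Fintype.card M).choose m₀ * (m₀.choose 2 : ℝ) ^ Fintype.card Z *
        ((((Finset.univ.filter fun v : ι → G => (hammingNorm v : ℝ) ≤ r).card : ℝ) /
          Fintype.card (ι → G)) ^ Fintype.card Z * Fintype.card (A × M × Z → ι → G)) := by
  classical
  set P : ℝ := (((Finset.univ.filter fun v : ι → G => (hammingNorm v : ℝ) ≤ r).card : ℝ) /
    Fintype.card (ι → G)) ^ Fintype.card Z * Fintype.card (A × M × Z → ι → G)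
  let close (k : A) (f : Z → Finset M) : Finset (A × M × Z → ι → G) :=
    Finset.univ.filter fun ω => ∀ z, ∃ m' m'', f z = {m', m''} ∧
      (hammingDist (ω (k, m', z)) (ω (k, m'', z)) : ℝ) ≤ r
  have hclose (k : A) (S : Finset M) (f : Z → Finset M)
      (hf : f ∈ Fintype.piFinset fun _ => S.powersetCard 2) : ((close k f).card : ℝ) ≤ P := by
    have hpair (z : Z) : ∃ m' m'', m' ≠ m'' ∧ f z = {m', m''} :=
      Finset.card_eq_two.1 (Finset.mem_powersetCard.1 (Fintype.mem_piFinset.1 hf z)).2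
    choose x y hxy hfxy using hpair
    refine le_trans ?_ (card_forall_hammingDist_le k x y hxy r)
    refine Nat.cast_le.2 (Finset.card_le_card fun ω hω => ?_)
    simp only [close, Finset.mem_filter, Finset.mem_univ, true_and] at hω ⊢
    intro z
    obtain ⟨m', m'', hm, hd⟩ := hω z
    rw [hfxy z] at hm
    rw [← Finset.coe_inj, Finset.coe_pair, Finset.coe_pair, Set.pair_eq_pair_iff] at hm
    obtain ⟨h1, h2⟩ | ⟨h1, h2⟩ := hm
    · rwa [h1, h2]
    · rwa [h1, h2, hammingDist_comm]
  rw [Nat.card_eq_fintype_card, Fintype.card_subtype]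
  have hsub : (Finset.univ.filter fun ω : A × M × Z → ι → G => ∃ k : A, ∃ S : Finset M,
      S.card = m₀ ∧ ∀ z, ∃ m' ∈ S, ∃ m'' ∈ S, m' ≠ m'' ∧
        (hammingDist (ω (k, m', z)) (ω (k, m'', z)) : ℝ) ≤ r) ⊆
      Finset.univ.biUnion fun k => (Finset.univ.powersetCard m₀).biUnion fun S =>
        (Fintype.piFinset fun _ : Z => S.powersetCard 2).biUnion (close k) := by
    intro ω hω
    obtain ⟨k, S, hS, h⟩ := (Finset.mem_filter.1 hω).2
    choose x hx y hy hxy hd using h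
    simp only [Finset.mem_biUnion, Finset.mem_univ, true_and, Fintype.mem_piFinset,
      Finset.mem_powersetCard, Finset.subset_univ, close, Finset.mem_filter]
    refine ⟨k, S, hS, fun z => {x z, y z}, fun z => ⟨?_, Finset.card_pair (hxy z)⟩,
      fun z => ⟨x z, y z, rfl, hd z⟩⟩
    simp [Finset.insert_subset_iff, hx z, hy z]
  calc _ ≤ ∑ k : A, ∑ S ∈ Finset.univ.powersetCard m₀,
        ∑ f ∈ Fintype.piFinset fun _ : Z => (S : Finset M).powersetCard 2,
          ((close k f).card : ℝ) := by
        exact_mod_cast (Finset.card_le_card hsub).trans <| Finset.card_biUnion_le.trans <|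
          Finset.sum_le_sum fun k _ => Finset.card_biUnion_le.trans <|
            Finset.sum_le_sum fun S _ => Finset.card_biUnion_le
    _ ≤ ∑ k : A, ∑ S ∈ (Finset.univ : Finset M).powersetCard m₀,
        (m₀.choose 2 : ℝ) ^ Fintype.card Z * P := by
        refine Finset.sum_le_sum fun k _ => Finset.sum_le_sum fun S hS => ?_
        refine (Finset.sum_le_sum fun f hf => hclose k S f hf).trans_eq ?_
        rw [Finset.sum_const, Fintype.card_piFinset, Finset.prod_const, Finset.card_powersetCard,
          (Finset.mem_powersetCard.1 hS).2, Finset.card_univ, nsmul_eq_mul, Nat.cast_pow]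
    _ = _ := by
        simp only [Finset.sum_const, Finset.card_powersetCard, Finset.card_univ, nsmul_eq_mul]
        ring

/-- Feedback distance property of a random code (Lemma thm:cb_fb).
With `θ = 1/K = s/n`, `T = 1/θ − 1 = K − 1`, `δ = (q−1)(1−ε_L)(1+ε_L)/q` and `m₀ = L/θ`
an integer ≥ 2, let the sub-codewords `X_{k,m,z}` (k ∈ {1,…,T}, m ∈ M, z ∈ Z) be
independent uniform on `X^{θn}`, modeled as a uniformly random assignment `ω`. Let `E`
be the event that for some `k` and some `S ⊆ M` with `|S| = L/θ`, for every `z ∈ Z`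
there are distinct `m′, m″ ∈ S` with `d_H(X_{k,m′,z}, X_{k,m″,z}) ≤ θn·δ`. Then
`P(E) ≤ T · C(L/θ,2)^{|Z|} · q^{RnL/θ − |Z|θn(1−H_q(δ))}`; in particular, if
`|Z| > RL/(θ²(1−H_q(δ)))` then `P(E) ≤ T · C(L/θ,2)^{|Z|} · q^{−cn}` with
`c = |Z|·θ·(1−H_q(δ)) − RL/θ > 0`, so `P(E) → 0` exponentially fast in `n`. -/
theorem feedback_distance_random_code (q : ℕ) (hq : 2 ≤ q)
    (R εL θ : ℝ) (L : ℕ) (hR : 0 < R) (hεL0 : 0 < εL) (hεL1 : εL < 1)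
    (hθ0 : 0 < θ) (hθ1 : θ < 1)
    (n s K m₀ : ℕ) (hs : 0 < s) (hsθ : (s : ℝ) = θ * n) (hK : (K : ℝ) = 1 / θ)
    (hm₀ : (m₀ : ℝ) = (L : ℝ) / θ) (hm₀2 : 2 ≤ m₀)
    (M : Type) [Fintype M] (hM : (Fintype.card M : ℝ) ≤ (q : ℝ) ^ (R * n))
    (Z : Type) [Fintype Z] :
    (Nat.card {ω : Fin (K - 1) × M × Z → Fin s → Fin q //
        ∃ k : Fin (K - 1), ∃ S : Finset M, S.card = m₀ ∧
          ∀ z : Z, ∃ m' ∈ S, ∃ m'' ∈ S, m' ≠ m'' ∧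
            (Nat.card {i : Fin s // ω (k, m', z) i ≠ ω (k, m'', z) i} : ℝ) ≤
              θ * n * (((q : ℝ) - 1) * (1 - εL) * (1 + εL) / q)} : ℝ) /
      (Nat.card (Fin (K - 1) × M × Z → Fin s → Fin q) : ℝ) ≤
        ((K : ℝ) - 1) * ((m₀ : ℝ) * ((m₀ : ℝ) - 1) / 2) ^ (Fintype.card Z) *
          (q : ℝ) ^ (R * n * m₀ -
            (Fintype.card Z : ℝ) * θ * n *
              (1 - Hq q (((q : ℝ) - 1) * (1 - εL) * (1 + εL) / q))) ∧
    ((R * L / (θ ^ 2 * (1 - Hq q (((q : ℝ) - 1) * (1 - εL) * (1 + εL) / q))) <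
        (Fintype.card Z : ℝ)) →
      0 < (Fintype.card Z : ℝ) * θ *
            (1 - Hq q (((q : ℝ) - 1) * (1 - εL) * (1 + εL) / q)) - R * L / θ ∧
      (Nat.card {ω : Fin (K - 1) × M × Z → Fin s → Fin q //
          ∃ k : Fin (K - 1), ∃ S : Finset M, S.card = m₀ ∧
            ∀ z : Z, ∃ m' ∈ S, ∃ m'' ∈ S, m' ≠ m'' ∧
              (Nat.card {i : Fin s // ω (k, m', z) i ≠ ω (k, m'', z) i} : ℝ) ≤
                θ * n * (((q : ℝ) - 1) * (1 - εL) * (1 + εL) / q)} : ℝ) /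
        (Nat.card (Fin (K - 1) × M × Z → Fin s → Fin q) : ℝ) ≤
          ((K : ℝ) - 1) * ((m₀ : ℝ) * ((m₀ : ℝ) - 1) / 2) ^ (Fintype.card Z) *
            (q : ℝ) ^ (-(((Fintype.card Z : ℝ) * θ *
              (1 - Hq q (((q : ℝ) - 1) * (1 - εL) * (1 + εL) / q)) - R * L / θ) *
                (n : ℝ)))) := by
  have hq2 : (2 : ℝ) ≤ q := by exact_mod_cast hq
  have : NeZero q := ⟨by omega⟩
  set δ : ℝ := ((q : ℝ) - 1) * (1 - εL) * (1 + εL) / q with hδ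
  have hδ0 : 0 < δ := by
    have h1 : (0 : ℝ) < q - 1 := by linarith
    have h2 : 0 < 1 - εL := by linarith
    positivity
  have hδ1 : δ < ((q : ℝ) - 1) / q := by
    refine div_lt_div_of_pos_right ?_ (by linarith)
    have h1 : (0 : ℝ) < q - 1 := by linarith
    nlinarith [mul_pos h1 (mul_pos hεL0 hεL0)]
  have hH : 0 < 1 - Hq q δ := sub_pos.2 (Hq_lt_one q hq hδ0 hδ1)
  have hK1 : 1 ≤ K := by
    have : (1 : ℝ) < K := by rw [hK]; exact (one_lt_div hθ0).2 hθ1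
    exact_mod_cast this.le
  have hbound : (Nat.card {ω : Fin (K - 1) × M × Z → Fin s → Fin q //
        ∃ k : Fin (K - 1), ∃ S : Finset M, S.card = m₀ ∧
          ∀ z : Z, ∃ m' ∈ S, ∃ m'' ∈ S, m' ≠ m'' ∧
            (Nat.card {i : Fin s // ω (k, m', z) i ≠ ω (k, m'', z) i} : ℝ) ≤ θ * n * δ} : ℝ) /
      (Nat.card (Fin (K - 1) × M × Z → Fin s → Fin q) : ℝ) ≤
        ((K : ℝ) - 1) * ((m₀ : ℝ) * ((m₀ : ℝ) - 1) / 2) ^ (Fintype.card Z) *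
          (q : ℝ) ^ (R * n * m₀ - (Fintype.card Z : ℝ) * θ * n * (1 - Hq q δ)) := by
    classical
    have hcount := card_exists_close_pairs_le (A := Fin (K - 1)) (M := M) (Z := Z) (ι := Fin s)
      (G := Fin q) m₀ (s * δ)
    have hdist (v w : Fin s → Fin q) : Nat.card {i : Fin s // v i ≠ w i} = hammingDist v w := by
      rw [Nat.card_eq_fintype_card, Fintype.card_subtype]
      rfl
    simp only [hdist, ← hsθ]
    have hball := card_hammingNorm_le q hq (Fintype.card_fin q) s hδ0 hδ1
    have hsize : (Fintype.card (Fin s → Fin q) : ℝ) = (q : ℝ) ^ (s : ℝ) := by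
      simp
    have hp : ((Finset.univ.filter fun v : Fin s → Fin q =>
        (hammingNorm v : ℝ) ≤ s * δ).card : ℝ) / Fintype.card (Fin s → Fin q) ≤
        (q : ℝ) ^ (-(s * (1 - Hq q δ))) := by
      rw [hsize, div_le_iff₀ (by positivity), ← Real.rpow_add (by linarith)]
      refine hball.trans_eq ?_
      congr 1
      ring
    have hchoose : ((Fintype.card M).choose m₀ : ℝ) ≤ (q : ℝ) ^ (R * n * m₀) := by
      rw [Real.rpow_mul (by linarith), Real.rpow_natCast]
      refine le_trans ?_ (pow_le_pow_left₀ (Nat.cast_nonneg _) hM m₀)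
      exact_mod_cast Nat.choose_le_pow _ _
    rw [Nat.card_eq_fintype_card (α := Fin (K - 1) × M × Z → Fin s → Fin q),
      div_le_iff₀ (by exact_mod_cast Fintype.card_pos)]
    refine hcount.trans ?_
    rw [← mul_assoc]
    refine mul_le_mul_of_nonneg_right ?_ (Nat.cast_nonneg _)
    rw [Fintype.card_fin, Nat.cast_sub hK1, Nat.cast_one, Nat.cast_choose_two]
    have hT : (0 : ℝ) ≤ K - 1 := sub_nonneg.2 (by exact_mod_cast hK1)
    have hm1 : (0 : ℝ) ≤ m₀ - 1 := sub_nonneg.2 (by exact_mod_cast (by omega : 1 ≤ m₀))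
    have hexp : (q : ℝ) ^ (R * n * m₀ - (Fintype.card Z : ℝ) * θ * n * (1 - Hq q δ)) =
        (q : ℝ) ^ (R * n * m₀) * ((q : ℝ) ^ (-(s * (1 - Hq q δ)))) ^ Fintype.card Z := by
      rw [← Real.rpow_mul_natCast (by linarith), ← Real.rpow_add (by linarith), hsθ]
      congr 1
      ring
    rw [hexp]
    calc _ ≤ ((K : ℝ) - 1) * (q : ℝ) ^ (R * n * m₀) *
          ((m₀ : ℝ) * ((m₀ : ℝ) - 1) / 2) ^ Fintype.card Z *
            ((q : ℝ) ^ (-(s * (1 - Hq q δ)))) ^ Fintype.card Z := by gcongr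
      _ = _ := by ring
  refine ⟨hbound, fun hZ => ⟨?_, hbound.trans_eq ?_⟩⟩
  · rw [div_lt_iff₀ (by positivity)] at hZ
    rw [sub_pos, div_lt_iff₀ hθ0]
    linarith
  · congr 2
    rw [hm₀]
    ring
end

section
/- Low-type trajectory lemma (Lemma thm:low_traj). There exists ε⁰ > 0, depending only on q, p, r, and ε_R, such that for every ε_L ∈ (0, ε⁰) and every θ ∈ (0, ε_L): for every admissible n and every error–erasure pattern for which t_min exists, if p̂_{t_min} ≥ p_{t_min}, then n·r − Λ_{t_min} + 2·(n·p − (t_min − Λ_{t_min})·p_{t_min}) ≤ (q−1)(1−ε_L)(n − t_min)/q. -/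
/-- An error–erasure pattern for blocklength `n = s·K` with feedback resolution
`θ = 1/K = s/n`, error fraction `p` and erasure fraction `r`. The time instants of
the set `T = {θn, 2θn, …, (1−θ)n}` are `t = j·s` for `j = 1,…,K−1`; `lam j` is the
cumulative number of erasures among the first `j·s` positions and `E j` the cumulative
number of symbol errors among the first `j·s − lam j` unerased positions. -/
structure EEPattern (p r : ℝ) (n s K : ℕ) where
  lam : ℕ → ℕ
  E : ℕ → ℕ
  mono_lam : ∀ j : ℕ, 1 ≤ j → j + 1 ≤ K - 1 → lam j ≤ lam (j + 1)
  mono_E : ∀ j : ℕ, 1 ≤ j → j + 1 ≤ K - 1 → E j ≤ E (j + 1)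
  lam_le : ∀ j : ℕ, 1 ≤ j → j ≤ K - 1 → lam j ≤ j * s ∧ (lam j : ℝ) ≤ r * n
  E_le : ∀ j : ℕ, 1 ≤ j → j ≤ K - 1 → E j + lam j ≤ j * s ∧ (E j : ℝ) ≤ p * n
  incr : ∀ j : ℕ, 2 ≤ j → j ≤ K - 1 →
    (lam j - lam (j - 1)) + (E j - E (j - 1)) ≤ s

namespace EEPattern

variable {p r : ℝ} {n s K : ℕ}

/-- The adversary's error trajectory `p_t = E_t/(t − Λ_t)` at time `t = j·s`. -/
noncomputable def pt (P : EEPattern p r n s K) (j : ℕ) : ℝ :=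
  (P.E j : ℝ) / (((j * s : ℕ) : ℝ) - (P.lam j : ℝ))

end EEPattern

/-- The set of indices `j` (times `t = j·s ∈ T`) at which `t − Λ_t > n(R + ε_L)`;
`t_min` is its least element. -/
def tminSet (R εL : ℝ) {p r : ℝ} {n s K : ℕ} (P : EEPattern p r n s K) : Set ℕ :=
  {j : ℕ | 1 ≤ j ∧ j ≤ K - 1 ∧ (n : ℝ) * (R + εL) < ((j * s : ℕ) : ℝ) - (P.lam j : ℝ)}

/-- `phat` is a reference trajectory for the pattern `P` (relative to `jmin = t_min/s`):
for every time `t = j·s ∈ T` with `t ≥ t_min`, `p̂_t ∈ [0,(q−1)/q]` and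
`(t − Λ_t)(1 − H_q(p̂_t)) = n(R + ε_L)`. -/
def IsRefTraj (q : ℕ) (R εL : ℝ) {p r : ℝ} {n s K : ℕ}
    (P : EEPattern p r n s K) (jmin : ℕ) (phat : ℕ → ℝ) : Prop :=
  ∀ j : ℕ, jmin ≤ j → j ≤ K - 1 →
    phat j ∈ Set.Icc (0 : ℝ) (((q : ℝ) - 1) / q) ∧
    (((j * s : ℕ) : ℝ) - (P.lam j : ℝ)) * (1 - Hq q (phat j)) = (n : ℝ) * (R + εL)

theorem Hq_zero (q : ℕ) : Hq q 0 = 0 := by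
  simp [Hq]

theorem C0_le_alphaEE_zero {q : ℕ} {p r : ℝ} (hp : 0 ≤ p) (hC : 0 < C0 q p r) :
    C0 q p r ≤ alphaEE q p r 0 := by
  have hbdd : BddBelow ((fun pb => alphaEE q p r pb * (1 - Hq q (pb / alphaEE q p r pb))) ''
      Set.Icc 0 p) := by
    by_contra h
    rw [C0, Real.sInf_of_not_bddBelow h] at hC
    exact lt_irrefl _ hC
  exact csInf_le hbdd ⟨0, ⟨le_rfl, hp⟩, by simp [Hq_zero]⟩

/-- At `t_min` the number of unerased positions exceeds the threshold by at most one block. -/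
theorem unerased_le_of_isLeast {R εL : ℝ} {p r : ℝ} {n s K : ℕ} {P : EEPattern p r n s K}
    {j : ℕ} (hR : 0 ≤ R + εL) (hj : IsLeast (tminSet R εL P) j) :
    ((j * s : ℕ) : ℝ) - P.lam j ≤ n * (R + εL) + s := by
  obtain ⟨⟨hj1, hjK, -⟩, hmin⟩ := hj
  obtain ⟨i, rfl⟩ : ∃ i, j = i + 1 := ⟨j - 1, by omega⟩
  have hn : 0 ≤ (n : ℝ) * (R + εL) := mul_nonneg n.cast_nonneg hR
  rcases Nat.eq_zero_or_pos i with rfl | hi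
  · have : (0 : ℝ) ≤ P.lam (0 + 1) := Nat.cast_nonneg _
    push_cast
    linarith
  · have hnot : ¬ (n : ℝ) * (R + εL) < ((i * s : ℕ) : ℝ) - P.lam i := fun h => by
      have : i + 1 ≤ i := hmin ⟨hi, by omega, h⟩
      omega
    have hlam : (P.lam i : ℝ) ≤ P.lam (i + 1) := by exact_mod_cast P.mono_lam i hi hjK
    push_cast at hnot ⊢
    linarith

/-- Low-type trajectory lemma (Lemma thm:low_traj). There exists ε⁰ > 0,
depending only on q, p, r, ε_R, such that for every ε_L ∈ (0, ε⁰) and every θ ∈ (0, ε_L):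
for every admissible n and every error–erasure pattern for which t_min exists, if
p̂_{t_min} ≥ p_{t_min}, then
n·r − Λ_{t_min} + 2·(n·p − (t_min − Λ_{t_min})·p_{t_min}) ≤ (q−1)(1−ε_L)(n − t_min)/q. -/
theorem low_type_trajectory (q : ℕ) (hq : 2 ≤ q) (p r : ℝ)
    (hp : p ∈ Set.Icc (0 : ℝ) 1) (hr : r ∈ Set.Icc (0 : ℝ) 1)
    (hpr : 2 * p + r < ((q : ℝ) - 1) / q)
    (εR : ℝ) (hεR0 : 0 < εR) (hεR1 : εR < C0 q p r) :
    ∃ ε0 : ℝ, 0 < ε0 ∧ ∀ εL : ℝ, 0 < εL → εL < ε0 →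
      ∀ (θ : ℝ) (n s K : ℕ), 0 < θ → θ < 1 → 0 < s →
        (s : ℝ) = θ * n → (K : ℝ) = 1 / θ → θ < εL →
      ∀ P : EEPattern p r n s K, ∀ jmin : ℕ,
        IsLeast (tminSet (C0 q p r - εR) εL P) jmin →
      ∀ phat : ℕ → ℝ, IsRefTraj q (C0 q p r - εR) εL P jmin phat →
      P.pt jmin ≤ phat jmin →
        (n : ℝ) * r - P.lam jmin +
            2 * ((n : ℝ) * p - (((jmin * s : ℕ) : ℝ) - P.lam jmin) * P.pt jmin) ≤
          ((q : ℝ) - 1) * (1 - εL) * ((n : ℝ) - ((jmin * s : ℕ) : ℝ)) / q := by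
  have hq2 : (2 : ℝ) ≤ q := by exact_mod_cast hq
  have hC := C0_le_alphaEE_zero hp.1 (hεR0.trans hεR1)
  set c : ℝ := ((q : ℝ) - 1) / q with hc
  have hc0 : 0 < c := div_pos (by linarith) (by linarith)
  have hc1 : c ≤ 1 := by rw [hc, div_le_one (by linarith)]; linarith
  have hα : c * alphaEE q p r 0 = c - (2 * p + r) := by
    have : (q : ℝ) - 1 ≠ 0 := by linarith
    rw [hc, alphaEE]
    field_simp
    ring
  refine ⟨min (εR / 8) (1 / 2), by positivity, ?_⟩
  intro εL hεL hεL0 θ n s K _ _ _ hs _ hθε P jmin hjmin phat _ _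
  obtain ⟨hε8, hε2⟩ := lt_min_iff.mp hεL0
  have hx := unerased_le_of_isLeast (by linarith) hjmin
  have hn : (0 : ℝ) ≤ n := n.cast_nonneg
  have hx0 : 0 ≤ ((jmin * s : ℕ) : ℝ) - P.lam jmin :=
    (mul_nonneg hn (by linarith)).trans hjmin.1.2.2.le
  have herr : 0 ≤ (((jmin * s : ℕ) : ℝ) - P.lam jmin) * P.pt jmin :=
    mul_nonneg hx0 (div_nonneg (Nat.cast_nonneg _) hx0)
  have hlam : (0 : ℝ) ≤ P.lam jmin := Nat.cast_nonneg _
  generalize ((jmin * s : ℕ) : ℝ) = t at *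
  generalize (P.lam jmin : ℝ) = l at *
  have hrem : n * (1 - alphaEE q p r 0 + εR - 2 * εL) ≤ n - (t - l) := by
    have h1 : (n : ℝ) * C0 q p r ≤ n * alphaEE q p r 0 := by gcongr
    have h2 : θ * n ≤ εL * n := by gcongr
    linarith
  have hbudget : 2 * p + r ≤ c * (1 - εL) * (1 - alphaEE q p r 0 + εR - 2 * εL) := by
    have h1 : εL * (2 * p + r) ≤ εL * c := by gcongr
    have h2 : εL ≤ (1 - εL) * (εR - 2 * εL) := by nlinarith
    have h3 : c * εL ≤ c * ((1 - εL) * (εR - 2 * εL)) := by gcongr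
    have h4 : c * (1 - εL) * (1 - alphaEE q p r 0 + εR - 2 * εL) =
        (1 - εL) * (2 * p + r) + c * ((1 - εL) * (εR - 2 * εL)) := by
      linear_combination (εL - 1) * hα
    linarith
  have hk : 0 ≤ c * (1 - εL) := mul_nonneg hc0.le (by linarith)
  have hk1 : c * (1 - εL) ≤ 1 := mul_le_one₀ hc1 (by linarith) (by linarith)
  have hmain : (n : ℝ) * (2 * p + r) ≤ c * (1 - εL) * (n - (t - l)) := by
    calc (n : ℝ) * (2 * p + r)
        ≤ n * (c * (1 - εL) * (1 - alphaEE q p r 0 + εR - 2 * εL)) := by gcongr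
      _ = c * (1 - εL) * (n * (1 - alphaEE q p r 0 + εR - 2 * εL)) := by ring
      _ ≤ c * (1 - εL) * (n - (t - l)) := by gcongr
  have hl : c * (1 - εL) * l ≤ l := mul_le_of_le_one_left hlam hk1
  have hgoal : ((q : ℝ) - 1) * (1 - εL) * (n - t) / q = c * (1 - εL) * (n - t) := by
    rw [hc]
    ring
  rw [hgoal]
  linarith
end

section
/- High-type trajectory lemma (Lemma thm:high_traj). There exists ε⁰ > 0, depending only on q, p, r, and ε_R, such that for every ε_L ∈ (0, ε⁰) there exists θ⁰ ∈ (0, ε_L] such that for every θ ∈ (0, θ⁰): for every admissible n and every error–erasure pattern for which t_min exists, if p̂_{t_min} < p_{t_min}, then the smallest t** ∈ T with t** ≥ t_min and p̂_{t**} ≥ p_{t**} exists, and it satisfies n·r − Λ_{t**} + 2·(n·p − (t** − Λ_{t**})·p_{t**}) ≤ (q−1)(1−ε_L)(1+ε_L)(n − t**)/q. -/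
theorem mul_log_sub_mul_log_le {y z : ℝ} (hy : 0 < y) (hz : 0 ≤ z) :
    z * Real.log y - z * Real.log z ≤ y - z := by
  rcases hz.eq_or_lt with rfl | hz
  · simpa using hy.le
  · have h := Real.log_le_sub_one_of_pos (div_pos hy hz)
    rw [Real.log_div hy.ne' hz.ne'] at h
    have h2 := mul_le_mul_of_nonneg_left h hz.le
    have h3 : z * (y / z - 1) = y - z := by field_simp
    linarith

/-- The tangent line to `Hq q` at `y` lies above its graph. -/
theorem Hq_le_tangent {q : ℕ} (hq : 2 ≤ q) {y z : ℝ} (hy0 : 0 < y) (hy1 : y < 1)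
    (hz0 : 0 ≤ z) (hz1 : z ≤ 1) :
    Hq q z ≤ z * (Real.logb q ((q : ℝ) - 1) + Real.logb q (1 - y) - Real.logb q y)
      - Real.logb q (1 - y) := by
  have hq' : (2 : ℝ) ≤ q := by exact_mod_cast hq
  have hl : 0 < Real.log q := Real.log_pos (by linarith)
  have h1 := mul_log_sub_mul_log_le hy0 hz0
  have h2 := mul_log_sub_mul_log_le (sub_pos.2 hy1) (sub_nonneg.2 hz1)
  have h : 0 ≤ (z * Real.log z + (1 - z) * Real.log (1 - z) - z * Real.log y
      - (1 - z) * Real.log (1 - y)) / Real.log q := div_nonneg (by linarith) hl.le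
  rw [← sub_nonneg]
  convert h using 1
  simp only [Hq, Real.logb]
  field_simp
  ring

theorem Hq_eq_tangent (q : ℕ) (y : ℝ) :
    Hq q y = y * (Real.logb q ((q : ℝ) - 1) + Real.logb q (1 - y) - Real.logb q y)
      - Real.logb q (1 - y) := by
  simp only [Hq]
  ring

theorem neg_one_le_logb_one_sub {q : ℕ} (hq : 2 ≤ q) {y : ℝ} (hy : y ≤ ((q : ℝ) - 1) / q) :
    -1 ≤ Real.logb q (1 - y) := by
  have hq' : (2 : ℝ) ≤ q := by exact_mod_cast hq
  have h1 : (q : ℝ)⁻¹ ≤ 1 - y := by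
    have : ((q : ℝ) - 1) / q = 1 - (q : ℝ)⁻¹ := by field_simp
    linarith
  have h2 := Real.logb_le_logb_of_le (b := q) (by linarith) (by positivity) h1
  rwa [Real.logb_inv, Real.logb_self_eq_one (by linarith)] at h2

/-- The slope of `Hq q` is nonnegative up to `(q - 1) / q`. -/
theorem Hq_slope_nonneg {q : ℕ} (hq : 2 ≤ q) {y : ℝ} (hy0 : 0 < y)
    (hy : y ≤ ((q : ℝ) - 1) / q) :
    0 ≤ Real.logb q ((q : ℝ) - 1) + Real.logb q (1 - y) - Real.logb q y := by
  have hq' : (2 : ℝ) ≤ q := by exact_mod_cast hq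
  have hy1 : y < 1 := hy.trans_lt ((div_lt_one (by linarith)).2 (by linarith))
  rw [← Real.logb_mul (by linarith) (by linarith), sub_nonneg]
  refine Real.logb_le_logb_of_le (by linarith) hy0 ?_
  rw [le_div_iff₀ (by linarith)] at hy
  linarith

theorem Hq_le_one {q : ℕ} (hq : 2 ≤ q) {z : ℝ} (hz0 : 0 ≤ z) (hz1 : z ≤ 1) : Hq q z ≤ 1 := by
  have hq' : (2 : ℝ) ≤ q := by exact_mod_cast hq
  have h1 : 1 - ((q : ℝ) - 1) / q = (q : ℝ)⁻¹ := by field_simp; ring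
  have h := Hq_le_tangent hq (y := ((q : ℝ) - 1) / q) (div_pos (by linarith) (by linarith))
    ((div_lt_one (by linarith)).2 (by linarith)) hz0 hz1
  rw [h1, Real.logb_div (by linarith) (by linarith), Real.logb_inv,
    Real.logb_self_eq_one (by linarith)] at h
  linarith

theorem le_mul_alphaEE {q : ℕ} (hq : 2 ≤ q) {p r x : ℝ}
    (hpr : 2 * p + r < ((q : ℝ) - 1) / q) (hx0 : 0 ≤ x) :
    x ≤ ((q : ℝ) - 1) / q * alphaEE q p r x := by
  have hq' : (2 : ℝ) ≤ q := by exact_mod_cast hq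
  have hq1 : (q : ℝ) - 1 ≠ 0 := by linarith
  have h : ((q : ℝ) - 1) / q * alphaEE q p r x = ((q : ℝ) - 1) / q - 2 * (p - x) - r := by
    simp only [alphaEE]
    field_simp
  linarith

theorem alphaEE_nonneg {q : ℕ} (hq : 2 ≤ q) {p r x : ℝ}
    (hpr : 2 * p + r < ((q : ℝ) - 1) / q) (hx0 : 0 ≤ x) : 0 ≤ alphaEE q p r x := by
  have hq' : (2 : ℝ) ≤ q := by exact_mod_cast hq
  exact nonneg_of_mul_nonneg_right (hx0.trans (le_mul_alphaEE hq hpr hx0))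
    (div_pos (by linarith) (by linarith))

theorem div_alphaEE_mem_Icc {q : ℕ} (hq : 2 ≤ q) {p r x : ℝ}
    (hpr : 2 * p + r < ((q : ℝ) - 1) / q) (hx0 : 0 ≤ x) :
    x / alphaEE q p r x ∈ Set.Icc 0 (((q : ℝ) - 1) / q) := by
  have hq' : (2 : ℝ) ≤ q := by exact_mod_cast hq
  have hA := alphaEE_nonneg hq hpr hx0
  exact ⟨div_nonneg hx0 hA, div_le_of_le_mul₀ hA (div_nonneg (by linarith) (by linarith))
    (le_mul_alphaEE hq hpr hx0)⟩

theorem C0_le {q : ℕ} (hq : 2 ≤ q) {p r x : ℝ}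
    (hpr : 2 * p + r < ((q : ℝ) - 1) / q) (hx : x ∈ Set.Icc 0 p) :
    C0 q p r ≤ alphaEE q p r x * (1 - Hq q (x / alphaEE q p r x)) := by
  have hq' : (2 : ℝ) ≤ q := by exact_mod_cast hq
  refine csInf_le ⟨0, ?_⟩ ⟨x, hx, rfl⟩
  rintro _ ⟨w, hw, rfl⟩
  obtain ⟨h0, h1⟩ := div_alphaEE_mem_Icc hq hpr hw.1
  have h2 := Hq_le_one hq h0 (h1.trans ((div_le_one (by linarith)).2 (by linarith)))
  exact mul_nonneg (alphaEE_nonneg hq hpr hw.1) (by linarith)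

/-- If the error fraction among a fraction `ρ` of unerased positions lies above the reference
value `z`, and `α x` exceeds `ρ` by at most `δ` for some `x` no less than the number of errors,
then the rate defining `z` is within `δ` of `C0`. -/
theorem C0_le_add {q : ℕ} (hq : 2 ≤ q) {p r x ρ z δ : ℝ}
    (hpr : 2 * p + r < ((q : ℝ) - 1) / q) (hxp : x ≤ p) (hρ : 0 < ρ) (hδ : 0 ≤ δ)
    (hz0 : 0 ≤ z) (hz1 : z ≤ 1) (hzx : ρ * z < x) (hα : alphaEE q p r x ≤ ρ + δ) :
    C0 q p r ≤ ρ * (1 - Hq q z) + δ := by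
  have hq' : (2 : ℝ) ≤ q := by exact_mod_cast hq
  have hx0 : 0 < x := (mul_nonneg hρ.le hz0).trans_lt hzx
  have hA0 : 0 < alphaEE q p r x :=
    pos_of_mul_pos_right (hx0.trans_le (le_mul_alphaEE hq hpr hx0.le))
      (div_nonneg (by linarith) (by linarith))
  have hC := C0_le hq hpr ⟨hx0.le, hxp⟩
  have hy := (div_alphaEE_mem_Icc hq hpr hx0.le).2
  have hy0 := div_pos hx0 hA0
  have hyx : alphaEE q p r x * (x / alphaEE q p r x) = x := mul_div_cancel₀ x hA0.ne'
  set A := alphaEE q p r x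
  set y := x / A
  have hy1 : y < 1 := hy.trans_lt ((div_lt_one (by linarith)).2 (by linarith))
  have hT := Hq_le_tangent hq hy0 hy1 hz0 hz1
  rw [Hq_eq_tangent] at hC
  have hb := Hq_slope_nonneg hq hy0 hy
  have ha := neg_one_le_logb_one_sub hq hy
  have ha' : Real.logb q (1 - y) ≤ 0 :=
    Real.logb_nonpos (by linarith) (by linarith) (by linarith)
  set b := Real.logb q ((q : ℝ) - 1) + Real.logb q (1 - y) - Real.logb q y
  set l := Real.logb q (1 - y)
  have h1 := mul_le_mul_of_nonneg_left hT hρ.le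
  have h2 := mul_le_mul_of_nonneg_right hzx.le hb
  have h3 : A * (1 - (y * b - l)) = A * (1 + l) - x * b := by rw [← hyx]; ring
  have h4 : (A - ρ) * (1 + l) ≤ δ * (1 + l) :=
    mul_le_mul_of_nonneg_right (by linarith) (by linarith)
  have h5 : δ * (1 + l) ≤ δ := mul_le_of_le_one_right hδ (by linarith)
  linarith

namespace EEPattern

variable {p r : ℝ} {n s K : ℕ}

theorem C0_le_of_lt_pt {q : ℕ} (hq : 2 ≤ q) (hpr : 2 * p + r < ((q : ℝ) - 1) / q)
    (hn : (0 : ℝ) < n) {L : ℝ} (hL : 0 < L) (P : EEPattern p r n s K) {j : ℕ} {z x δ : ℝ}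
    (hz : z ∈ Set.Icc (0 : ℝ) (((q : ℝ) - 1) / q))
    (hzL : (((j * s : ℕ) : ℝ) - (P.lam j : ℝ)) * (1 - Hq q z) = n * L)
    (hlt : z < P.pt j) (hEx : (P.E j : ℝ) ≤ n * x) (hxp : x ≤ p) (hδ : 0 ≤ δ)
    (hα : n * alphaEE q p r x ≤ ((j * s : ℕ) : ℝ) - (P.lam j : ℝ) + n * δ) :
    C0 q p r ≤ L + δ := by
  have hq' : (2 : ℝ) ≤ q := by exact_mod_cast hq
  have hz1 : z ≤ 1 := hz.2.trans ((div_le_one (by linarith)).2 (by linarith))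
  have hρ : 0 < ((j * s : ℕ) : ℝ) - (P.lam j : ℝ) :=
    pos_of_mul_pos_left (hzL ▸ mul_pos hn hL) (sub_nonneg.2 (Hq_le_one hq hz.1 hz1))
  rw [pt, lt_div_iff₀ hρ] at hlt
  set ρ := ((j * s : ℕ) : ℝ) - (P.lam j : ℝ)
  have hLz : ρ / n * (1 - Hq q z) = L := by
    rw [div_mul_eq_mul_div, hzL, mul_div_cancel_left₀ L hn.ne']
  rw [← hLz]
  refine C0_le_add hq hpr hxp (div_pos hρ hn) hδ hz.1 hz1 ?_ ?_
  · rw [div_mul_eq_mul_div, div_lt_iff₀ hn]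
    linarith
  · rw [← sub_le_iff_le_add, le_div_iff₀ hn]
    linarith

end EEPattern

/-- High-type trajectory lemma (Lemma thm:high_traj). There exists
ε⁰ > 0, depending only on q, p, r, ε_R, such that for every ε_L ∈ (0, ε⁰) there exists
θ⁰ ∈ (0, ε_L] such that for every θ ∈ (0, θ⁰): for every admissible n and every
error–erasure pattern for which t_min exists, if p̂_{t_min} < p_{t_min}, then the
smallest t** ∈ T with t** ≥ t_min and p̂_{t**} ≥ p_{t**} exists, and it satisfies
n·r − Λ_{t**} + 2·(n·p − (t** − Λ_{t**})·p_{t**}) ≤ (q−1)(1−ε_L)(1+ε_L)(n − t**)/q. -/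
theorem high_type_trajectory (q : ℕ) (hq : 2 ≤ q) (p r : ℝ)
    (hp : p ∈ Set.Icc (0 : ℝ) 1) (hr : r ∈ Set.Icc (0 : ℝ) 1)
    (hpr : 2 * p + r < ((q : ℝ) - 1) / q)
    (εR : ℝ) (hεR0 : 0 < εR) (hεR1 : εR < C0 q p r) :
    ∃ ε0 : ℝ, 0 < ε0 ∧ ∀ εL : ℝ, 0 < εL → εL < ε0 →
      ∃ θ0 : ℝ, 0 < θ0 ∧ θ0 ≤ εL ∧
      ∀ (θ : ℝ) (n s K : ℕ), 0 < θ → θ < θ0 → 0 < s →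
        (s : ℝ) = θ * n → (K : ℝ) = 1 / θ →
      ∀ P : EEPattern p r n s K, ∀ jmin : ℕ,
        IsLeast (tminSet (C0 q p r - εR) εL P) jmin →
      ∀ phat : ℕ → ℝ, IsRefTraj q (C0 q p r - εR) εL P jmin phat →
      phat jmin < P.pt jmin →
        ∃ jss : ℕ,
          IsLeast {j : ℕ | jmin ≤ j ∧ j ≤ K - 1 ∧ P.pt j ≤ phat j} jss ∧
          (n : ℝ) * r - P.lam jss +
              2 * ((n : ℝ) * p - (((jss * s : ℕ) : ℝ) - P.lam jss) * P.pt jss) ≤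
            ((q : ℝ) - 1) * (1 - εL) * (1 + εL) * ((n : ℝ) - ((jss * s : ℕ) : ℝ)) / q := by
  have hq' : (2 : ℝ) ≤ q := by exact_mod_cast hq
  have hq1 : (0 : ℝ) < (q : ℝ) - 1 := by linarith
  have hβ : 1 ≤ (q : ℝ) / ((q : ℝ) - 1) := (one_le_div hq1).2 (by linarith)
  refine ⟨min 1 (εR / 3), by positivity, fun εL hεL hεL' => ⟨εL, hεL, le_rfl, ?_⟩⟩
  obtain ⟨hεL1, hεL2⟩ := lt_min_iff.1 hεL'
  intro θ n s K hθ hθL hs hsn hK P jmin hmin phat href hlt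
  have hs' : (0 : ℝ) < s := by exact_mod_cast hs
  have hn : (0 : ℝ) < n := pos_of_mul_pos_right (hsn ▸ hs') hθ.le
  have hsq : εL ^ 2 < εL := by nlinarith
  have hL : 0 < C0 q p r - εR + εL := by linarith
  obtain ⟨hj1, hjK, -⟩ := hmin.1
  have hK1 : ((K - 1 : ℕ) : ℝ) * s = n - n * θ := by
    rw [Nat.cast_sub (by omega), hK, hsn]
    field_simp
    simp
  have hex : ∃ j, jmin ≤ j ∧ j ≤ K - 1 ∧ P.pt j ≤ phat j := by
    refine ⟨K - 1, hjK, le_rfl, ?_⟩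
    by_contra! h
    obtain ⟨hz, hzL⟩ := href (K - 1) hjK le_rfl
    have hE := (P.E_le (K - 1) (by omega) le_rfl).2
    have hlam := (P.lam_le (K - 1) (by omega) le_rfl).2
    have := P.C0_le_of_lt_pt hq hpr hn hL hz hzL h (x := p) (by linarith) le_rfl hθ.le (by
      rw [Nat.cast_mul, hK1]
      have h1 := mul_le_mul_of_nonneg_right hβ (mul_nonneg hr.1 hn.le)
      simp only [alphaEE]
      linarith)
    linarith
  classical
  obtain ⟨hm, hjK', hle⟩ := Nat.find_spec hex
  have hleast : ∀ j, j < Nat.find hex → ¬ (jmin ≤ j ∧ j ≤ K - 1 ∧ P.pt j ≤ phat j) :=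
    fun j hj => Nat.find_min hex hj
  refine ⟨Nat.find hex, ⟨Nat.find_spec hex, fun j hj => Nat.find_min' hex hj⟩, ?_⟩
  generalize Nat.find hex = j at hm hjK' hle hleast
  have hne : jmin ≠ j := by
    rintro rfl
    linarith
  obtain ⟨i, rfl⟩ : ∃ i, j = i + 1 := ⟨j - 1, by omega⟩
  have hlt' : phat i < P.pt i := by
    by_contra! h
    exact hleast i (by omega) ⟨by omega, by omega, h⟩
  obtain ⟨hz, hzL⟩ := href i (by omega) (by omega)
  obtain ⟨hz', hzL'⟩ := href (i + 1) (by omega) (by omega)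
  have hρ : (((i + 1) * s : ℕ) : ℝ) - P.lam (i + 1) ≠ 0 := by
    intro h
    rw [h, zero_mul] at hzL'
    exact (mul_pos hn hL).ne hzL'
  have hEpt : ((((i + 1) * s : ℕ) : ℝ) - P.lam (i + 1)) * P.pt (i + 1) = P.E (i + 1) :=
    mul_div_cancel₀ _ hρ
  rw [hEpt]
  by_contra! hcon
  have hE : (P.E i : ℝ) ≤ P.E (i + 1) := by exact_mod_cast P.mono_E i (by omega) hjK'
  have hlam : (P.lam i : ℝ) ≤ P.lam (i + 1) := by exact_mod_cast P.mono_lam i (by omega) hjK'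
  have hEp := (P.E_le (i + 1) (by omega) hjK').2
  have hnx : (n : ℝ) * (P.E (i + 1) / n) = P.E (i + 1) := mul_div_cancel₀ _ hn.ne'
  have hα : (n : ℝ) * alphaEE q p r (P.E (i + 1) / n) ≤
      ((i * s : ℕ) : ℝ) - P.lam i + n * (θ + εL ^ 2) := by
    have h1 := mul_le_mul_of_nonneg_right hβ (Nat.cast_nonneg (α := ℝ) (P.lam (i + 1)))
    have h2 : (n : ℝ) * alphaEE q p r (P.E (i + 1) / n) = n - (q : ℝ) / ((q : ℝ) - 1) *
        (n * r - P.lam (i + 1) + 2 * (n * p - P.E (i + 1)))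
        - (q : ℝ) / ((q : ℝ) - 1) * P.lam (i + 1) := by
      rw [← hnx]
      simp only [alphaEE, hnx]
      field_simp
      ring
    have h3 := mul_lt_mul_of_pos_left hcon (zero_lt_one.trans_le hβ)
    have h4 : (q : ℝ) / ((q : ℝ) - 1) * (((q : ℝ) - 1) * (1 - εL) * (1 + εL) *
        ((n : ℝ) - (((i + 1) * s : ℕ) : ℝ)) / q) =
        (1 - εL ^ 2) * ((n : ℝ) - (((i + 1) * s : ℕ) : ℝ)) := by
      field_simp
      ring
    have h5 : (((i + 1) * s : ℕ) : ℝ) = ((i * s : ℕ) : ℝ) + n * θ := by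
      push_cast
      linarith
    have h6 : 0 ≤ εL ^ 2 * (((i + 1) * s : ℕ) : ℝ) := by positivity
    rw [h4] at h3
    linarith
  have := P.C0_le_of_lt_pt hq hpr hn hL hz hzL hlt' (hnx.symm ▸ hE)
    ((div_le_iff₀ hn).2 hEp) (by positivity) hα
  linarith
end
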